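/- There exist constants c' > 0 and N_0 such that for all integers N > N_0, every subset S ⊆ {1, 2, ..., N} containing no three-term arithmetic progression satisfies |S| ≤ N · exp(−c'·(log N)^{1/9}). -/

import Mathlib

namespace KelleyMeka

open Finset Real
open scoped Classical

set_option linter.unusedSectionVars false

section Gibbs

variable {G : Type*} [AddCommGroup G] [Fintype G]

/-- A symmetric subadditive length function on a finite abelian group whose exponential sums at
consecutive dyadic scales differ by a factor of at most `exp D`. -/
structure IsBohrLength (N : G → ℝ) (D : ℝ) : Prop where
  zero : N 0 = 0
  neg : ∀ x, N (-x) = N x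
  add : ∀ x y, N (x + y) ≤ N x + N y
  doubling : ∀ s : ℝ, 0 < s → ∑ x, exp (-(s / 2 * N x)) ≤ exp D * ∑ x, exp (-(s * N x))

/-- The exponential sum of a length function at inverse scale `s`. -/
noncomputable def partition (N : G → ℝ) (s : ℝ) : ℝ := ∑ x, exp (-(s * N x))

/-- The probability measure proportional to `exp (-s N)`. -/
noncomputable def gibbs (N : G → ℝ) (s : ℝ) (x : G) : ℝ := exp (-(s * N x)) / partition N s

lemma partition_pos (N : G → ℝ) (s : ℝ) : 0 < partition N s :=
  Finset.sum_pos (fun _ _ => exp_pos _) ⟨0, mem_univ _⟩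

lemma gibbs_pos (N : G → ℝ) (s : ℝ) (x : G) : 0 < gibbs N s x :=
  div_pos (exp_pos _) (partition_pos N s)

lemma gibbs_nonneg (N : G → ℝ) (s : ℝ) (x : G) : 0 ≤ gibbs N s x := (gibbs_pos N s x).le

lemma sum_gibbs (N : G → ℝ) (s : ℝ) : ∑ x, gibbs N s x = 1 := by
  simp only [gibbs, ← Finset.sum_div]
  exact div_self (partition_pos N s).ne'

lemma gibbs_mul (N : G → ℝ) (c s : ℝ) (x : G) :
    gibbs (fun y => c * N y) s x = gibbs N (c * s) x := by
  have h : ∀ y, s * (c * N y) = c * s * N y := fun y => by ring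
  simp only [gibbs, partition, h]

namespace IsBohrLength

variable {N : G → ℝ} {D : ℝ}

lemma nonneg (h : IsBohrLength N D) (x : G) : 0 ≤ N x := by
  have := h.add x (-x)
  rw [add_neg_cancel, h.zero, h.neg] at this
  linarith

lemma sub (h : IsBohrLength N D) (x y : G) : N (x - y) ≤ N x + N y := by
  have := h.add x (-y)
  rwa [h.neg, ← sub_eq_add_neg] at this

lemma gibbs_neg (h : IsBohrLength N D) (s : ℝ) (x : G) : gibbs N s (-x) = gibbs N s x := by
  simp [gibbs, h.neg]

lemma gibbs_add_le (h : IsBohrLength N D) {s : ℝ} (hs : 0 ≤ s) (x t : G) :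
    gibbs N s (x + t) ≤ exp (s * N t) * gibbs N s x := by
  unfold gibbs
  rw [← mul_div_assoc, ← exp_add]
  refine div_le_div_of_nonneg_right (exp_le_exp.2 ?_) (partition_pos N s).le
  have := h.add (x + t) (-t)
  rw [add_neg_cancel_right, h.neg] at this
  nlinarith

lemma gibbs_sub_le (h : IsBohrLength N D) {s : ℝ} (hs : 0 ≤ s) (x t : G) :
    gibbs N s (x - t) ≤ exp (s * N t) * gibbs N s x := by
  have := h.gibbs_add_le hs x (-t)
  rwa [h.neg, ← sub_eq_add_neg] at this

lemma le_gibbs_add (h : IsBohrLength N D) {s : ℝ} (hs : 0 ≤ s) (x t : G) :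
    exp (-(s * N t)) * gibbs N s x ≤ gibbs N s (x + t) := by
  have := h.gibbs_sub_le hs (x + t) t
  rw [add_sub_cancel_right] at this
  calc _ ≤ exp (-(s * N t)) * (exp (s * N t) * gibbs N s (x + t)) := by gcongr
    _ = _ := by rw [← mul_assoc, ← exp_add]; simp

lemma le_gibbs_sub (h : IsBohrLength N D) {s : ℝ} (hs : 0 ≤ s) (x t : G) :
    exp (-(s * N t)) * gibbs N s x ≤ gibbs N s (x - t) := by
  have := h.le_gibbs_add hs x (-t)
  rwa [h.neg, ← sub_eq_add_neg] at this

/-- The mean length under `gibbs N s` is at most `2 D / s`. -/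
lemma sum_gibbs_mul_le (h : IsBohrLength N D) {s : ℝ} (hs : 0 < s) :
    ∑ x, gibbs N s x * N x ≤ 2 * D / s := by
  have hj : exp (∑ x, gibbs N s x • (s / 2 * N x)) ≤ ∑ x, gibbs N s x • exp (s / 2 * N x) :=
    convexOn_exp.map_sum_le (fun x _ => gibbs_nonneg N s x) (sum_gibbs N s) (fun _ _ => trivial)
  have h2 : ∑ x, gibbs N s x • exp (s / 2 * N x) ≤ exp D := by
    have : ∀ x, gibbs N s x • exp (s / 2 * N x) = exp (-(s / 2 * N x)) / partition N s := by
      intro x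
      rw [gibbs, smul_eq_mul, div_mul_eq_mul_div, ← exp_add]
      congr 2; ring
    rw [Finset.sum_congr rfl fun x _ => this x, ← Finset.sum_div, div_le_iff₀ (partition_pos N s)]
    exact h.doubling s hs
  have h3 := exp_le_exp.1 (hj.trans h2)
  have h4 : ∑ x, gibbs N s x • (s / 2 * N x) = s / 2 * ∑ x, gibbs N s x * N x := by
    rw [Finset.mul_sum]
    exact Finset.sum_congr rfl fun x _ => by rw [smul_eq_mul]; ring
  rw [h4] at h3
  rw [le_div_iff₀ hs]
  linarith

/-- Markov's inequality for the length under `gibbs N s`. -/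
lemma le_sum_gibbs_ite (h : IsBohrLength N D) {s δ : ℝ} (hs : 0 < s) (hδ : 0 < δ) :
    1 - 2 * D / (s * δ) ≤ ∑ x, gibbs N s x * (if N x ≤ δ then 1 else 0) := by
  have h1 : ∑ x, gibbs N s x * (1 - N x / δ) ≤
      ∑ x, gibbs N s x * (if N x ≤ δ then 1 else 0) := by
    refine Finset.sum_le_sum fun x _ => mul_le_mul_of_nonneg_left ?_ (gibbs_nonneg N s x)
    split_ifs with hx
    · have := div_nonneg (h.nonneg x) hδ.le
      linarith
    · have := (one_le_div hδ).2 (not_le.1 hx).le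
      linarith
  refine le_trans ?_ h1
  have h2 : ∑ x, gibbs N s x * (1 - N x / δ) = 1 - (∑ x, gibbs N s x * N x) / δ := by
    nth_rewrite 2 [← sum_gibbs N s]
    rw [Finset.sum_div, ← Finset.sum_sub_distrib]
    exact Finset.sum_congr rfl fun x _ => by ring
  rw [h2, ← div_div]
  have := div_le_div_of_nonneg_right (h.sum_gibbs_mul_le hs) hδ.le
  linarith

end IsBohrLength

end Gibbs

section Kernels

variable {G : Type*} [AddCommGroup G] [Fintype G]

/-- The correlation `∑ y, f (y + u) f (y + v)`. -/
noncomputable def corr (f : G → ℝ) (u v : G) : ℝ := ∑ y, f (y + u) * f (y + v)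

lemma sum_mul_sum_pow {ι : Type*} [Fintype ι] (ω : ι → ℝ) (g k : ι → G → ℝ) (p : ℕ) :
    ∑ u, ∑ v, ω u * ω v * (∑ y, g u y * k v y) ^ p =
      ∑ y : Fin p → G, (∑ u, ω u * ∏ i, g u (y i)) * ∑ v, ω v * ∏ i, k v (y i) := by
  simp_rw [Fintype.sum_pow, Finset.prod_mul_distrib, Finset.sum_mul_sum, Finset.mul_sum]
  conv_rhs => rw [Finset.sum_comm]
  refine Finset.sum_congr rfl fun u _ => ?_
  rw [Finset.sum_comm]
  exact Finset.sum_congr rfl fun y _ => Finset.sum_congr rfl fun v _ => by ring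

lemma sum_corr_pow (ω f : G → ℝ) (p : ℕ) :
    ∑ u, ∑ v, ω u * ω v * corr f u v ^ p =
      ∑ y : Fin p → G, (∑ u, ω u * ∏ i, f (y i + u)) ^ 2 := by
  simp_rw [sq]
  exact sum_mul_sum_pow ω (fun u y => f (y + u)) (fun u y => f (y + u)) p

lemma sum_corr_pow_nonneg (ω f : G → ℝ) (p : ℕ) :
    0 ≤ ∑ u, ∑ v, ω u * ω v * corr f u v ^ p := by
  rw [sum_corr_pow]; positivity

/-- Moments of `f * f` against a translate of a positive definite measure are bounded by those of
the autocorrelation of `f`. -/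
lemma sum_conv_pow_le (ω f : G → ℝ) (p : ℕ) (t : G) :
    ∑ u, ∑ v, ω u * ω v * (∑ y, f y * f (t + u - v - y)) ^ p ≤
      ∑ u, ∑ v, ω u * ω v * corr f u v ^ p := by
  have h1 : ∀ u v, ∑ y, f y * f (t + u - v - y) = ∑ y, f (y + u) * f (t - v - y) := by
    intro u v
    refine (Fintype.sum_equiv (Equiv.addRight u) _ _ fun y => ?_).symm
    simp only [Equiv.coe_addRight]
    congr 2; abel
  have h2 : ∑ y : Fin p → G, (∑ v, ω v * ∏ i, f (t - v - y i)) ^ 2 =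
      ∑ u, ∑ v, ω u * ω v * corr f u v ^ p := by
    simp_rw [sq]
    rw [← sum_mul_sum_pow ω (fun v y => f (t - v - y)) (fun v y => f (t - v - y)) p]
    refine Finset.sum_congr rfl fun u _ => Finset.sum_congr rfl fun v _ => ?_
    congr 2
    rw [corr]
    refine Fintype.sum_equiv (Equiv.subLeft (t - u - v)) _ _ fun y => ?_
    simp only [Equiv.subLeft_apply]
    rw [mul_comm]
    congr 2 <;> abel
  simp_rw [h1]
  rw [sum_mul_sum_pow ω (fun u y => f (y + u)) (fun v y => f (t - v - y)) p]
  have h3 := sum_corr_pow ω f p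
  have h4 : ∀ y : Fin p → G, (∑ u, ω u * ∏ i, f (y i + u)) * ∑ v, ω v * ∏ i, f (t - v - y i) ≤
      ((∑ u, ω u * ∏ i, f (y i + u)) ^ 2 + (∑ v, ω v * ∏ i, f (t - v - y i)) ^ 2) / 2 := by
    intro y
    nlinarith [sq_nonneg ((∑ u, ω u * ∏ i, f (y i + u)) - ∑ v, ω v * ∏ i, f (t - v - y i))]
  refine (Finset.sum_le_sum fun y _ => h4 y).trans ?_
  rw [← Finset.sum_div, Finset.sum_add_distrib, h2, ← h3]
  linarith

end Kernels

section Probability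

variable {ι : Type*} [Fintype ι]

/-- If a bounded-below-moment function has a nonnegative odd moment, then any function that
dominates it after adding `1` has a large moment. -/
lemma unbalance (w g f : ι → ℝ) (hw : ∀ i, 0 ≤ w i) (hw1 : ∑ i, w i = 1) {p : ℕ} (hp : Even p)
    (hp8 : 8 ≤ p) (h1 : (1 / 8 : ℝ) ^ p ≤ ∑ i, w i * g i ^ p)
    (h2 : 0 ≤ ∑ i, w i * g i ^ (p + 1)) (hf0 : ∀ i, 0 ≤ f i)
    (hf1 : ∀ i, 3 / 32 ≤ g i → 1.088 ≤ f i) (hf2 : ∀ i, 3 / 32 ≤ g i → g i ≤ 2 * f i) :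
    (17 / 16 : ℝ) ^ (400 * (p + 1)) ≤ ∑ i, w i * f i ^ (400 * (p + 1)) := by
  have hodd : Odd (p + 1) := hp.add_one
  set q := p + 1 with hq
  have hη : (0 : ℝ) < (1 / 8) ^ q := by positivity
  let T : ι → ℝ := fun i => if 3 / 32 ≤ g i then 1 else 0
  have step1 : (15 / 32 : ℝ) * (1 / 8) ^ q ≤ ∑ i, w i * |g i| ^ q := by
    have hpt : ∀ i, (1 / 16 : ℝ) * g i ^ p - (1 / 16) ^ q ≤ |g i| ^ q := by
      intro i
      rw [← hp.pow_abs]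
      rcases le_total (1 / 16) |g i| with hi | hi
      · have : (0 : ℝ) < (1 / 16) ^ q := by positivity
        have h3 : (1 / 16 : ℝ) * |g i| ^ p ≤ |g i| ^ q := by
          rw [hq, pow_succ']; gcongr
        linarith
      · have h3 : (1 / 16 : ℝ) * |g i| ^ p ≤ (1 / 16) ^ q := by
          rw [hq, pow_succ']; gcongr
        have : 0 ≤ |g i| ^ q := by positivity
        linarith
    have h3 : ∑ i, w i * ((1 / 16 : ℝ) * g i ^ p - (1 / 16) ^ q) ≤ ∑ i, w i * |g i| ^ q :=
      Finset.sum_le_sum fun i _ => mul_le_mul_of_nonneg_left (hpt i) (hw i)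
    have h4 : ∑ i, w i * ((1 / 16 : ℝ) * g i ^ p - (1 / 16) ^ q) =
        1 / 16 * ∑ i, w i * g i ^ p - (1 / 16) ^ q := by
      simp only [mul_sub, Finset.sum_sub_distrib, ← Finset.sum_mul, hw1, one_mul]
      rw [Finset.mul_sum]
      congr 1
      exact Finset.sum_congr rfl fun i _ => by ring
    have h5 : (1 / 16 : ℝ) ^ q ≤ 1 / 32 * (1 / 8) ^ q := by
      have : (1 / 16 : ℝ) ^ q = (1 / 2) ^ q * (1 / 8) ^ q := by rw [← mul_pow]; norm_num
      rw [this]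
      gcongr
      calc (1 / 2 : ℝ) ^ q ≤ (1 / 2) ^ 5 :=
            pow_le_pow_of_le_one (by norm_num) (by norm_num) (by omega)
        _ = 1 / 32 := by norm_num
    have h6 : (1 / 16 : ℝ) * (1 / 8) ^ p = 1 / 2 * (1 / 8) ^ q := by rw [hq, pow_succ]; ring
    linarith
  have step2 : (1 / 8 : ℝ) * (1 / 8) ^ q ≤ ∑ i, w i * (g i ^ q * T i) := by
    have hpt : ∀ i, |g i| ^ q + g i ^ q ≤ 2 * ((3 / 32) ^ q + g i ^ q * T i) := by
      intro i
      have h0 : (0 : ℝ) < (3 / 32) ^ q := by positivity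
      simp only [T]
      split_ifs with hi
      · rw [abs_of_nonneg (by linarith)]; linarith
      · rcases le_total 0 (g i) with h3 | h3
        · have : g i ^ q ≤ (3 / 32) ^ q := pow_le_pow_left₀ h3 (not_le.1 hi).le _
          rw [abs_of_nonneg h3]; linarith
        · rw [abs_of_nonpos h3, hodd.neg_pow]; linarith
    have h3 : ∑ i, w i * (|g i| ^ q + g i ^ q) ≤
        ∑ i, w i * (2 * ((3 / 32) ^ q + g i ^ q * T i)) :=
      Finset.sum_le_sum fun i _ => mul_le_mul_of_nonneg_left (hpt i) (hw i)
    have h4 : ∑ i, w i * (2 * ((3 / 32) ^ q + g i ^ q * T i)) =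
        2 * (3 / 32) ^ q + 2 * ∑ i, w i * (g i ^ q * T i) := by
      have : ∀ i, w i * (2 * ((3 / 32) ^ q + g i ^ q * T i)) =
        w i * (2 * (3 / 32) ^ q) + 2 * (w i * (g i ^ q * T i)) := fun i => by ring
      rw [Finset.sum_congr rfl fun i _ => this i, Finset.sum_add_distrib, ← Finset.sum_mul, hw1,
        ← Finset.mul_sum, one_mul]
    have h5 : (3 / 32 : ℝ) ^ q ≤ 1 / 13 * (1 / 8) ^ q := by
      have : (3 / 32 : ℝ) ^ q = (3 / 4) ^ q * (1 / 8) ^ q := by rw [← mul_pow]; norm_num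
      rw [this]
      gcongr
      calc (3 / 4 : ℝ) ^ q ≤ (3 / 4) ^ 9 :=
            pow_le_pow_of_le_one (by norm_num) (by norm_num) (by omega)
        _ ≤ 1 / 13 := by norm_num
    have h6 : ∑ i, w i * (|g i| ^ q + g i ^ q) = ∑ i, w i * |g i| ^ q + ∑ i, w i * g i ^ q := by
      rw [← Finset.sum_add_distrib]; exact Finset.sum_congr rfl fun i _ => by ring
    linarith
  have hcs : (∑ i, w i * (g i ^ q * T i)) ^ 2 ≤
      (∑ i, w i * T i) * ∑ i, w i * (g i ^ (2 * q) * T i) := by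
    refine Finset.sum_sq_le_sum_mul_sum_of_sq_le_mul _ ?_ ?_ ?_
    · intro i _; simp only [T]; split_ifs <;> simp [hw]
    · intro i _
      have : 0 ≤ g i ^ (2 * q) := by rw [pow_mul']; positivity
      have h3 := hw i
      simp only [T]; split_ifs <;> positivity
    · intro i _
      refine le_of_eq ?_
      simp only [T]; split_ifs <;> ring
  have h3 : ∑ i, w i * (g i ^ (2 * q) * T i) ≤ 2 ^ (2 * q) * ∑ i, w i * f i ^ (2 * q) := by
    rw [Finset.mul_sum]
    refine Finset.sum_le_sum fun i _ => ?_
    rw [mul_left_comm ((2 : ℝ) ^ (2 * q)) (w i)]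
    refine mul_le_mul_of_nonneg_left ?_ (hw i)
    rw [← mul_pow]
    have h0 : 0 ≤ (2 * f i) ^ (2 * q) := pow_nonneg (by linarith [hf0 i]) _
    simp only [T]
    split_ifs with hi
    · rw [mul_one]; exact pow_le_pow_left₀ (by linarith) (hf2 i hi) _
    · simpa using h0
  have hT0 : 0 ≤ ∑ i, w i * T i := Finset.sum_nonneg fun i _ => by
    simp only [T]; split_ifs <;> simp [hw]
  rcases le_total ((17 / 16 : ℝ) ^ (2 * q)) (∑ i, w i * f i ^ (2 * q)) with hc | hc
  · have hpm := Real.pow_arith_mean_le_arith_mean_pow univ w (fun i => f i ^ (2 * q))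
      (fun i _ => hw i) hw1 (fun i _ => pow_nonneg (hf0 i) _) 200
    simp only [← pow_mul] at hpm
    have e : 2 * q * 200 = 400 * q := by ring
    rw [e] at hpm
    refine le_trans ?_ hpm
    rw [← e, pow_mul _ (2 * q)]
    exact pow_le_pow_left₀ (by positivity) hc _
  · have hPT : (1 / 578 : ℝ) ^ q ≤ ∑ i, w i * T i := by
      have h4 : ((1 / 8 : ℝ) * (1 / 8) ^ q) ^ 2 ≤
          (∑ i, w i * T i) * (2 ^ (2 * q) * (17 / 16) ^ (2 * q)) := by
        calc _ ≤ (∑ i, w i * (g i ^ q * T i)) ^ 2 := by gcongr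
          _ ≤ _ := hcs
          _ ≤ _ := by gcongr; exact h3.trans (by gcongr)
      have e1 : (2 : ℝ) ^ (2 * q) * (17 / 16) ^ (2 * q) = (289 / 64) ^ q := by
        rw [← mul_pow, pow_mul]; norm_num
      have e2 : ((1 / 8 : ℝ) * (1 / 8) ^ q) ^ 2 = 1 / 64 * (1 / 64) ^ q := by
        rw [mul_pow, ← pow_mul, mul_comm q 2, pow_mul]; norm_num
      have h64 : (1 / 2 : ℝ) ^ q ≤ 1 / 64 := by
        calc (1 / 2 : ℝ) ^ q ≤ (1 / 2) ^ 6 :=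
            pow_le_pow_of_le_one (by norm_num) (by norm_num) (by omega)
        _ = 1 / 64 := by norm_num
      rw [e1, e2] at h4
      have e3 : (1 / 578 : ℝ) ^ q * (289 / 64) ^ q = (1 / 2) ^ q * (1 / 64) ^ q := by
        rw [← mul_pow, ← mul_pow]; norm_num
      have h5 : (1 / 578 : ℝ) ^ q * (289 / 64) ^ q ≤ (∑ i, w i * T i) * (289 / 64) ^ q := by
        rw [e3]; refine le_trans ?_ h4; gcongr
      exact le_of_mul_le_mul_right h5 (by positivity)
    have h6 : (∑ i, w i * T i) * 1.088 ^ (400 * q) ≤ ∑ i, w i * f i ^ (400 * q) := by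
      rw [Finset.sum_mul]
      refine Finset.sum_le_sum fun i _ => ?_
      rw [mul_assoc]
      refine mul_le_mul_of_nonneg_left ?_ (hw i)
      simp only [T]
      split_ifs with hi
      · rw [one_mul]; exact pow_le_pow_left₀ (by norm_num) (hf1 i hi) _
      · rw [zero_mul]; exact pow_nonneg (hf0 i) _
    refine le_trans ?_ h6
    calc (17 / 16 : ℝ) ^ (400 * q) ≤ (1 / 578) ^ q * 1.088 ^ (400 * q) := by
          rw [pow_mul, pow_mul, ← mul_pow]
          refine pow_le_pow_left₀ (by positivity) ?_ _
          have e : (1.088 : ℝ) ^ 400 = (17 / 16) ^ 400 * ((128 / 125) ^ 100) ^ 4 := by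
            rw [← pow_mul, ← mul_pow]; norm_num only
          have h8 : (8 : ℝ) ≤ (128 / 125) ^ 100 := by norm_num
          have h9 : (8 : ℝ) ^ 4 ≤ ((128 / 125) ^ 100) ^ 4 := pow_le_pow_left₀ (by norm_num) h8 4
          have h10 : (0 : ℝ) < (17 / 16) ^ 400 := by positivity
          rw [e]
          generalize (17 / 16 : ℝ) ^ 400 = X at h10 ⊢
          generalize ((128 / 125 : ℝ) ^ 100) ^ 4 = Y at h9 ⊢
          norm_num at h9
          nlinarith
      _ ≤ _ := by gcongr

/-- Hoeffding's inequality for the empirical mean of a bounded centred function. -/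
lemma hoeffding (μ X : ι → ℝ) (hμ : ∀ i, 0 ≤ μ i) (hμ1 : ∑ i, μ i = 1) (hX : ∀ i, |X i| ≤ 1)
    (hX0 : ∑ i, μ i * X i = 0) (m : ℕ) {ε : ℝ} (hε : 0 ≤ ε) :
    ∑ a : Fin m → ι, (∏ j, μ (a j)) * (if ε * m < |∑ j, X (a j)| then 1 else 0) ≤
      2 * exp (-(ε ^ 2 * m / 2)) := by
  have mgf : ∀ l : ℝ, ∑ a : Fin m → ι, (∏ j, μ (a j)) * exp (l * ∑ j, X (a j)) ≤
      exp (l ^ 2 / 2 * m) := by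
    intro l
    have e : ∀ a : Fin m → ι, (∏ j, μ (a j)) * exp (l * ∑ j, X (a j)) =
        ∏ j, μ (a j) * exp (l * X (a j)) := by
      intro a
      rw [Finset.mul_sum, exp_sum, Finset.prod_mul_distrib]
    rw [Finset.sum_congr rfl fun a _ => e a, ← Fintype.sum_pow (fun i => μ i * exp (l * X i)) m,
      mul_comm, exp_nat_mul]
    refine pow_le_pow_left₀ (Finset.sum_nonneg fun i _ => mul_nonneg (hμ i) (exp_pos _).le) ?_ _
    calc ∑ i, μ i * exp (l * X i) ≤ ∑ i, (μ i * cosh l + sinh l * (μ i * X i)) := by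
          refine Finset.sum_le_sum fun i _ => ?_
          have := mul_le_mul_of_nonneg_left (exp_mul_le_cosh_add_mul_sinh (hX i) l) (hμ i)
          rw [mul_comm (X i) l] at this
          linarith
      _ = cosh l := by
          rw [Finset.sum_add_distrib, ← Finset.sum_mul, ← Finset.mul_sum, hμ1, hX0]; ring
      _ ≤ exp (l ^ 2 / 2) := cosh_le_exp_half_sq l
  have hpt : ∀ a : Fin m → ι, (if ε * m < |∑ j, X (a j)| then (1 : ℝ) else 0) ≤
      exp (-(ε ^ 2 * m)) * (exp (ε * ∑ j, X (a j)) + exp (-ε * ∑ j, X (a j))) := by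
    intro a
    split_ifs with h
    · rw [mul_add, ← exp_add, ← exp_add]
      rcases lt_abs.1 h with h' | h'
      · have : 1 ≤ exp (-(ε ^ 2 * m) + ε * ∑ j, X (a j)) := one_le_exp (by nlinarith)
        have := exp_pos (-(ε ^ 2 * m) + -ε * ∑ j, X (a j))
        linarith
      · have : 1 ≤ exp (-(ε ^ 2 * m) + -ε * ∑ j, X (a j)) := one_le_exp (by nlinarith)
        have := exp_pos (-(ε ^ 2 * m) + ε * ∑ j, X (a j))
        linarith
    · positivity
  have hW : ∀ a : Fin m → ι, 0 ≤ ∏ j, μ (a j) := fun a => Finset.prod_nonneg fun j _ => hμ _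
  calc _ ≤ ∑ a : Fin m → ι, (∏ j, μ (a j)) *
        (exp (-(ε ^ 2 * m)) * (exp (ε * ∑ j, X (a j)) + exp (-ε * ∑ j, X (a j)))) :=
        Finset.sum_le_sum fun a _ => mul_le_mul_of_nonneg_left (hpt a) (hW a)
    _ = exp (-(ε ^ 2 * m)) * (∑ a : Fin m → ι, (∏ j, μ (a j)) * exp (ε * ∑ j, X (a j)) +
        ∑ a : Fin m → ι, (∏ j, μ (a j)) * exp (-ε * ∑ j, X (a j))) := by
        rw [← Finset.sum_add_distrib, Finset.mul_sum]
        exact Finset.sum_congr rfl fun a _ => by ring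
    _ ≤ exp (-(ε ^ 2 * m)) * (exp (ε ^ 2 / 2 * m) + exp (ε ^ 2 / 2 * m)) := by
        gcongr
        · exact mgf ε
        · simpa using mgf (-ε)
    _ = 2 * exp (-(ε ^ 2 * m / 2)) := by
        rw [← two_mul, mul_left_comm, ← exp_add]; congr 2; ring

/-- If a weighted average is at least `c`, some point is at least `c`. -/
lemma exists_le_of_le_sum (w f : ι → ℝ) (hw : ∀ i, 0 ≤ w i) (hw1 : ∑ i, w i = 1) {c : ℝ}
    (h : c ≤ ∑ i, w i * f i) : ∃ i, c ≤ f i := by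
  by_contra! hc
  have hne : ∃ i ∈ univ, 0 < w i := by
    by_contra! h0
    have : ∑ i, w i ≤ 0 := Finset.sum_nonpos h0
    linarith
  have h1 : ∑ i, w i * f i < ∑ i, w i * c := by
    obtain ⟨i, hi, hi'⟩ := hne
    exact Finset.sum_lt_sum (fun j _ => mul_le_mul_of_nonneg_left (hc j).le (hw j))
      ⟨i, hi, mul_lt_mul_of_pos_left (hc i) hi'⟩
  rw [← Finset.sum_mul, hw1, one_mul] at h1
  linarith

end Probability

section Sifting

variable {G : Type*} [AddCommGroup G] [Fintype G]

/-- Sifting by dependent random choice. -/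
lemma sift (ω β A : G → ℝ) (hω : ∀ x, 0 ≤ ω x) (hβ : ∀ x, 0 ≤ β x) (hβ1 : ∑ x, β x = 1)
    (hA : ∀ x, 0 ≤ A x) {r : ℕ} {T θ : ℝ} (hT : 0 < T) (hθ : 0 < θ)
    (h : T ≤ ∑ a, ∑ b, ω a * ω b * (∑ s, β s * A (s + a) * A (s + b)) ^ r)
    (hω1 : ∑ x, ω x = 1) :
    ∃ s : Fin r → G, T / 2 ≤ (∑ x, ω x * ∏ i, A (s i + x)) ^ 2 ∧
      ∑ a, ∑ b, (ω a * ∏ i, A (s i + a)) * (ω b * ∏ i, A (s i + b)) *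
        (if ∑ s, β s * A (s + a) * A (s + b) < θ then 1 else 0) ≤
      2 * θ ^ r / T * (∑ x, ω x * ∏ i, A (s i + x)) ^ 2 := by
  set F : G → G → ℝ := fun a b => ∑ s, β s * A (s + a) * A (s + b) with hF
  have hF0 : ∀ a b, 0 ≤ F a b := fun a b => Finset.sum_nonneg fun s _ =>
    mul_nonneg (mul_nonneg (hβ s) (hA _)) (hA _)
  have key : ∀ H : G → G → ℝ, ∑ s : Fin r → G, (∏ i, β (s i)) *
      ∑ a, ∑ b, (ω a * ∏ i, A (s i + a)) * (ω b * ∏ i, A (s i + b)) * H a b =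
      ∑ a, ∑ b, ω a * ω b * F a b ^ r * H a b := by
    intro H
    simp_rw [Finset.mul_sum, hF, Fintype.sum_pow, Finset.prod_mul_distrib, Finset.mul_sum,
      Finset.sum_mul]
    rw [Finset.sum_comm]
    refine Finset.sum_congr rfl fun a _ => ?_
    rw [Finset.sum_comm]
    exact Finset.sum_congr rfl fun b _ => Finset.sum_congr rfl fun s _ => by ring
  have hW : ∀ s : Fin r → G, 0 ≤ ∏ i, β (s i) := fun s => Finset.prod_nonneg fun i _ => hβ _
  have hW1 : ∑ s : Fin r → G, ∏ i, β (s i) = 1 := by rw [← Fintype.sum_pow, hβ1, one_pow]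
  set Bad : (Fin r → G) → ℝ := fun s => ∑ a, ∑ b, (ω a * ∏ i, A (s i + a)) *
    (ω b * ∏ i, A (s i + b)) * (if F a b < θ then 1 else 0) with hBad
  have hP : ∀ (s : Fin r → G) x, 0 ≤ ω x * ∏ i, A (s i + x) := fun s x =>
    mul_nonneg (hω x) (Finset.prod_nonneg fun i _ => hA _)
  have hBad0 : ∀ s, 0 ≤ Bad s := fun s => Finset.sum_nonneg fun a _ => Finset.sum_nonneg fun b _ =>
    mul_nonneg (mul_nonneg (hP _ _) (hP _ _)) (by split_ifs <;> norm_num)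
  have k1 := key fun _ _ => 1
  have k2 := key fun a b => if F a b < θ then 1 else 0
  have hM : ∀ s : Fin r → G, ∑ a, ∑ b, (ω a * ∏ i, A (s i + a)) * (ω b * ∏ i, A (s i + b)) * 1 =
      (∑ x, ω x * ∏ i, A (s i + x)) ^ 2 := by
    intro s; simp_rw [mul_one]; rw [sq, Finset.sum_mul_sum]
  simp_rw [hM] at k1
  simp_rw [mul_one] at k1
  have hbad : ∑ a, ∑ b, ω a * ω b * F a b ^ r * (if F a b < θ then 1 else 0) ≤ θ ^ r := by
    have : ∀ a b, ω a * ω b * F a b ^ r * (if F a b < θ then 1 else 0) ≤ ω a * ω b * θ ^ r := by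
      intro a b
      have hab := mul_nonneg (hω a) (hω b)
      split_ifs with hlt
      · rw [mul_one]
        exact mul_le_mul_of_nonneg_left (pow_le_pow_left₀ (hF0 a b) hlt.le _) hab
      · rw [mul_zero]; positivity
    calc _ ≤ ∑ a, ∑ b, ω a * ω b * θ ^ r :=
          Finset.sum_le_sum fun a _ => Finset.sum_le_sum fun b _ => this a b
      _ = θ ^ r := by
          simp_rw [← Finset.sum_mul, ← Finset.mul_sum, hω1, mul_one, hω1, one_mul]
  have hθr : 0 < θ ^ r := by positivity
  obtain ⟨s, hs⟩ := exists_le_of_le_sum (fun s : Fin r → G => ∏ i, β (s i))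
    (fun s => (∑ x, ω x * ∏ i, A (s i + x)) ^ 2 - T / 2 - T / (2 * θ ^ r) * Bad s) hW hW1
    (c := 0) (by
      have e : ∀ s : Fin r → G, (∏ i, β (s i)) *
          ((∑ x, ω x * ∏ i, A (s i + x)) ^ 2 - T / 2 - T / (2 * θ ^ r) * Bad s) =
          (∏ i, β (s i)) * (∑ x, ω x * ∏ i, A (s i + x)) ^ 2 - (∏ i, β (s i)) * (T / 2) -
          T / (2 * θ ^ r) * ((∏ i, β (s i)) * Bad s) := fun s => by ring
      rw [Finset.sum_congr rfl fun s _ => e s, Finset.sum_sub_distrib, Finset.sum_sub_distrib,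
        ← Finset.sum_mul, ← Finset.mul_sum, hW1, k1, k2]
      have : T / (2 * θ ^ r) * ∑ a, ∑ b, ω a * ω b * F a b ^ r * (if F a b < θ then 1 else 0) ≤
          T / (2 * θ ^ r) * θ ^ r := by gcongr
      have e2 : T / (2 * θ ^ r) * θ ^ r = T / 2 := by field_simp
      linarith)
  refine ⟨s, ?_, ?_⟩
  · have := mul_nonneg (by positivity : 0 ≤ T / (2 * θ ^ r)) (hBad0 s)
    linarith
  · have h3 : T / (2 * θ ^ r) * Bad s ≤ (∑ x, ω x * ∏ i, A (s i + x)) ^ 2 := by linarith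
    have e3 : Bad s = 2 * θ ^ r / T * (T / (2 * θ ^ r) * Bad s) := by field_simp
    change Bad s ≤ _
    rw [e3]
    gcongr

end Sifting

section Conv

variable {G : Type*} [AddCommGroup G] [Fintype G]

/-- Convolution with respect to counting measure. -/
noncomputable def conv (f g : G → ℝ) (x : G) : ℝ := ∑ y, f y * g (x - y)

/-- Iterated convolution. -/
noncomputable def convPow (f : G → ℝ) : ℕ → G → ℝ
  | 0 => fun x => if x = 0 then 1 else 0
  | k + 1 => conv (convPow f k) f

lemma convPow_induction {f : G → ℝ} {Q : ℕ → G → Prop} (h0 : Q 0 0)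
    (hs : ∀ j T u, Q j T → f u ≠ 0 → Q (j + 1) (T + u)) :
    ∀ k T, convPow f k T ≠ 0 → Q k T
  | 0, T, h => by
      have : T = 0 := by by_contra hT; exact h (by simp [convPow, hT])
      rwa [this]
  | k + 1, T, h => by
      obtain ⟨y, _, hy⟩ := Finset.exists_ne_zero_of_sum_ne_zero h
      have := hs k y (T - y) (convPow_induction h0 hs k y (left_ne_zero_of_mul hy))
        (right_ne_zero_of_mul hy)
      rwa [add_sub_cancel] at this

end Conv

section AlmostPeriodicity

variable {G : Type*} [AddCommGroup G] [Fintype G] {N : G → ℝ} {D : ℝ}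

/-- Croot–Sisask sampling: the translates of an empirical mean approximate
`b ↦ ∑ a, μ a * χ (a - b)` for a rich set of translations. -/
lemma exists_sample (h : IsBohrLength N D) (β μ χ : G → ℝ) (hβ : ∀ x, 0 ≤ β x)
    (hβ1 : ∑ x, β x = 1) (hμ : ∀ x, 0 ≤ μ x) (hμ1 : ∑ x, μ x = 1)
    (hχ0 : ∀ x, 0 ≤ χ x) (hχ1 : ∀ x, χ x ≤ 1) {c s s' δ ε τ : ℝ} {m : ℕ} (hm : 0 < m)
    (hc : 0 < c) (hs : 0 < s) (hs' : 0 < s') (hδ : 0 < δ) (hε : 0 ≤ ε) (hτ : 0 < τ)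
    (hμc : ∀ x, c * μ x ≤ gibbs N s x) (hms : m * s * δ ≤ 1) (hsδ : 4 * D ≤ s' * δ)
    (hmτ : 2 * exp (-(ε ^ 2 * m / 2)) ≤ τ / 2) :
    ∃ (X : Finset G) (e : G → ℝ), (∀ t ∈ X, N t ≤ δ) ∧
      c ^ m / 12 ≤ ∑ t ∈ X, gibbs N s' t ∧
      ∀ t ∈ X, ∑ b, β b *
        (if ε < |e (b - t) - ∑ a, μ a * χ (a - b)| then 1 else 0) ≤ τ := by
  set H : G → ℝ := fun b => ∑ a, μ a * χ (a - b) with hH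
  have hH0 : ∀ b, 0 ≤ H b := fun b => Finset.sum_nonneg fun a _ => mul_nonneg (hμ a) (hχ0 _)
  have hH1 : ∀ b, H b ≤ 1 := fun b => by
    rw [← hμ1]
    exact Finset.sum_le_sum fun a _ => mul_le_of_le_one_right (hμ a) (hχ1 _)
  set E : (Fin m → G) → G → ℝ := fun a b => (∑ j, χ (a j - b)) / m with hE
  set err : (Fin m → G) → ℝ := fun a => ∑ b, β b * (if ε < |E a b - H b| then 1 else 0) with herr
  have herr0 : ∀ a, 0 ≤ err a := fun a => Finset.sum_nonneg fun b _ =>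
    mul_nonneg (hβ b) (by split_ifs <;> norm_num)
  have hm0 : (0 : ℝ) < m := by exact_mod_cast hm
  have hW : ∀ a : Fin m → G, 0 ≤ ∏ j, μ (a j) := fun a => Finset.prod_nonneg fun j _ => hμ _
  have hW1 : ∑ a : Fin m → G, ∏ j, μ (a j) = 1 := by rw [← Fintype.sum_pow, hμ1, one_pow]
  have hmean : ∑ a : Fin m → G, (∏ j, μ (a j)) * err a ≤ τ / 2 := by
    have hb : ∀ b, ∑ a : Fin m → G, (∏ j, μ (a j)) * (if ε < |E a b - H b| then 1 else 0) ≤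
        τ / 2 := by
      intro b
      refine le_trans ?_ ((hoeffding μ (fun a => χ (a - b) - H b) hμ hμ1 ?_ ?_ m hε).trans hmτ)
      · refine Finset.sum_le_sum fun a _ => mul_le_mul_of_nonneg_left (le_of_eq ?_) (hW a)
        have : ∑ j, (χ (a j - b) - H b) = m * (E a b - H b) := by
          rw [Finset.sum_sub_distrib]; simp [hE]; field_simp
        rw [this, abs_mul, abs_of_pos hm0, mul_comm ε]
        simp only [mul_lt_mul_iff_right₀ hm0]
      · intro a; rw [abs_le]
        constructor <;> linarith [hχ0 (a - b), hχ1 (a - b), hH0 b, hH1 b]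
      · simp_rw [mul_sub]
        rw [Finset.sum_sub_distrib, ← Finset.sum_mul, hμ1, one_mul, sub_self]
    calc ∑ a : Fin m → G, (∏ j, μ (a j)) * err a =
        ∑ b, β b * ∑ a : Fin m → G, (∏ j, μ (a j)) * (if ε < |E a b - H b| then 1 else 0) := by
          simp_rw [herr, Finset.mul_sum]
          rw [Finset.sum_comm]
          exact Finset.sum_congr rfl fun b _ => Finset.sum_congr rfl fun a _ => by ring
      _ ≤ ∑ b, β b * (τ / 2) :=
          Finset.sum_le_sum fun b _ => mul_le_mul_of_nonneg_left (hb b) (hβ b)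
      _ = τ / 2 := by rw [← Finset.sum_mul, hβ1, one_mul]
  set good : (Fin m → G) → ℝ := fun a => if err a ≤ τ then 1 else 0 with hgood
  have hgood0 : ∀ a, 0 ≤ good a := fun a => by simp only [hgood]; split_ifs <;> norm_num
  have hmk : 1 / 2 ≤ ∑ a : Fin m → G, (∏ j, μ (a j)) * good a := by
    have : ∑ a : Fin m → G, (∏ j, μ (a j)) * (1 - err a / τ) ≤
        ∑ a : Fin m → G, (∏ j, μ (a j)) * good a := by
      refine Finset.sum_le_sum fun a _ => mul_le_mul_of_nonneg_left ?_ (hW a)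
      simp only [hgood]
      split_ifs with ha
      · have := div_nonneg (herr0 a) hτ.le
        linarith
      · have := (one_le_div hτ).2 (not_le.1 ha).le
        linarith
    refine le_trans ?_ this
    simp_rw [mul_sub, mul_one, ← mul_div_assoc]
    rw [Finset.sum_sub_distrib, hW1, ← Finset.sum_div]
    have : (∑ a : Fin m → G, (∏ j, μ (a j)) * err a) / τ ≤ (τ / 2) / τ := by gcongr
    have e : τ / 2 / τ = 1 / 2 := by field_simp
    linarith
  have hlift : c ^ m / 2 ≤ ∑ a : Fin m → G, (∏ j, gibbs N s (a j)) * good a := by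
    calc c ^ m / 2 ≤ c ^ m * ∑ a : Fin m → G, (∏ j, μ (a j)) * good a := by
          have : 0 < c ^ m := by positivity
          nlinarith
      _ = ∑ a : Fin m → G, (∏ j, c * μ (a j)) * good a := by
          rw [Finset.mul_sum]
          refine Finset.sum_congr rfl fun a _ => ?_
          rw [Finset.prod_mul_distrib, Finset.prod_const, Finset.card_univ, Fintype.card_fin]
          ring
      _ ≤ _ := Finset.sum_le_sum fun a _ => mul_le_mul_of_nonneg_right
          (Finset.prod_le_prod (fun j _ => mul_nonneg hc.le (hμ _)) fun j _ => hμc _) (hgood0 a)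
  have hshift : ∀ t, N t ≤ δ → exp (-1) * (c ^ m / 2) ≤
      ∑ a : Fin m → G, (∏ j, gibbs N s (a j)) * good (fun j => a j + t) := by
    intro t ht
    have e1 : ∑ a : Fin m → G, (∏ j, gibbs N s (a j)) * good (fun j => a j + t) =
        ∑ a : Fin m → G, (∏ j, gibbs N s (a j - t)) * good a := by
      refine Fintype.sum_equiv (Equiv.addRight (fun _ => t)) _ _ fun a => ?_
      simp only [Equiv.coe_addRight, Pi.add_apply, add_sub_cancel_right]
      rfl
    rw [e1]
    calc _ ≤ exp (-1) * ∑ a : Fin m → G, (∏ j, gibbs N s (a j)) * good a := by gcongr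
      _ ≤ _ := by
        rw [Finset.mul_sum]
        refine Finset.sum_le_sum fun a _ => ?_
        rw [← mul_assoc]
        refine mul_le_mul_of_nonneg_right ?_ (hgood0 a)
        calc exp (-1) * ∏ j, gibbs N s (a j) ≤
              ∏ j : Fin m, (exp (-(s * N t)) * gibbs N s (a j)) := by
              rw [Finset.prod_mul_distrib, Finset.prod_const, Finset.card_univ, Fintype.card_fin,
                ← exp_nat_mul]
              refine mul_le_mul_of_nonneg_right (exp_le_exp.2 ?_)
                (Finset.prod_nonneg fun j _ => gibbs_nonneg _ _ _)
              have : (m : ℝ) * s * N t ≤ m * s * δ := by gcongr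
              linarith
          _ ≤ _ := Finset.prod_le_prod
              (fun j _ => mul_nonneg (exp_pos _).le (gibbs_nonneg _ _ _))
              fun j _ => h.le_gibbs_sub hs.le _ _
  have hmass : 1 / 2 ≤ ∑ x, gibbs N s' x * (if N x ≤ δ then 1 else 0) := by
    refine le_trans ?_ (h.le_sum_gibbs_ite hs' hδ)
    have : 2 * D / (s' * δ) ≤ 1 / 2 := by
      rw [div_le_div_iff₀ (by positivity) (by norm_num)]; linarith
    linarith
  have hG1 : ∑ a : Fin m → G, ∏ j, gibbs N s (a j) = 1 := by
    rw [← Fintype.sum_pow, sum_gibbs, one_pow]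
  have havg : c ^ m / 12 ≤ ∑ a : Fin m → G, (∏ j, gibbs N s (a j)) *
      ∑ t, gibbs N s' t * ((if N t ≤ δ then 1 else 0) * good (fun j => a j + t)) := by
    have e1 : ∑ a : Fin m → G, (∏ j, gibbs N s (a j)) *
        ∑ t, gibbs N s' t * ((if N t ≤ δ then 1 else 0) * good (fun j => a j + t)) =
        ∑ t, gibbs N s' t * (if N t ≤ δ then 1 else 0) *
          ∑ a : Fin m → G, (∏ j, gibbs N s (a j)) * good (fun j => a j + t) := by
      simp_rw [Finset.mul_sum]
      rw [Finset.sum_comm]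
      exact Finset.sum_congr rfl fun b _ => Finset.sum_congr rfl fun a _ => by ring
    have hcm : 0 < c ^ m := by positivity
    have he : 1 / 3 ≤ exp (-1) := by
      rw [exp_neg, ← one_div]
      exact one_div_le_one_div_of_le (exp_pos _) (by linarith [exp_one_lt_d9])
    rw [e1]
    calc c ^ m / 12 ≤ 1 / 2 * (exp (-1) * (c ^ m / 2)) := by nlinarith
      _ ≤ (∑ x, gibbs N s' x * (if N x ≤ δ then 1 else 0)) * (exp (-1) * (c ^ m / 2)) := by
          gcongr
      _ = ∑ t, gibbs N s' t * (if N t ≤ δ then 1 else 0) * (exp (-1) * (c ^ m / 2)) := by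
          rw [Finset.sum_mul]
      _ ≤ _ := by
          refine Finset.sum_le_sum fun t _ => ?_
          split_ifs with ht
          · exact mul_le_mul_of_nonneg_left (hshift t ht)
              (mul_nonneg (gibbs_nonneg _ _ _) zero_le_one)
          · simp
  obtain ⟨a, ha⟩ := exists_le_of_le_sum _ _
    (fun a : Fin m → G => Finset.prod_nonneg fun j _ => gibbs_nonneg N s (a j)) hG1 havg
  refine ⟨univ.filter fun t => N t ≤ δ ∧ err (fun j => a j + t) ≤ τ, E a, ?_, ?_, ?_⟩
  · intro t ht; exact (Finset.mem_filter.1 ht).2.1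
  · refine ha.trans (le_of_eq ?_)
    rw [Finset.sum_filter]
    refine Finset.sum_congr rfl fun t _ => ?_
    simp only [hgood]
    by_cases h1 : N t ≤ δ <;> by_cases h2 : err (fun j => a j + t) ≤ τ <;> simp [h1, h2]
  · intro t ht
    have := (Finset.mem_filter.1 ht).2.2
    have e : ∀ b, E (fun j => a j + t) b = E a (b - t) := by
      intro b
      simp only [hE]
      congr 1
      exact Finset.sum_congr rfl fun j _ => by congr 1; abel
    simp only [herr, e] at this
    exact this

/-- The averages `T ↦ ∑ b, μ b * h (b + T)` are nearly constant on `k`-fold difference sets. -/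
lemma almost_periodic (hN : IsBohrLength N D) (β μ h e : G → ℝ)
    (hμ : ∀ x, 0 ≤ μ x) (hμ1 : ∑ x, μ x = 1) (hh0 : ∀ x, 0 ≤ h x) (hh1 : ∀ x, h x ≤ 1)
    {c s δ ε τ : ℝ} {k : ℕ} (hc : 0 < c) (hs : 0 < s) (hε : 0 ≤ ε)
    (hβ : β = gibbs N s) (hμc : ∀ x, c * μ x ≤ β x) (hks : 4 * k * s * δ ≤ 1)
    {X : Finset G} (hX : ∀ t ∈ X, N t ≤ δ)
    (he : ∀ t ∈ X, ∑ b, β b * (if ε < |e (b - t) - h b| then 1 else 0) ≤ τ)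
    {f : G → ℝ} (hf : ∀ u, f u ≠ 0 → ∃ t ∈ X, ∃ t' ∈ X, u = t - t') {T : G}
    (hT : convPow f k T ≠ 0) :
    |∑ b, μ b * h (b + T) - ∑ b, μ b * h b| ≤ 2 * k * ε + 12 * k * τ / c := by
  have hβ0 : ∀ x, 0 ≤ β x := fun x => hβ ▸ gibbs_nonneg N s x
  have hmove : ∀ (u : G) (q : G → ℝ), (∀ x, 0 ≤ q x) → s * N u ≤ 1 →
      ∑ b, β b * q (b + u) ≤ 3 * ∑ b, β b * q b := by
    intro u q hq hu
    have e1 : ∑ b, β b * q (b + u) = ∑ b, β (b - u) * q b := by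
      refine Fintype.sum_equiv (Equiv.addRight u) _ _ fun b => ?_
      simp
    rw [e1, Finset.mul_sum]
    refine Finset.sum_le_sum fun b _ => ?_
    rw [← mul_assoc]
    refine mul_le_mul_of_nonneg_right ?_ (hq b)
    have h1 := hN.gibbs_sub_le hs.le b u
    rw [← hβ] at h1
    refine h1.trans (mul_le_mul_of_nonneg_right ?_ (hβ0 b))
    calc exp (s * N u) ≤ exp 1 := exp_le_exp.2 hu
      _ ≤ 3 := by linarith [exp_one_lt_d9]
  have hbase : ∀ t ∈ X, ∀ t' ∈ X, s * N (t - t') ≤ 1 →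
      ∑ b, β b * (if 2 * ε < |h (b + (t - t')) - h b| then 1 else 0) ≤ 4 * τ := by
    intro t ht t' ht' hs1
    have h1 := he t' ht'
    have h2 := hmove (t - t') (fun b => if ε < |e (b - t) - h b| then 1 else 0)
      (fun b => by split_ifs <;> norm_num) hs1
    have h3 := he t ht
    have : ∑ b, β b * (if 2 * ε < |h (b + (t - t')) - h b| then 1 else 0) ≤
        ∑ b, β b * (if ε < |e (b + (t - t') - t) - h (b + (t - t'))| then 1 else 0) +
        ∑ b, β b * (if ε < |e (b - t') - h b| then 1 else 0) := by
      rw [← Finset.sum_add_distrib]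
      refine Finset.sum_le_sum fun b _ => ?_
      rw [← mul_add]
      refine mul_le_mul_of_nonneg_left ?_ (hβ0 b)
      have e1 : b + (t - t') - t = b - t' := by abel
      rw [e1]
      split_ifs with c1 c2 c3 c3 c2 c3 c3 <;> norm_num
      have := abs_sub_le (h (b + (t - t'))) (e (b - t')) (h b)
      rw [abs_sub_comm (h (b + (t - t'))) (e _)] at this
      linarith
    linarith
  have key := convPow_induction (f := f) (Q := fun j T => j ≤ k → N T ≤ 2 * j * δ ∧
    ∑ b, β b * (if 2 * j * ε < |h (b + T) - h b| then 1 else 0) ≤ 12 * j * τ)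
    (by intro _; simp [hN.zero]) (by
      intro j T u hQ hu hj
      obtain ⟨h1, h2⟩ := hQ (by omega)
      obtain ⟨t, ht, t', ht', rfl⟩ := hf u hu
      have hjk : (j : ℝ) + 1 ≤ k := by exact_mod_cast hj
      have hδ0 : 0 ≤ δ := (hN.nonneg t).trans (hX t ht)
      have hu2 : N (t - t') ≤ 2 * δ := (hN.sub t t').trans (by linarith [hX t ht, hX t' ht'])
      have hsd : 0 ≤ s * δ := by positivity
      have hj0 : (0 : ℝ) ≤ j := by positivity
      have hsT : s * N T ≤ 1 := by
        have : s * N T ≤ s * (2 * j * δ) := by gcongr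
        nlinarith
      have hsu : s * N (t - t') ≤ 1 := by
        have : s * N (t - t') ≤ s * (2 * δ) := by gcongr
        nlinarith
      refine ⟨?_, ?_⟩
      · push_cast
        linarith [hN.add T (t - t')]
      · have h3 := hbase t ht t' ht' hsu
        have h4 := hmove T (fun b => if 2 * ε < |h (b + (t - t')) - h b| then 1 else 0)
          (fun b => by split_ifs <;> norm_num) hsT
        have : ∑ b, β b * (if 2 * ((j + 1 : ℕ) : ℝ) * ε < |h (b + (T + (t - t'))) - h b|
            then 1 else 0) ≤
            ∑ b, β b * (if 2 * ε < |h (b + T + (t - t')) - h (b + T)| then 1 else 0) +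
            ∑ b, β b * (if 2 * j * ε < |h (b + T) - h b| then 1 else 0) := by
          rw [← Finset.sum_add_distrib]
          refine Finset.sum_le_sum fun b _ => ?_
          rw [← mul_add, ← add_assoc]
          refine mul_le_mul_of_nonneg_left ?_ (hβ0 b)
          split_ifs with c1 c2 c3 c3 c2 c3 c3 <;> norm_num
          have := abs_sub_le (h (b + T + (t - t'))) (h (b + T)) (h b)
          push_cast at c1
          linarith
        push_cast at this ⊢
        linarith) k T hT le_rfl
  obtain ⟨-, h2⟩ := key
  rw [← Finset.sum_sub_distrib]
  calc |∑ b, (μ b * h (b + T) - μ b * h b)| ≤ ∑ b, |μ b * h (b + T) - μ b * h b| :=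
        Finset.abs_sum_le_sum_abs _ _
    _ ≤ ∑ b, (μ b * (2 * k * ε) +
          β b * (if 2 * k * ε < |h (b + T) - h b| then 1 else 0) / c) := by
        refine Finset.sum_le_sum fun b _ => ?_
        rw [← mul_sub, abs_mul, abs_of_nonneg (hμ b)]
        have hk0 : 0 ≤ 2 * (k : ℝ) * ε := by positivity
        split_ifs with c1
        · have h3 : |h (b + T) - h b| ≤ 1 := by
            rw [abs_le]; constructor <;> linarith [hh0 b, hh1 b, hh0 (b + T), hh1 (b + T)]
          have h4 : μ b ≤ β b * 1 / c := by
            rw [le_div_iff₀ hc, mul_one, mul_comm]; exact hμc b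
          have h5 := mul_le_mul_of_nonneg_left h3 (hμ b)
          have h6 := mul_nonneg (hμ b) hk0
          linarith
        · have := mul_le_mul_of_nonneg_left (not_lt.1 c1) (hμ b)
          simpa using this
    _ = 2 * k * ε + (∑ b, β b * (if 2 * k * ε < |h (b + T) - h b| then 1 else 0)) / c := by
        rw [Finset.sum_add_distrib, ← Finset.sum_mul, hμ1, one_mul, Finset.sum_div]
    _ ≤ _ := by gcongr

end AlmostPeriodicity

section Fourier

variable {G : Type*} [AddCommGroup G] [Fintype G]

lemma sum_conv_mul (f g q : G → ℝ) :
    ∑ x, conv f g x * q x = ∑ y, ∑ z, f y * g z * q (y + z) := by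
  simp_rw [conv, Finset.sum_mul]
  rw [Finset.sum_comm]
  refine Finset.sum_congr rfl fun y _ => ?_
  exact Fintype.sum_equiv (Equiv.subRight y) _ _ fun x => by simp

lemma conv_nonneg {f g : G → ℝ} (hf : ∀ x, 0 ≤ f x) (hg : ∀ x, 0 ≤ g x) (x : G) :
    0 ≤ conv f g x := Finset.sum_nonneg fun y _ => mul_nonneg (hf y) (hg _)

lemma sum_conv (f g : G → ℝ) : ∑ x, conv f g x = (∑ x, f x) * ∑ x, g x := by
  have := sum_conv_mul f g fun _ => 1
  simp only [mul_one] at this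
  rw [this, Finset.sum_mul_sum]

lemma convPow_nonneg {f : G → ℝ} (hf : ∀ x, 0 ≤ f x) : ∀ k x, 0 ≤ convPow f k x
  | 0, x => by simp only [convPow]; split_ifs <;> norm_num
  | k + 1, x => conv_nonneg (convPow_nonneg hf k) hf x

lemma sum_convPow {f : G → ℝ} (hf1 : ∑ x, f x = 1) : ∀ k, ∑ x, convPow f k x = 1
  | 0 => by simp [convPow]
  | k + 1 => by rw [convPow, sum_conv, sum_convPow hf1 k, hf1, one_mul]

/-- The autocorrelation `x ↦ ∑ y, f (y + x) * f y`. -/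
noncomputable def autocorr (f : G → ℝ) (x : G) : ℝ := ∑ y, f (y + x) * f y

lemma autocorr_nonneg {f : G → ℝ} (hf : ∀ x, 0 ≤ f x) (x : G) : 0 ≤ autocorr f x :=
  Finset.sum_nonneg fun y _ => mul_nonneg (hf _) (hf y)

lemma sum_autocorr_mul {R : Type*} [CommRing R] (f : G → R) (q : G → R) :
    ∑ x, (∑ y, f (y + x) * f y) * q x = ∑ y, ∑ z, f y * f z * q (z - y) := by
  simp_rw [Finset.sum_mul]
  rw [Finset.sum_comm]
  refine Finset.sum_congr rfl fun y _ => ?_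
  exact Fintype.sum_equiv (Equiv.addLeft y) _ _ fun x => by simp; ring

lemma sum_autocorr (f : G → ℝ) : ∑ x, autocorr f x = (∑ x, f x) ^ 2 := by
  have := sum_autocorr_mul f fun _ => 1
  simp only [mul_one] at this
  simp only [autocorr]
  rw [this, sq, Finset.sum_mul_sum]

/-- The Fourier transform. -/
noncomputable def hat (f : G → ℝ) (ψ : AddChar G ℂ) : ℂ := ∑ x, (f x : ℂ) * ψ x

lemma hat_conv (f g : G → ℝ) (ψ : AddChar G ℂ) : hat (conv f g) ψ = hat f ψ * hat g ψ := by
  simp only [hat, conv, Complex.ofReal_sum, Complex.ofReal_mul]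
  rw [Finset.sum_mul_sum]
  simp_rw [Finset.sum_mul]
  rw [Finset.sum_comm]
  refine Finset.sum_congr rfl fun y _ => ?_
  refine Fintype.sum_equiv (Equiv.subRight y) _ _ fun x => ?_
  simp only [Equiv.subRight_apply]
  have : ψ x = ψ y * ψ (x - y) := by rw [← AddChar.map_add_eq_mul, add_sub_cancel]
  rw [this]
  ring

lemma hat_convPow (f : G → ℝ) (ψ : AddChar G ℂ) : ∀ k, hat (convPow f k) ψ = hat f ψ ^ k
  | 0 => by simp only [hat, convPow]; rw [Finset.sum_eq_single 0] <;> simp +contextual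
  | k + 1 => by rw [convPow, hat_conv, hat_convPow f ψ k, pow_succ]

lemma conj_hat (f : G → ℝ) (ψ : AddChar G ℂ) :
    (starRingEnd ℂ) (hat f ψ) = ∑ x, (f x : ℂ) * ψ (-x) := by
  simp [hat, AddChar.map_neg_eq_conj]

lemma hat_autocorr (f : G → ℝ) (ψ : AddChar G ℂ) :
    hat (autocorr f) ψ = ((‖hat f ψ‖ ^ 2 : ℝ) : ℂ) := by
  rw [← Complex.normSq_eq_norm_sq, ← Complex.mul_conj, conj_hat]
  have := sum_autocorr_mul (fun x => (f x : ℂ)) fun x => ψ x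
  simp only [hat, autocorr, Complex.ofReal_sum, Complex.ofReal_mul]
  rw [this, Finset.sum_mul_sum, Finset.sum_comm]
  refine Finset.sum_congr rfl fun y _ => Finset.sum_congr rfl fun z _ => ?_
  rw [sub_eq_add_neg, AddChar.map_add_eq_mul]
  ring

lemma norm_hat_le {f : G → ℝ} (hf : ∀ x, 0 ≤ f x) (hf1 : ∑ x, f x = 1) (ψ : AddChar G ℂ) :
    ‖hat f ψ‖ ≤ 1 := by
  rw [← hf1]
  refine (norm_sum_le _ _).trans (Finset.sum_le_sum fun x _ => ?_)
  rw [norm_mul, AddChar.norm_apply, mul_one, Complex.norm_real, norm_of_nonneg (hf x)]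

lemma hat_inversion (f : G → ℝ) (x : G) :
    ∑ ψ : AddChar G ℂ, hat f ψ * ψ (-x) = (Fintype.card G : ℂ) * f x := by
  simp_rw [hat, Finset.sum_mul]
  rw [Finset.sum_comm]
  have : ∀ y, ∑ ψ : AddChar G ℂ, (f y : ℂ) * ψ y * ψ (-x) =
      f y * if y - x = 0 then (Fintype.card G : ℂ) else 0 := by
    intro y
    rw [← AddChar.sum_apply_eq_ite (y - x), Finset.mul_sum]
    refine Finset.sum_congr rfl fun ψ _ => ?_
    rw [sub_eq_add_neg, AddChar.map_add_eq_mul, mul_assoc]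
  simp_rw [this, sub_eq_zero]
  simp [mul_comm]

/-- Averaging an autocorrelation against `Y` is insensitive to a further average against `η` when
the spectrum of `Y` is nearly annihilated by `η`. -/
lemma bootstrap (F Y η : G → ℝ) {θ : ℝ} (h : ∀ ψ, ‖hat Y ψ‖ * ‖1 - hat η ψ‖ ≤ θ) (x : G) :
    ∑ T, Y T * autocorr F (x - T) - θ * ∑ y, F y ^ 2 ≤
      ∑ T, Y T * ∑ u, η u * autocorr F (x - T + u) := by
  have hG : (0 : ℝ) < Fintype.card G := by exact_mod_cast Fintype.card_pos
  have key : (Fintype.card G : ℂ) * ((∑ T, Y T * autocorr F (x - T) -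
      ∑ T, Y T * ∑ u, η u * autocorr F (x - T + u) : ℝ) : ℂ) =
      ∑ ψ : AddChar G ℂ, hat (autocorr F) ψ * (ψ (-x) * (hat Y ψ *
        (1 - (starRingEnd ℂ) (hat η ψ)))) := by
    have e1 : ∀ T : G, ∀ q : G, (Fintype.card G : ℂ) * (autocorr F (x - T + q) : ℂ) =
        ∑ ψ : AddChar G ℂ, hat (autocorr F) ψ * (ψ (-x) * (ψ T * ψ (-q))) := by
      intro T q
      rw [← hat_inversion]
      refine Finset.sum_congr rfl fun ψ _ => ?_
      rw [← AddChar.map_add_eq_mul, ← AddChar.map_add_eq_mul]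
      congr 2; abel
    have e2 : (Fintype.card G : ℂ) * ∑ T, (Y T : ℂ) * (autocorr F (x - T) : ℂ) =
        ∑ ψ : AddChar G ℂ, hat (autocorr F) ψ * (ψ (-x) * hat Y ψ) := by
      calc _ = ∑ T, (Y T : ℂ) * ((Fintype.card G : ℂ) * (autocorr F (x - T + 0) : ℂ)) := by
            rw [Finset.mul_sum]
            exact Finset.sum_congr rfl fun T _ => by rw [add_zero]; ring
        _ = _ := by
            simp_rw [e1, Finset.mul_sum]
            rw [Finset.sum_comm]
            refine Finset.sum_congr rfl fun ψ _ => ?_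
            simp_rw [hat, Finset.mul_sum]
            refine Finset.sum_congr rfl fun T _ => ?_
            rw [neg_zero, AddChar.map_zero_eq_one]; ring
    have e3 : (Fintype.card G : ℂ) * ∑ T, (Y T : ℂ) *
        ∑ u, (η u : ℂ) * (autocorr F (x - T + u) : ℂ) =
        ∑ ψ : AddChar G ℂ, hat (autocorr F) ψ *
          (ψ (-x) * (hat Y ψ * (starRingEnd ℂ) (hat η ψ))) := by
      calc _ = ∑ T, ∑ u, (Y T : ℂ) * (η u : ℂ) *
            ((Fintype.card G : ℂ) * (autocorr F (x - T + u) : ℂ)) := by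
            simp_rw [Finset.mul_sum]
            exact Finset.sum_congr rfl fun T _ => Finset.sum_congr rfl fun u _ => by ring
        _ = ∑ ψ : AddChar G ℂ, ∑ T, ∑ u, (Y T : ℂ) * (η u : ℂ) *
              (hat (autocorr F) ψ * (ψ (-x) * (ψ T * ψ (-u)))) := by
            simp_rw [e1, Finset.mul_sum]
            exact (Finset.sum_congr rfl fun T _ => Finset.sum_comm).trans Finset.sum_comm
        _ = _ := by
            refine Finset.sum_congr rfl fun ψ _ => ?_
            rw [conj_hat, show hat Y ψ = ∑ T, (Y T : ℂ) * ψ T from rfl, Finset.sum_mul_sum]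
            simp_rw [Finset.mul_sum]
            exact Finset.sum_congr rfl fun T _ => Finset.sum_congr rfl fun u _ => by ring
    push_cast
    rw [mul_sub, e2, e3, ← Finset.sum_sub_distrib]
    exact Finset.sum_congr rfl fun ψ _ => by ring
  have hb : ∀ ψ : AddChar G ℂ, ‖hat (autocorr F) ψ * (ψ (-x) * (hat Y ψ *
        (1 - (starRingEnd ℂ) (hat η ψ))))‖ ≤ ‖hat F ψ‖ ^ 2 * θ := by
    intro ψ
    rw [norm_mul, norm_mul, norm_mul, AddChar.norm_apply, one_mul, hat_autocorr,
      Complex.norm_real, norm_of_nonneg (by positivity)]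
    refine mul_le_mul_of_nonneg_left ?_ (by positivity)
    have : ‖1 - (starRingEnd ℂ) (hat η ψ)‖ = ‖1 - hat η ψ‖ := by
      rw [← Complex.norm_conj (1 - hat η ψ)]; simp
    rw [this]; exact h ψ
  have hpars : ∑ ψ : AddChar G ℂ, ‖hat F ψ‖ ^ 2 = Fintype.card G * ∑ y, F y ^ 2 := by
    have := hat_inversion (autocorr F) 0
    simp_rw [hat_autocorr, neg_zero, AddChar.map_zero_eq_one, mul_one] at this
    have e : autocorr F 0 = ∑ y, F y ^ 2 := by
      simp only [autocorr, add_zero]; exact Finset.sum_congr rfl fun y _ => by ring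
    rw [e] at this
    exact_mod_cast this
  have hn := norm_sum_le (univ : Finset (AddChar G ℂ)) fun ψ => hat (autocorr F) ψ *
    (ψ (-x) * (hat Y ψ * (1 - (starRingEnd ℂ) (hat η ψ))))
  rw [← key] at hn
  have h2 := hn.trans (Finset.sum_le_sum fun ψ _ => hb ψ)
  rw [← Finset.sum_mul, hpars, norm_mul, Complex.norm_natCast, Complex.norm_real, mul_assoc] at h2
  have h3 := le_of_mul_le_mul_left h2 hG
  have h4 := (le_abs_self _).trans h3
  linarith

end Fourier

section Chang

variable {G : Type*} [AddCommGroup G] [Fintype G] {N : G → ℝ} {D : ℝ}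

/-- Exponents in `{-1, 0, 1}` supported on `Λ`. -/
noncomputable def signs (Λ : Finset (AddChar G ℂ)) : Finset (AddChar G ℂ → ℤ) :=
  Fintype.piFinset fun ψ => if ψ ∈ Λ then {-1, 0, 1} else {0}

/-- `Λ` is dissociated relative to the weight `g`. -/
def IsDissociated (g : G → ℝ) (Λ : Finset (AddChar G ℂ)) : Prop :=
  ∀ c ∈ signs Λ, c ≠ 0 → ‖hat g (∏ ψ, ψ ^ c ψ)‖ ≤ 1 / 2

lemma zero_mem_signs (Λ : Finset (AddChar G ℂ)) : (0 : AddChar G ℂ → ℤ) ∈ signs Λ := by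
  rw [signs, Fintype.mem_piFinset]
  intro ψ
  split_ifs <;> simp

lemma card_signs (Λ : Finset (AddChar G ℂ)) : #(signs Λ) = 3 ^ #Λ := by
  rw [signs, Fintype.card_piFinset]
  have : ∀ ψ : AddChar G ℂ, #(if ψ ∈ Λ then ({-1, 0, 1} : Finset ℤ) else {0}) =
      if ψ ∈ Λ then 3 else 1 := by
    intro ψ; split_ifs <;> rfl
  simp_rw [this]
  rw [Finset.prod_ite, Finset.prod_const, Finset.prod_const, one_pow, mul_one]
  simp

lemma riesz (γ : G → ℝ) (hγ1 : ∑ x, γ x = 1) (Λ : Finset (AddChar G ℂ)) {κ : ℝ} (hκ0 : 0 ≤ κ)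
    (hκ : ∀ c ∈ signs Λ, c ≠ 0 → ‖hat γ (∏ ψ, ψ ^ c ψ)‖ ≤ κ)
    (z : AddChar G ℂ → ℂ) (hz : ∀ ψ, ‖z ψ‖ ≤ 1) :
    ∑ x, γ x * ∏ ψ ∈ Λ, (1 + (z ψ * ψ x).re) ≤ 1 + 3 ^ #Λ * κ := by
  set a : AddChar G ℂ → ℤ → ℂ := fun ψ j =>
    if j = 0 then 1 else if j = 1 then z ψ / 2 else (starRingEnd ℂ) (z ψ) / 2 with ha
  have ha1 : ∀ ψ j, ‖a ψ j‖ ≤ 1 := by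
    intro ψ j
    simp only [ha]
    split_ifs
    · simp
    · rw [norm_div]; simp; linarith [hz ψ]
    · rw [norm_div]; simp; linarith [hz ψ]
  have hfac : ∀ (x : G) (ψ : AddChar G ℂ), ψ ∈ Λ → ((1 + (z ψ * ψ x).re : ℝ) : ℂ) =
      ∑ j ∈ ({-1, 0, 1} : Finset ℤ), a ψ j * ψ x ^ j := by
    intro x ψ _
    rw [Finset.sum_insert (by decide), Finset.sum_insert (by decide), Finset.sum_singleton]
    simp only [ha]
    norm_num
    have h1 : (starRingEnd ℂ) (ψ x) = (ψ x)⁻¹ := by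
      rw [← AddChar.map_neg_eq_conj, AddChar.map_neg_eq_inv]
    have h2 := Complex.re_eq_add_conj (z ψ * ψ x)
    rw [map_mul, h1] at h2
    rw [Complex.mul_re] at h2
    push_cast at h2
    rw [h2]; ring
  have hprod : ∀ x : G, ((∏ ψ ∈ Λ, (1 + (z ψ * ψ x).re) : ℝ) : ℂ) =
      ∑ c ∈ signs Λ, (∏ ψ, a ψ (c ψ)) * (∏ ψ, ψ ^ c ψ : AddChar G ℂ) x := by
    intro x
    have e : ((∏ ψ ∈ Λ, (1 + (z ψ * ψ x).re) : ℝ) : ℂ) = ∏ ψ : AddChar G ℂ,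
        ∑ j ∈ (if ψ ∈ Λ then ({-1, 0, 1} : Finset ℤ) else {0}), a ψ j * ψ x ^ j := by
      rw [Complex.ofReal_prod, Finset.prod_congr rfl (hfac x)]
      rw [← Finset.prod_subset (Finset.subset_univ Λ)]
      · exact Finset.prod_congr rfl fun ψ hψ => by rw [if_pos hψ]
      · intro ψ _ hψ
        rw [if_neg hψ]; simp [ha]
    rw [e, Finset.prod_univ_sum]
    refine Finset.sum_congr rfl fun c _ => ?_
    rw [Finset.prod_mul_distrib, AddChar.prod_apply]
    simp_rw [AddChar.zpow_apply]
  have key : ((∑ x, γ x * ∏ ψ ∈ Λ, (1 + (z ψ * ψ x).re) : ℝ) : ℂ) =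
      ∑ c ∈ signs Λ, (∏ ψ, a ψ (c ψ)) * hat γ (∏ ψ, ψ ^ c ψ) := by
    rw [Complex.ofReal_sum]
    simp_rw [Complex.ofReal_mul, hprod, hat, Finset.mul_sum]
    rw [Finset.sum_comm]
    exact Finset.sum_congr rfl fun c _ => Finset.sum_congr rfl fun x _ => by ring
  have h1 := (le_abs_self _).trans (le_of_eq (Complex.norm_real
    (∑ x, γ x * ∏ ψ ∈ Λ, (1 + (z ψ * ψ x).re))).symm)
  rw [key] at h1
  refine (h1.trans (norm_sum_le _ _)).trans ?_
  calc _ ≤ ∑ c ∈ signs Λ, ((if c = 0 then 1 else 0) + κ) := by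
        refine Finset.sum_le_sum fun c hc => ?_
        split_ifs with h0
        · subst h0
          simp only [Pi.zero_apply, zpow_zero, Finset.prod_const_one]
          have : hat γ (1 : AddChar G ℂ) = 1 := by
            simp only [hat, AddChar.one_apply, mul_one]
            rw [← Complex.ofReal_sum, hγ1, Complex.ofReal_one]
          rw [this]; simp [ha, hκ0]
        · rw [norm_mul, norm_prod, zero_add]
          calc _ ≤ 1 * ‖hat γ (∏ ψ, ψ ^ c ψ)‖ := by
                gcongr
                exact Finset.prod_le_one (fun _ _ => norm_nonneg _) fun ψ _ => ha1 _ _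
            _ ≤ κ := by rw [one_mul]; exact hκ c hc h0
    _ = 1 + 3 ^ #Λ * κ := by
        rw [Finset.sum_add_distrib, Finset.sum_ite_eq' (signs Λ), if_pos (zero_mem_signs Λ),
          Finset.sum_const, card_signs, nsmul_eq_mul]
        push_cast; ring

lemma sum_convPow_mul_le (h : IsBohrLength N D) {g : G → ℝ} (hg : ∀ x, 0 ≤ g x)
    (hg1 : ∑ x, g x = 1) : ∀ n : ℕ, ∑ x, convPow g n x * N x ≤ n * ∑ x, g x * N x
  | 0 => by simp [convPow, h.zero]
  | n + 1 => by
      rw [convPow, sum_conv_mul]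
      calc _ ≤ ∑ y, ∑ z, (convPow g n y * N y * g z + convPow g n y * (g z * N z)) := by
            refine Finset.sum_le_sum fun y _ => Finset.sum_le_sum fun z _ => ?_
            have := mul_le_mul_of_nonneg_left (h.add y z)
              (mul_nonneg (convPow_nonneg hg n y) (hg z))
            linarith
        _ = ∑ x, convPow g n x * N x + ∑ x, g x * N x := by
            simp_rw [Finset.sum_add_distrib, ← Finset.mul_sum, hg1, mul_one]
            rw [← Finset.sum_mul, sum_convPow hg1, one_mul]
        _ ≤ _ := by
            have := sum_convPow_mul_le h hg hg1 n
            push_cast; linarith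

lemma gibbs_le_two_mul_conv (h : IsBohrLength N D) {s s' : ℝ} (hs : 0 ≤ s) (hs' : 0 < s') {n : ℕ}
    (hn : 4 * n * D * s ≤ s') (x : G) :
    gibbs N s x ≤ 2 * conv (convPow (gibbs N s') n) (gibbs N s) x := by
  have h1 : ∑ y, convPow (gibbs N s') n y * N y ≤ n * (2 * D / s') :=
    (sum_convPow_mul_le h (gibbs_nonneg N s') (sum_gibbs N s') n).trans
      (mul_le_mul_of_nonneg_left (h.sum_gibbs_mul_le hs') (Nat.cast_nonneg n))
  have h2 : s * ∑ y, convPow (gibbs N s') n y * N y ≤ 1 / 2 := by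
    refine (mul_le_mul_of_nonneg_left h1 hs).trans ?_
    rw [← mul_div_assoc, ← mul_div_assoc, div_le_iff₀ hs']
    linarith
  have h3 : (∑ y, convPow (gibbs N s') n y * (1 - s * N y)) * gibbs N s x ≤
      conv (convPow (gibbs N s') n) (gibbs N s) x := by
    rw [conv, Finset.sum_mul]
    refine Finset.sum_le_sum fun y _ => ?_
    rw [mul_assoc]
    refine mul_le_mul_of_nonneg_left ?_ (convPow_nonneg (gibbs_nonneg N s') n y)
    refine le_trans ?_ (h.le_gibbs_sub hs x y)
    refine mul_le_mul_of_nonneg_right ?_ (gibbs_nonneg _ _ _)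
    linarith [add_one_le_exp (-(s * N y))]
  have h4 : ∑ y, convPow (gibbs N s') n y * (1 - s * N y) =
      1 - s * ∑ y, convPow (gibbs N s') n y * N y := by
    simp_rw [mul_sub, mul_one]
    rw [Finset.sum_sub_distrib, sum_convPow (sum_gibbs N s'), Finset.mul_sum]
    congr 1
    exact Finset.sum_congr rfl fun y _ => by ring
  rw [h4] at h3
  have := gibbs_nonneg N s x
  nlinarith

/-- Chang's lemma: a dissociated set of large Fourier coefficients is small. -/
lemma card_le_of_isDissociated (h : IsBohrLength N D) {f : G → ℝ} (hf : ∀ x, 0 ≤ f x)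
    (hf1 : ∑ x, f x = 1) {σ s s' : ℝ} (hσ : 0 < σ) (hs : 0 ≤ s) (hs' : 0 < s')
    (hfσ : ∀ x, σ * f x ≤ gibbs N s x) {M : ℕ} (hM : 8 * M * D * s ≤ s')
    {Λ : Finset (AddChar G ℂ)} (hΛ : IsDissociated (gibbs N s') Λ) (hcard : #Λ ≤ M)
    (hspec : ∀ ψ ∈ Λ, 1 / 2 ≤ ‖hat f ψ‖) : (#Λ : ℝ) ≤ 8 * log (4 / σ) := by
  set γ := conv (convPow (gibbs N s') (2 * M)) (gibbs N s) with hγ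
  have hγ1 : ∑ x, γ x = 1 := by
    rw [hγ, sum_conv, sum_convPow (sum_gibbs N s'), sum_gibbs, one_mul]
  have hgγ : ∀ x, gibbs N s x ≤ 2 * γ x :=
    gibbs_le_two_mul_conv h hs hs' (by push_cast; linarith)
  have hγhat : ∀ c ∈ signs Λ, c ≠ 0 → ‖hat γ (∏ ψ, ψ ^ c ψ)‖ ≤ (1 / 2) ^ (2 * M) := by
    intro c hc hc0
    rw [hγ, hat_conv, hat_convPow, norm_mul, norm_pow]
    calc _ ≤ (1 / 2 : ℝ) ^ (2 * M) * 1 := by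
          gcongr
          · exact hΛ c hc hc0
          · exact norm_hat_le (gibbs_nonneg N s) (sum_gibbs N s) _
      _ = _ := mul_one _
  set u : AddChar G ℂ → ℂ := fun ψ => (starRingEnd ℂ) (hat f ψ) / ‖hat f ψ‖ with hu
  have hu1 : ∀ ψ, ‖u ψ‖ ≤ 1 := by
    intro ψ
    simp only [hu]
    rw [norm_div, Complex.norm_conj, Complex.norm_real, norm_norm]
    exact div_self_le_one _
  have hux : ∀ ψ x, |(u ψ * ψ x).re| ≤ 1 := fun ψ x => by
    refine (Complex.abs_re_le_norm _).trans ?_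
    rw [norm_mul, AddChar.norm_apply, mul_one]; exact hu1 ψ
  set th : ℝ := sinh (1 / 2) / cosh (1 / 2) with hth
  have hth1 : |th| ≤ 1 := by
    rw [hth, abs_div, abs_of_pos (cosh_pos _), div_le_one (cosh_pos _),
      abs_of_nonneg (sinh_nonneg_iff.2 (by norm_num))]
    exact (sinh_lt_cosh _).le
  have hR : ∑ x, γ x * ∏ ψ ∈ Λ, (1 + th * (u ψ * ψ x).re) ≤ 2 := by
    have := riesz γ hγ1 Λ (by positivity) hγhat (fun ψ => th * u ψ) (fun ψ => by
      rw [norm_mul, Complex.norm_real, Real.norm_eq_abs]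
      exact mul_le_one₀ hth1 (norm_nonneg _) (hu1 ψ))
    simp only [mul_assoc, Complex.re_ofReal_mul] at this
    refine this.trans ?_
    have h3 : (3 : ℝ) ^ #Λ * (1 / 2) ^ (2 * M) ≤ 1 := by
      calc _ ≤ (3 : ℝ) ^ M * (1 / 2) ^ (2 * M) := by gcongr; norm_num
        _ = (3 / 4) ^ M := by rw [pow_mul, ← mul_pow]; norm_num
        _ ≤ 1 := pow_le_one₀ (by norm_num) (by norm_num)
    linarith
  have hexp : ∀ x, exp (∑ ψ ∈ Λ, (u ψ * ψ x).re * (1 / 2)) ≤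
      exp (#Λ / 8) * ∏ ψ ∈ Λ, (1 + th * (u ψ * ψ x).re) := by
    intro x
    rw [exp_sum]
    calc _ ≤ ∏ ψ ∈ Λ, (exp (1 / 8) * (1 + th * (u ψ * ψ x).re)) := by
          refine Finset.prod_le_prod (fun _ _ => (exp_pos _).le) fun ψ _ => ?_
          have h1 := exp_mul_le_cosh_add_mul_sinh (hux ψ x) (1 / 2)
          have h2 := cosh_le_exp_half_sq (1 / 2)
          have h3 : cosh (1 / 2) + (u ψ * ψ x).re * sinh (1 / 2) =
              cosh (1 / 2) * (1 + th * (u ψ * ψ x).re) := by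
            rw [hth]; field_simp [(cosh_pos (1 / 2 : ℝ)).ne']
          rw [h3] at h1
          refine h1.trans (mul_le_mul_of_nonneg_right (h2.trans (le_of_eq (by norm_num))) ?_)
          have := abs_mul th (u ψ * ψ x).re
          have h4 : |th * (u ψ * ψ x).re| ≤ 1 := by
            rw [this]; exact mul_le_one₀ hth1 (abs_nonneg _) (hux ψ x)
          linarith [neg_le_of_abs_le h4]
      _ = _ := by
          rw [Finset.prod_mul_distrib, Finset.prod_const, ← exp_nat_mul]
          congr 2; ring
  have hmean : (#Λ : ℝ) / 4 ≤ ∑ x, f x * ∑ ψ ∈ Λ, (u ψ * ψ x).re * (1 / 2) := by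
    have e : ∑ x, f x * ∑ ψ ∈ Λ, (u ψ * ψ x).re * (1 / 2) =
        ∑ ψ ∈ Λ, ‖hat f ψ‖ * (1 / 2) := by
      simp_rw [Finset.mul_sum]
      rw [Finset.sum_comm]
      refine Finset.sum_congr rfl fun ψ _ => ?_
      have h1 : (u ψ * hat f ψ) = (‖hat f ψ‖ : ℂ) := by
        simp only [hu]
        rw [div_mul_eq_mul_div, mul_comm, Complex.mul_conj, Complex.normSq_eq_norm_sq]
        by_cases h0 : ‖hat f ψ‖ = 0
        · simp [h0]
        · have : (‖hat f ψ‖ : ℂ) ≠ 0 := by exact_mod_cast h0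
          push_cast; field_simp
      have h2 := congrArg Complex.re h1
      rw [Complex.ofReal_re, hat, Finset.mul_sum, Complex.re_sum] at h2
      rw [hat, ← h2, Finset.sum_mul]
      refine Finset.sum_congr rfl fun x _ => ?_
      rw [mul_left_comm (u ψ), Complex.re_ofReal_mul]; ring
    rw [e]
    calc (#Λ : ℝ) / 4 = ∑ ψ ∈ Λ, (1 / 2 : ℝ) * (1 / 2) := by
          rw [Finset.sum_const, nsmul_eq_mul]; ring
      _ ≤ _ := Finset.sum_le_sum fun ψ hψ => by linarith [hspec ψ hψ]
  have hj := convexOn_exp.map_sum_le (t := univ) (w := f)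
    (p := fun x => ∑ ψ ∈ Λ, (u ψ * ψ x).re * (1 / 2)) (fun x _ => hf x) hf1
    (fun _ _ => Set.mem_univ _)
  simp only [smul_eq_mul] at hj
  have hP0 : ∀ x, 0 ≤ ∏ ψ ∈ Λ, (1 + th * (u ψ * ψ x).re) := fun x =>
    nonneg_of_mul_nonneg_right ((exp_pos _).le.trans (hexp x)) (exp_pos _)
  have hfin : exp (#Λ / 4) ≤ 4 / σ * exp (#Λ / 8) := by
    calc exp (#Λ / 4) ≤ exp (∑ x, f x * ∑ ψ ∈ Λ, (u ψ * ψ x).re * (1 / 2)) := exp_le_exp.2 hmean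
      _ ≤ _ := hj
      _ ≤ ∑ x, (2 / σ * γ x) * (exp (#Λ / 8) * ∏ ψ ∈ Λ, (1 + th * (u ψ * ψ x).re)) := by
          refine Finset.sum_le_sum fun x _ => mul_le_mul ?_ (hexp x) (exp_pos _).le ?_
          · rw [div_mul_eq_mul_div, le_div_iff₀ hσ, mul_comm]
            exact (hfσ x).trans (hgγ x)
          · have : 0 ≤ γ x := by linarith [hgγ x, gibbs_nonneg N s x]
            positivity
      _ = 2 / σ * exp (#Λ / 8) * ∑ x, γ x * ∏ ψ ∈ Λ, (1 + th * (u ψ * ψ x).re) := by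
          rw [Finset.mul_sum]
          exact Finset.sum_congr rfl fun x _ => by ring
      _ ≤ 2 / σ * exp (#Λ / 8) * 2 := by gcongr
      _ = _ := by ring
  have e8 : exp ((#Λ : ℝ) / 4) = exp (#Λ / 8) * exp (#Λ / 8) := by
    rw [← exp_add]; congr 1; ring
  rw [e8] at hfin
  have h9 := le_of_mul_le_mul_right hfin (exp_pos _)
  have h10 := log_le_log (exp_pos _) h9
  rw [log_exp] at h10
  linarith

lemma norm_sub_one_le_of_hat (h : IsBohrLength N D) {s : ℝ} (hs : 0 ≤ s) {ψ : AddChar G ℂ}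
    (hψ : 1 / 2 ≤ ‖hat (gibbs N s) ψ‖) {t : G} (ht : s * N t ≤ 1) :
    ‖ψ t - 1‖ ≤ 4 * s * N t := by
  have e : (ψ t - 1) * hat (gibbs N s) ψ =
      ∑ x, ((gibbs N s (x - t) - gibbs N s x : ℝ) : ℂ) * ψ x := by
    have : ψ t * hat (gibbs N s) ψ = ∑ x, (gibbs N s (x - t) : ℂ) * ψ x := by
      rw [hat, Finset.mul_sum]
      refine Fintype.sum_equiv (Equiv.addRight t) _ _ fun x => ?_
      simp only [Equiv.coe_addRight, add_sub_cancel_right, AddChar.map_add_eq_mul]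
      ring
    rw [sub_mul, this, one_mul, hat, ← Finset.sum_sub_distrib]
    exact Finset.sum_congr rfl fun x _ => by push_cast; ring
  have hst : 0 ≤ s * N t := mul_nonneg hs (h.nonneg t)
  have hb : ‖∑ x, ((gibbs N s (x - t) - gibbs N s x : ℝ) : ℂ) * ψ x‖ ≤ 2 * (s * N t) := by
    refine (norm_sum_le _ _).trans ?_
    calc _ ≤ ∑ x, 2 * (s * N t) * gibbs N s x := by
          refine Finset.sum_le_sum fun x _ => ?_
          rw [norm_mul, AddChar.norm_apply, mul_one, Complex.norm_real, Real.norm_eq_abs]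
          have h1 := h.gibbs_sub_le hs x t
          have h2 := h.le_gibbs_sub hs x t
          have h3 := (le_abs_self _).trans (abs_exp_sub_one_le (x := s * N t)
            (by rwa [abs_of_nonneg hst]))
          have h4 := add_one_le_exp (-(s * N t))
          rw [abs_of_nonneg hst] at h3
          have h5 := gibbs_nonneg N s x
          rw [abs_le]
          constructor <;> nlinarith
      _ = 2 * (s * N t) := by rw [← Finset.mul_sum, sum_gibbs, mul_one]
  rw [← e, norm_mul] at hb
  have := mul_le_mul_of_nonneg_left hψ (norm_nonneg (ψ t - 1))
  linarith

lemma norm_mul_sub_one_le {z w : ℂ} (hz : ‖z‖ = 1) : ‖z * w - 1‖ ≤ ‖z - 1‖ + ‖w - 1‖ := by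
  have e : z * w - 1 = z * (w - 1) + (z - 1) := by ring
  rw [e]
  refine (norm_add_le _ _).trans ?_
  rw [norm_mul, hz, one_mul, add_comm]

lemma norm_inv_sub_one {z : ℂ} (hz : ‖z‖ = 1) : ‖z⁻¹ - 1‖ = ‖z - 1‖ := by
  have h0 : z ≠ 0 := by rintro rfl; simp at hz
  have e : z⁻¹ - 1 = -(z⁻¹ * (z - 1)) := by field_simp; ring
  rw [e, norm_neg, norm_mul, norm_inv, hz, inv_one, one_mul]

lemma norm_prod_sub_one_le {ι : Type*} (s : Finset ι) (z : ι → ℂ) (hz : ∀ i ∈ s, ‖z i‖ = 1) :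
    ‖∏ i ∈ s, z i - 1‖ ≤ ∑ i ∈ s, ‖z i - 1‖ := by
  induction s using Finset.induction_on with
  | empty => simp
  | insert i s hi ih =>
    rw [Finset.prod_insert hi, Finset.sum_insert hi]
    refine (norm_mul_sub_one_le (hz i (Finset.mem_insert_self i s))).trans ?_
    linarith [ih fun j hj => hz j (Finset.mem_insert_of_mem hj)]

/-- The large spectrum of `f` is controlled by few characters. -/
lemma exists_chang (h : IsBohrLength N D) {f : G → ℝ} (hf : ∀ x, 0 ≤ f x)
    (hf1 : ∑ x, f x = 1) {σ s s' : ℝ} (hσ : 0 < σ) (hs : 0 ≤ s) (hs' : 0 < s')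
    (hfσ : ∀ x, σ * f x ≤ gibbs N s x) {M : ℕ} (hM : 8 * M * D * s ≤ s')
    (hMσ : 8 * log (4 / σ) + 1 ≤ M) :
    ∃ Λ : Finset (AddChar G ℂ), (#Λ : ℝ) ≤ 8 * log (4 / σ) ∧
      ∀ ψ, 1 / 2 ≤ ‖hat f ψ‖ → ∀ t, s' * N t ≤ 1 →
        ‖ψ t - 1‖ ≤ ∑ χ ∈ Λ, ‖χ t - 1‖ + 4 * s' * N t := by
  set 𝓕 : Finset (Finset (AddChar G ℂ)) := univ.filter fun Λ =>
    IsDissociated (gibbs N s') Λ ∧ #Λ ≤ M ∧ ∀ ψ ∈ Λ, 1 / 2 ≤ ‖hat f ψ‖ with h𝓕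
  have hne : 𝓕.Nonempty := by
    refine ⟨∅, ?_⟩
    rw [h𝓕, Finset.mem_filter]
    refine ⟨mem_univ _, ?_, by simp, by simp⟩
    intro c hc hc0
    exfalso; apply hc0
    funext ψ
    rw [signs, Fintype.mem_piFinset] at hc
    simpa using hc ψ
  obtain ⟨Λ, hΛ, hmax⟩ := Finset.exists_max_image 𝓕 (fun Λ => #Λ) hne
  obtain ⟨-, hdis, hcard, hspec⟩ := Finset.mem_filter.1 hΛ
  have hle := card_le_of_isDissociated h hf hf1 hσ hs hs' hfσ hM hdis hcard hspec
  refine ⟨Λ, hle, fun ψ hψ t ht => ?_⟩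
  have hnt : 0 ≤ 4 * s' * N t := by have := h.nonneg t; positivity
  by_cases hmem : ψ ∈ Λ
  · have := Finset.single_le_sum (f := fun χ : AddChar G ℂ => ‖χ t - 1‖)
      (fun χ _ => norm_nonneg _) hmem
    linarith
  have hnot : ¬ IsDissociated (gibbs N s') (insert ψ Λ) := by
    intro hd
    have hc1 : #(insert ψ Λ) = #Λ + 1 := Finset.card_insert_of_notMem hmem
    have : insert ψ Λ ∈ 𝓕 := by
      rw [h𝓕, Finset.mem_filter]
      refine ⟨mem_univ _, hd, ?_, ?_⟩
      · rw [hc1]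
        have : (#Λ : ℝ) + 1 ≤ M := by linarith
        exact_mod_cast this
      · intro χ hχ
        rcases Finset.mem_insert.1 hχ with rfl | hχ
        · exact hψ
        · exact hspec χ hχ
    have := hmax _ this
    omega
  unfold IsDissociated at hnot
  push Not at hnot
  obtain ⟨c, hc, hc0, hbig⟩ := hnot
  have hcv : ∀ χ, c χ ∈ (if χ ∈ insert ψ Λ then ({-1, 0, 1} : Finset ℤ) else {0}) := by
    rw [signs, Fintype.mem_piFinset] at hc; exact hc
  have hψ0 : c ψ ≠ 0 := by
    intro h0
    have : c ∈ signs Λ := by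
      rw [signs, Fintype.mem_piFinset]
      intro χ
      have := hcv χ
      by_cases h1 : χ ∈ Λ
      · rw [if_pos h1]; rwa [if_pos (Finset.mem_insert_of_mem h1)] at this
      · rw [if_neg h1]
        by_cases h2 : χ = ψ
        · rw [h2, h0]; simp
        · rwa [if_neg (by simp [h1, h2])] at this
    linarith [hdis c this hc0]
  have hone : ∀ χ : AddChar G ℂ, ‖χ t ^ c χ‖ = 1 := fun χ => by
    rw [norm_zpow, AddChar.norm_apply, one_zpow]
  have hsign : ∀ χ : AddChar G ℂ, ‖χ t ^ c χ - 1‖ ≤ ‖χ t - 1‖ := by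
    intro χ
    have := hcv χ
    have h3 : c χ = -1 ∨ c χ = 0 ∨ c χ = 1 := by
      split_ifs at this <;> simp at this <;> tauto
    rcases h3 with h3 | h3 | h3
    · rw [h3, zpow_neg_one, norm_inv_sub_one (AddChar.norm_apply χ t)]
    · rw [h3]; simp
    · rw [h3, zpow_one]
  have hψe : ‖ψ t - 1‖ = ‖ψ t ^ c ψ - 1‖ := by
    have := hcv ψ
    rw [if_pos (Finset.mem_insert_self _ _)] at this
    simp at this
    rcases this with h3 | h3 | h3
    · rw [h3, zpow_neg_one, norm_inv_sub_one (AddChar.norm_apply ψ t)]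
    · exact absurd h3 hψ0
    · rw [h3, zpow_one]
  have hprod : (∏ χ : AddChar G ℂ, χ ^ c χ : AddChar G ℂ) t =
      ψ t ^ c ψ * ∏ χ ∈ Λ, χ t ^ c χ := by
    rw [AddChar.prod_apply]
    simp_rw [AddChar.zpow_apply]
    rw [← Finset.prod_subset (Finset.subset_univ (insert ψ Λ)), Finset.prod_insert hmem]
    intro χ _ hχ
    have := hcv χ
    rw [if_neg hχ, Finset.mem_singleton] at this
    rw [this, zpow_zero]
  have hΛ1 : ‖∏ χ ∈ Λ, χ t ^ c χ‖ = 1 := by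
    rw [norm_prod]; exact Finset.prod_eq_one fun χ _ => hone χ
  have hψp : ψ t ^ c ψ = (∏ χ : AddChar G ℂ, χ ^ c χ : AddChar G ℂ) t *
      (∏ χ ∈ Λ, χ t ^ c χ)⁻¹ := by
    rw [hprod, mul_assoc, mul_inv_cancel₀, mul_one]
    intro h0; rw [h0] at hΛ1; simp at hΛ1
  rw [hψe, hψp]
  refine (norm_mul_sub_one_le (AddChar.norm_apply _ t)).trans ?_
  rw [norm_inv_sub_one hΛ1]
  have h4 := norm_sub_one_le_of_hat h hs'.le hbig.le ht
  have h5 := norm_prod_sub_one_le Λ (fun χ => χ t ^ c χ) fun χ _ => hone χ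
  have h6 : ∑ χ ∈ Λ, ‖χ t ^ c χ - 1‖ ≤ ∑ χ ∈ Λ, ‖χ t - 1‖ :=
    Finset.sum_le_sum fun χ _ => hsign χ
  linarith

end Chang

section Rank

variable {G : Type*} [AddCommGroup G] [Fintype G]

/-- The length `x ↦ ∑ ψ, w ψ * ‖ψ x - 1‖`. -/
noncomputable def charLength (w : AddChar G ℂ → ℝ) (x : G) : ℝ := ∑ ψ, w ψ * ‖ψ x - 1‖

/-- `N` is a weighted sum of at most `d` character lengths with weights at most `W`. -/
def HasRank (N : G → ℝ) (d : ℕ) (W : ℝ) : Prop :=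
  ∃ w : AddChar G ℂ → ℝ, (∀ ψ, 0 ≤ w ψ) ∧ (∀ ψ, w ψ ≤ W) ∧
    #(univ.filter fun ψ => w ψ ≠ 0) ≤ d ∧ N = charLength w

lemma norm_map_sub_sub_one (ψ : AddChar G ℂ) (x y : G) : ‖ψ (x - y) - 1‖ = ‖ψ x - ψ y‖ := by
  have : ψ (x - y) - 1 = ψ (-y) * (ψ x - ψ y) := by
    rw [mul_sub, ← AddChar.map_add_eq_mul, ← AddChar.map_add_eq_mul, neg_add_cancel,
      AddChar.map_zero_eq_one]
    congr 2; abel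
  rw [this, norm_mul, AddChar.norm_apply, one_mul]

lemma charLength_sub (w : AddChar G ℂ → ℝ) (x y : G) :
    charLength w (x - y) = ∑ ψ, w ψ * ‖ψ x - ψ y‖ := by
  simp_rw [charLength, norm_map_sub_sub_one]

lemma sum_Icc_exp_le (M : ℕ) :
    ∑ j ∈ Finset.Icc (-(M : ℤ)) M, exp (-(|(j : ℝ)| / 4)) ≤ 10 := by
  set q : ℝ := exp (-(1 / 4)) with hq
  have hq0 : 0 < q := exp_pos _
  have hq1 : q ≤ 4 / 5 := by
    rw [hq, exp_neg]
    have := add_one_le_exp (1 / 4 : ℝ)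
    rw [inv_le_comm₀ (exp_pos _) (by norm_num)]
    norm_num at this ⊢; linarith
  have e : ∀ j : ℤ, exp (-(|(j : ℝ)| / 4)) = q ^ j.natAbs := by
    intro j
    rw [hq, ← exp_nat_mul, Nat.cast_natAbs, Int.cast_abs]
    congr 1; ring
  simp_rw [e]
  rw [← Finset.sum_fiberwise_of_maps_to (g := Int.natAbs) (t := Finset.range (M + 1))
    (fun j hj => by rw [Finset.mem_Icc] at hj; rw [Finset.mem_range]; omega)]
  have hfib : ∀ n ∈ Finset.range (M + 1),
      ∑ j ∈ (Finset.Icc (-(M : ℤ)) M).filter (fun j => j.natAbs = n), q ^ j.natAbs ≤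
        2 * q ^ n := by
    intro n _
    rw [Finset.sum_congr rfl fun j hj => by rw [(Finset.mem_filter.1 hj).2], Finset.sum_const,
      nsmul_eq_mul]
    refine mul_le_mul_of_nonneg_right ?_ (by positivity)
    have hsub : (Finset.Icc (-(M : ℤ)) M).filter (fun j => j.natAbs = n) ⊆ {(n : ℤ), -(n : ℤ)} := by
      intro j hj
      have := (Finset.mem_filter.1 hj).2
      rw [Finset.mem_insert, Finset.mem_singleton]; omega
    exact_mod_cast (Finset.card_le_card hsub).trans Finset.card_le_two
  refine (Finset.sum_le_sum hfib).trans ?_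
  rw [← Finset.mul_sum]
  have hgeo : ∑ n ∈ Finset.range (M + 1), q ^ n ≤ (1 - q)⁻¹ :=
    (Summable.sum_le_tsum _ (fun n _ => by positivity)
      (summable_geometric_of_lt_one hq0.le (by linarith))).trans
      (tsum_geometric_of_lt_one hq0.le (by linarith)).le
  have : (1 - q)⁻¹ ≤ 5 := by
    rw [inv_le_comm₀ (by linarith) (by norm_num)]; linarith
  linarith

lemma doubling_aux (w : AddChar G ℂ → ℝ) (hw : ∀ ψ, 0 ≤ w ψ) {d : ℕ}
    (hd : #(univ.filter fun ψ => w ψ ≠ 0) ≤ d) :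
    ∑ x, exp (-(charLength w x / 2)) ≤ exp (8 * d) * ∑ x, exp (-charLength w x) := by
  set S := univ.filter fun ψ : AddChar G ℂ => w ψ ≠ 0 with hS
  have hSd : (#S : ℝ) ≤ d := by exact_mod_cast hd
  have hNS : ∀ f : AddChar G ℂ → ℝ, ∑ ψ, w ψ * f ψ = ∑ ψ ∈ S, w ψ * f ψ := by
    intro f
    refine (Finset.sum_subset (Finset.subset_univ S) fun ψ _ hψ => ?_).symm
    have : w ψ = 0 := by simpa [hS] using hψ
    rw [this, zero_mul]
  set c : G → AddChar G ℂ → ℤ × ℤ := fun x ψ =>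
    (⌊w ψ * ((ψ x).re - 1)⌋, ⌊w ψ * (ψ x).im⌋) with hc
  set Z := ∑ x, exp (-charLength w x) with hZ
  have hfib : ∀ b, (#(univ.filter fun x => c x = b) : ℝ) ≤ exp (2 * d) * Z := by
    intro b
    rcases (univ.filter fun x => c x = b).eq_empty_or_nonempty with h0 | ⟨x₀, hx₀⟩
    · rw [h0]; simp; positivity
    · have hcx₀ := (Finset.mem_filter.1 hx₀).2
      have hclose : ∀ x ∈ univ.filter (fun x => c x = b), charLength w (x - x₀) ≤ 2 * d := by
        intro x hx
        have hcx := (Finset.mem_filter.1 hx).2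
        rw [charLength_sub, hNS]
        calc _ ≤ ∑ ψ ∈ S, (2 : ℝ) := by
              refine Finset.sum_le_sum fun ψ _ => ?_
              have h1 := congrFun (hcx.trans hcx₀.symm) ψ
              simp only [hc, Prod.mk.injEq] at h1
              have h2 := Int.abs_sub_lt_one_of_floor_eq_floor h1.1
              have h3 := Int.abs_sub_lt_one_of_floor_eq_floor h1.2
              rw [← mul_sub, abs_mul, abs_of_nonneg (hw ψ)] at h2 h3
              have h4 := Complex.norm_le_abs_re_add_abs_im (ψ x - ψ x₀)
              rw [Complex.sub_re, Complex.sub_im] at h4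
              have h5 : (ψ x).re - 1 - ((ψ x₀).re - 1) = (ψ x).re - (ψ x₀).re := by ring
              rw [h5] at h2
              have := mul_le_mul_of_nonneg_left h4 (hw ψ)
              linarith
          _ = #S * 2 := by rw [Finset.sum_const, nsmul_eq_mul]
          _ ≤ _ := by linarith
      calc (#(univ.filter fun x => c x = b) : ℝ) =
            ∑ x ∈ univ.filter (fun x => c x = b), (1 : ℝ) := by simp
        _ ≤ ∑ x ∈ univ.filter (fun x => c x = b),
              exp (2 * d) * exp (-charLength w (x - x₀)) := by
            refine Finset.sum_le_sum fun x hx => ?_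
            rw [← exp_add]
            exact one_le_exp (by linarith [hclose x hx])
        _ ≤ ∑ x, exp (2 * d) * exp (-charLength w (x - x₀)) :=
            Finset.sum_le_sum_of_subset_of_nonneg (Finset.subset_univ _)
              fun _ _ _ => by positivity
        _ = _ := by
            rw [← Finset.mul_sum, hZ]
            congr 1
            exact Fintype.sum_equiv (Equiv.subRight x₀) _ _ fun x => rfl
  set wt : ℤ × ℤ → ℝ := fun b => exp (1 / 2) *
    (exp (-(|(b.1 : ℝ)| / 4)) * exp (-(|(b.2 : ℝ)| / 4))) with hwt
  have hwt0 : ∀ b, 0 ≤ wt b := fun b => by simp only [hwt]; positivity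
  set Φ : (AddChar G ℂ → ℤ × ℤ) → ℝ := fun b => ∏ ψ ∈ S, wt (b ψ) with hΦ
  have hΦ0 : ∀ b, 0 ≤ Φ b := fun b => Finset.prod_nonneg fun ψ _ => hwt0 _
  have hfl : ∀ a : ℝ, |(⌊a⌋ : ℝ)| ≤ |a| + 1 := by
    intro a
    have h1 := Int.floor_le a
    have h2 := Int.lt_floor_add_one a
    rw [abs_le]
    constructor <;> linarith [neg_abs_le a, le_abs_self a]
  have hpt : ∀ x, exp (-(charLength w x / 2)) ≤ Φ (c x) := by
    intro x
    rw [charLength, hNS, Finset.sum_div, ← Finset.sum_neg_distrib, exp_sum]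
    refine Finset.prod_le_prod (fun _ _ => (exp_pos _).le) fun ψ _ => ?_
    simp only [hwt, hc]
    rw [← exp_add, ← exp_add]
    refine exp_le_exp.2 ?_
    have h1 := hfl (w ψ * ((ψ x).re - 1))
    have h2 := hfl (w ψ * (ψ x).im)
    rw [abs_mul, abs_of_nonneg (hw ψ)] at h1 h2
    have h3 := mul_le_mul_of_nonneg_left (Complex.abs_re_le_norm (ψ x - 1)) (hw ψ)
    have h4 := mul_le_mul_of_nonneg_left (Complex.abs_im_le_norm (ψ x - 1)) (hw ψ)
    rw [Complex.sub_re, Complex.one_re] at h3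
    rw [Complex.sub_im, Complex.one_im, sub_zero] at h4
    linarith
  obtain ⟨M, hM⟩ : ∃ M : ℕ, ∀ x ψ, |(c x ψ).1| ≤ M ∧ |(c x ψ).2| ≤ M := by
    refine ⟨∑ x, ∑ ψ, ((c x ψ).1.natAbs + (c x ψ).2.natAbs), fun x ψ => ?_⟩
    have h1 := Finset.single_le_sum (f := fun ψ => (c x ψ).1.natAbs + (c x ψ).2.natAbs)
      (fun _ _ => Nat.zero_le _) (mem_univ ψ)
    have h2 := Finset.single_le_sum
      (f := fun x => ∑ ψ, ((c x ψ).1.natAbs + (c x ψ).2.natAbs))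
      (fun _ _ => Nat.zero_le _) (mem_univ x)
    have h3 := h1.trans h2
    rw [Int.abs_eq_natAbs, Int.abs_eq_natAbs]
    constructor <;> exact_mod_cast le_trans (by omega) h3
  set B : Finset (ℤ × ℤ) := Finset.Icc (-(M : ℤ)) M ×ˢ Finset.Icc (-(M : ℤ)) M with hB
  set P : Finset (AddChar G ℂ → ℤ × ℤ) :=
    Fintype.piFinset fun ψ => if ψ ∈ S then B else {0} with hP
  have hcP : ∀ x, c x ∈ P := by
    intro x
    rw [hP, Fintype.mem_piFinset]
    intro ψ
    split_ifs with h
    · rw [hB, Finset.mem_product, Finset.mem_Icc, Finset.mem_Icc]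
      have := hM x ψ
      rw [abs_le, abs_le] at this
      exact this
    · have : w ψ = 0 := by simpa [hS] using h
      simp [hc, this]
  have hPsum : ∑ b ∈ P, Φ b ≤ exp (6 * d) := by
    have e1 : ∀ b ∈ P, Φ b = ∏ ψ : AddChar G ℂ, if ψ ∈ S then wt (b ψ) else 1 := by
      intro b _
      simp only [hΦ]
      rw [Finset.prod_ite_mem, Finset.univ_inter]
    rw [Finset.sum_congr rfl e1, hP,
      ← Finset.prod_univ_sum (fun ψ => if ψ ∈ S then B else {0})
        (fun ψ b => if ψ ∈ S then wt b else 1)]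
    have e2 : ∀ ψ : AddChar G ℂ, ∑ b ∈ (if ψ ∈ S then B else {0}),
        (if ψ ∈ S then wt b else 1) = if ψ ∈ S then ∑ b ∈ B, wt b else 1 := by
      intro ψ; split_ifs <;> simp
    simp_rw [e2]
    rw [Finset.prod_ite_mem, Finset.univ_inter, Finset.prod_const]
    have h1 : ∑ b ∈ B, wt b ≤ exp 6 := by
      have : ∑ b ∈ B, wt b = exp (1 / 2) * ((∑ j ∈ Finset.Icc (-(M : ℤ)) M,
          exp (-(|(j : ℝ)| / 4))) * ∑ j ∈ Finset.Icc (-(M : ℤ)) M, exp (-(|(j : ℝ)| / 4))) := by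
        rw [hB, Finset.sum_product, Finset.sum_mul_sum, Finset.mul_sum]
        exact Finset.sum_congr rfl fun i _ => by rw [Finset.mul_sum]
      rw [this]
      have h10 := sum_Icc_exp_le M
      have h0 : 0 ≤ ∑ j ∈ Finset.Icc (-(M : ℤ)) M, exp (-(|(j : ℝ)| / 4)) :=
        Finset.sum_nonneg fun _ _ => (exp_pos _).le
      have h100 : (100 : ℝ) ≤ exp 5 := by
        have : exp 5 = exp 1 ^ 5 := by rw [← exp_nat_mul]; norm_num
        rw [this]
        calc (100 : ℝ) ≤ 2.7 ^ 5 := by norm_num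
          _ ≤ _ := pow_le_pow_left₀ (by norm_num) (by linarith [exp_one_gt_d9]) 5
      calc _ ≤ exp (1 / 2) * (10 * 10) := by gcongr
        _ ≤ exp 1 * exp 5 := by
            gcongr <;> norm_num
            exact h100
        _ = exp 6 := by rw [← exp_add]; norm_num
    calc _ ≤ exp 6 ^ #S := pow_le_pow_left₀ (Finset.sum_nonneg fun b _ => hwt0 b) h1 _
      _ = exp (6 * #S) := by rw [← exp_nat_mul, mul_comm]
      _ ≤ _ := exp_le_exp.2 (by linarith)
  calc _ ≤ ∑ x, Φ (c x) := Finset.sum_le_sum fun x _ => hpt x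
    _ = ∑ b ∈ P, ∑ x ∈ univ.filter (fun x => c x = b), Φ (c x) :=
        (Finset.sum_fiberwise_of_maps_to (fun x _ => hcP x) _).symm
    _ = ∑ b ∈ P, #(univ.filter fun x => c x = b) * Φ b := by
        refine Finset.sum_congr rfl fun b _ => ?_
        rw [Finset.sum_congr rfl fun x hx => by rw [(Finset.mem_filter.1 hx).2],
          Finset.sum_const, nsmul_eq_mul]
    _ ≤ ∑ b ∈ P, exp (2 * d) * Z * Φ b :=
        Finset.sum_le_sum fun b _ => mul_le_mul_of_nonneg_right (hfib b) (hΦ0 b)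
    _ = exp (2 * d) * Z * ∑ b ∈ P, Φ b := (Finset.mul_sum _ _ _).symm
    _ ≤ exp (2 * d) * Z * exp (6 * d) := by gcongr
    _ = exp (2 * d) * exp (6 * d) * Z := by ring
    _ = _ := by rw [← exp_add]; congr 2; ring

namespace HasRank

variable {N : G → ℝ} {d : ℕ} {W : ℝ}

lemma isBohrLength (h : HasRank N d W) : IsBohrLength N (8 * (d + 1)) := by
  obtain ⟨w, hw, -, hd, rfl⟩ := h
  refine ⟨by simp [charLength], fun x => ?_, fun x y => ?_, fun s hs => ?_⟩
  · refine Finset.sum_congr rfl fun ψ _ => ?_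
    rw [AddChar.map_neg_eq_inv, norm_inv_sub_one (AddChar.norm_apply ψ x)]
  · simp only [charLength]
    rw [← Finset.sum_add_distrib]
    refine Finset.sum_le_sum fun ψ _ => ?_
    rw [← mul_add, AddChar.map_add_eq_mul]
    exact mul_le_mul_of_nonneg_left (norm_mul_sub_one_le (AddChar.norm_apply ψ x)) (hw ψ)
  · have := doubling_aux (fun ψ => s * w ψ) (fun ψ => mul_nonneg hs.le (hw ψ)) (d := d) (by
      refine le_trans (le_of_eq ?_) hd
      congr 1; ext ψ; simp [hs.ne'])
    have e : ∀ x, charLength (fun ψ => s * w ψ) x = s * charLength w x := by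
      intro x; simp_rw [charLength, mul_assoc, Finset.mul_sum]
    simp_rw [e] at this
    calc _ = ∑ x, exp (-(s * charLength w x / 2)) := by
          refine Finset.sum_congr rfl fun x _ => ?_
          congr 1; ring
      _ ≤ _ := this
      _ ≤ _ := by
          gcongr
          linarith

lemma le (h : HasRank N d W) (hW : 0 ≤ W) (x : G) : N x ≤ 2 * d * W := by
  obtain ⟨w, hw, hW', hd, rfl⟩ := h
  have hSd : (#(univ.filter fun ψ => w ψ ≠ 0) : ℝ) ≤ d := by exact_mod_cast hd
  calc charLength w x ≤ ∑ ψ, (if w ψ ≠ 0 then 2 * W else 0) := by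
        refine Finset.sum_le_sum fun ψ _ => ?_
        split_ifs with h0
        · have : ‖ψ x - 1‖ ≤ 2 := by
            refine (norm_sub_le _ _).trans ?_
            rw [AddChar.norm_apply, norm_one]; norm_num
          have h1 := hW' ψ
          have h2 := hw ψ
          nlinarith [norm_nonneg (ψ x - 1)]
        · have : w ψ = 0 := by simpa using h0
          rw [this, zero_mul]
    _ = #(univ.filter fun ψ => w ψ ≠ 0) * (2 * W) := by
        rw [← Finset.sum_filter, Finset.sum_const, nsmul_eq_mul]
    _ ≤ d * (2 * W) := by gcongr
    _ = _ := by ring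

lemma comp_half (h : HasRank N d W) (e : G ≃+ G) : HasRank (fun x => N (e x)) d W := by
  obtain ⟨w, hw, hW', hd, rfl⟩ := h
  let E : AddChar G ℂ ≃ AddChar G ℂ :=
    { toFun := fun ψ => ψ.compAddMonoidHom e.toAddMonoidHom
      invFun := fun ψ => ψ.compAddMonoidHom e.symm.toAddMonoidHom
      left_inv := fun ψ => by ext x; simp
      right_inv := fun ψ => by ext x; simp }
  refine ⟨fun ψ => w (E.symm ψ), fun ψ => hw _, fun ψ => hW' _, le_trans (le_of_eq ?_) hd, ?_⟩
  · refine Finset.card_equiv E.symm fun ψ => ?_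
    simp
  · funext x
    refine Fintype.sum_equiv E _ _ fun ψ => ?_
    dsimp only
    rw [Equiv.symm_apply_apply]
    rfl

lemma add (h : HasRank N d W) {s v : ℝ} (hs : 0 ≤ s) (hv : 0 ≤ v) (Λ : Finset (AddChar G ℂ)) :
    HasRank (fun x => s * N x + v * ∑ ψ ∈ Λ, ‖ψ x - 1‖) (d + #Λ) (s * W + v) := by
  obtain ⟨w, hw, hW', hd, rfl⟩ := h
  refine ⟨fun ψ => s * w ψ + v * if ψ ∈ Λ then 1 else 0, fun ψ => ?_, fun ψ => ?_, ?_, ?_⟩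
  · have := hw ψ
    dsimp only
    split_ifs <;> positivity
  · have := mul_le_mul_of_nonneg_left (hW' ψ) hs
    dsimp only
    split_ifs <;> linarith
  · refine le_trans (Finset.card_le_card fun ψ hψ => ?_)
      ((Finset.card_union_le (univ.filter fun ψ => w ψ ≠ 0) Λ).trans (by omega))
    rw [Finset.mem_union]
    by_contra hn
    push Not at hn
    have h1 : w ψ = 0 := by simpa using hn.1
    simp [h1, hn.2] at hψ
  · funext x
    simp only [charLength, add_mul, Finset.sum_add_distrib, Finset.mul_sum, mul_assoc]
    congr 1
    simp

end HasRank

lemma IsBohrLength.card_le {N : G → ℝ} {D : ℝ} (h : IsBohrLength N D) {B : ℝ}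
    (hB : ∀ x, N x ≤ B) : ∀ (j : ℕ) {s : ℝ}, 0 < s → s * B ≤ 2 ^ j →
      (Fintype.card G : ℝ) ≤ exp (1 + j * D) * partition N s
  | 0, s, hs, hj => by
      rw [partition, Finset.mul_sum, Fintype.card_eq_sum_ones]
      push_cast
      refine Finset.sum_le_sum fun x _ => ?_
      rw [← exp_add]
      refine one_le_exp ?_
      have := mul_le_mul_of_nonneg_left (hB x) hs.le
      simp at hj ⊢
      linarith
  | j + 1, s, hs, hj => by
      have h1 := IsBohrLength.card_le h hB j (s := s / 2) (by positivity) (by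
        rw [pow_succ] at hj; linarith)
      refine h1.trans ?_
      calc _ ≤ exp (1 + j * D) * (exp D * partition N s) := by
            gcongr; exact h.doubling s hs
        _ = _ := by
            rw [← mul_assoc, ← exp_add]; congr 2; push_cast; ring

end Rank

section Increment

variable {G : Type*} [AddCommGroup G] [Fintype G] {N : G → ℝ} {D : ℝ}

lemma IsBohrLength.le_sum_gibbs_mul_density (h : IsBohrLength N D) {A : G → ℝ} (hA0 : ∀ x, 0 ≤ A x)
    {α c s : ℝ} (hs : 0 < s) (hα : 0 ≤ α) (hsD : 2 * D ≤ c * s) {x₀ : G}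
    (hx₀ : α ≤ ∑ y, gibbs N 1 y * A (x₀ + y)) :
    (1 - c) * α ≤ ∑ x, gibbs N 1 x * ∑ y, gibbs N s y * A (x₀ + x + y) := by
  have h1 : ∀ y, α * (1 - N y) ≤ ∑ x, gibbs N 1 x * A (x₀ + x + y) := by
    intro y
    have e : ∑ x, gibbs N 1 x * A (x₀ + x + y) = ∑ z, gibbs N 1 (z - y) * A (x₀ + z) := by
      refine Fintype.sum_equiv (Equiv.addRight y) _ _ fun x => ?_
      simp [add_assoc]
    rw [e]
    have h2 : exp (-(1 * N y)) * ∑ z, gibbs N 1 z * A (x₀ + z)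
        ≤ ∑ z, gibbs N 1 (z - y) * A (x₀ + z) := by
      rw [Finset.mul_sum]
      refine Finset.sum_le_sum fun z _ => ?_
      rw [← mul_assoc]
      exact mul_le_mul_of_nonneg_right (h.le_gibbs_sub zero_le_one z y) (hA0 _)
    refine le_trans ?_ h2
    have h3 := one_sub_le_exp_neg (1 * N y)
    rw [mul_comm]
    calc (1 - N y) * α ≤ exp (-(1 * N y)) * α := by
          refine mul_le_mul_of_nonneg_right (by linarith) hα
      _ ≤ _ := by gcongr
  calc (1 - c) * α ≤ α * (1 - ∑ y, gibbs N s y * N y) := by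
        have h2 : ∑ y, gibbs N s y * N y ≤ c :=
          (h.sum_gibbs_mul_le hs).trans ((div_le_iff₀ hs).2 hsD)
        rw [mul_comm]
        gcongr
    _ = ∑ y, gibbs N s y * (α * (1 - N y)) := by
        have : ∀ y, gibbs N s y * (α * (1 - N y)) =
          α * (gibbs N s y - gibbs N s y * N y) := fun y => by ring
        simp_rw [this]
        rw [← Finset.mul_sum, Finset.sum_sub_distrib, sum_gibbs]
    _ ≤ ∑ y, gibbs N s y * ∑ x, gibbs N 1 x * A (x₀ + x + y) :=
        Finset.sum_le_sum fun y _ => mul_le_mul_of_nonneg_left (h1 y) (gibbs_nonneg _ _ _)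
    _ = _ := by
        simp_rw [Finset.mul_sum]
        rw [Finset.sum_comm]
        exact Finset.sum_congr rfl fun x _ => Finset.sum_congr rfl fun y _ => by ring

lemma IsBohrLength.exists_center (h : IsBohrLength N D) {A : G → ℝ} (hA0 : ∀ x, 0 ≤ A x)
    {α c s t : ℝ} (hs : 0 < s) (ht : 0 < t) (hα : 0 ≤ α) (hsD : 2 * D ≤ c * s)
    (htD : 2 * D ≤ c * t) {x₀ : G} (hx₀ : α ≤ ∑ y, gibbs N 1 y * A (x₀ + y))
    (hs' : ∀ x, ∑ y, gibbs N s y * A (x + y) ≤ (1 + c) * α)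
    (ht' : ∀ x, ∑ y, gibbs N t y * A (x + y) ≤ (1 + c) * α) :
    ∃ x, (1 - 3 * c) * α ≤ ∑ y, gibbs N s y * A (x + y) ∧
      (1 - 3 * c) * α ≤ ∑ y, gibbs N t y * A (x + y) := by
  have h1 := h.le_sum_gibbs_mul_density hA0 hs hα hsD hx₀
  have h2 := h.le_sum_gibbs_mul_density hA0 ht hα htD hx₀
  obtain ⟨x, hx⟩ := exists_le_of_le_sum (gibbs N 1)
    (fun x => ∑ y, gibbs N s y * A (x₀ + x + y) + ∑ y, gibbs N t y * A (x₀ + x + y))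
    (gibbs_nonneg N 1) (sum_gibbs N 1) (c := 2 * ((1 - c) * α)) (by
      simp_rw [mul_add, Finset.sum_add_distrib]
      linarith)
  have h3 := hs' (x₀ + x)
  have h4 := ht' (x₀ + x)
  exact ⟨x₀ + x, by linarith, by linarith⟩

lemma IsBohrLength.gibbs_one_le (h : IsBohrLength N D) (y : G) :
    gibbs N 1 y ≤ 1 / partition N 1 := by
  refine div_le_div_of_nonneg_right ?_ (partition_pos N 1).le
  rw [exp_le_one_iff]
  linarith [h.nonneg y]

lemma sum_gibbs_one_sq (N : G → ℝ) :
    ∑ y, gibbs N 1 y ^ 2 = partition N 2 / partition N 1 ^ 2 := by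
  simp_rw [gibbs, div_pow, ← Finset.sum_div]
  congr 1
  refine Finset.sum_congr rfl fun y _ => ?_
  rw [← exp_nat_mul]
  congr 1
  push_cast
  ring

lemma gibbs_one_sq (N : G → ℝ) (y : G) :
    gibbs N 1 y ^ 2 = (∑ z, gibbs N 1 z ^ 2) * gibbs N 2 y := by
  have h1 := (partition_pos N 1).ne'
  have h2 := (partition_pos N 2).ne'
  rw [sum_gibbs_one_sq, gibbs, gibbs, div_pow, ← exp_nat_mul]
  field_simp
  congr 1
  push_cast
  ring

lemma sum_gibbs_one_sq_pos (N : G → ℝ) : 0 < ∑ y, gibbs N 1 y ^ 2 := by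
  rw [sum_gibbs_one_sq]
  exact div_pos (partition_pos N 2) (pow_pos (partition_pos N 1) 2)

/-- The balanced function of `A` relative to the weight `gibbs N 1`. -/
noncomputable def balanced (N : G → ℝ) (A : G → ℝ) (α : ℝ) (y : G) : ℝ :=
  gibbs N 1 y * (A y / α - 1)

/-- The normalised restriction of `A` to the weight `gibbs N 1`. -/
noncomputable def restricted (N : G → ℝ) (A : G → ℝ) (α : ℝ) (y : G) : ℝ :=
  gibbs N 1 y * (A y / α)

lemma restricted_eq (N A : G → ℝ) (α : ℝ) (y : G) :
    restricted N A α y = balanced N A α y + gibbs N 1 y := by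
  rw [restricted, balanced]; ring

/-- Sets without nontrivial three-term progressions have few solutions to `x + z = 2 y`. -/
lemma IsBohrLength.half_le_sum_conv_balanced (h : IsBohrLength N D) {A : G → ℝ}
    (hA0 : ∀ x, 0 ≤ A x) (hA1 : ∀ x, A x ≤ 1)
    (hfree : ∀ x y z, x + z = y + y → A x ≠ 0 → A y ≠ 0 → A z ≠ 0 → x = y)
    {α q : ℝ} (hα : 0 < α) (hq : 0 < q) (hqD : 8000 * D ≤ α * q)
    (h2 : (1 - 1 / 1000) * α ≤ ∑ y, gibbs N 2 y * A y)
    (hq1 : (1 - 1 / 1000) * α ≤ ∑ y, gibbs N q y * A y)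
    (hq2 : ∑ y, gibbs N q y * A y ≤ (1 + 1 / 1000) * α)
    (hZ : 8 ≤ α ^ 2 * partition N 2) :
    (∑ y, gibbs N 1 y ^ 2) / 2 * α ≤ ∑ y, gibbs N q y * A y *
      |conv (balanced N A α) (balanced N A α) (y + y)| := by
  set κ := ∑ y, gibbs N 1 y ^ 2 with hκ
  have hκ0 : 0 < κ := sum_gibbs_one_sq_pos N
  have hpt : ∀ y, conv (restricted N A α) (restricted N A α) (y + y)
      ≥ conv (balanced N A α) (balanced N A α) (y + y) + κ * (2 * (1 - 1 / 1000) * (1 - 2 * N y) - 1) := by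
    intro y
    have e1 : conv (restricted N A α) (restricted N A α) (y + y)
        = conv (balanced N A α) (balanced N A α) (y + y)
          + ((∑ z, restricted N A α z * gibbs N 1 (y + y - z))
            + (∑ z, gibbs N 1 z * restricted N A α (y + y - z))
            - ∑ z, gibbs N 1 z * gibbs N 1 (y + y - z)) := by
      rw [conv, conv, ← Finset.sum_add_distrib, ← Finset.sum_sub_distrib, ← Finset.sum_add_distrib]
      refine Finset.sum_congr rfl fun z _ => ?_
      rw [restricted_eq, restricted_eq]
      ring
    have e2 : ∑ z, gibbs N 1 z * restricted N A α (y + y - z)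
        = ∑ z, restricted N A α z * gibbs N 1 (y + y - z) := by
      refine Fintype.sum_equiv (Equiv.subLeft (y + y)) _ _ fun z => ?_
      simp [mul_comm]
    have e3 : ∑ z, gibbs N 1 z * gibbs N 1 (y + y - z) ≤ κ := by
      have e4 : ∑ z, gibbs N 1 (y + y - z) ^ 2 = κ :=
        Fintype.sum_equiv (Equiv.subLeft (y + y)) _ _ fun z => by simp
      calc _ ≤ ∑ z, (gibbs N 1 z ^ 2 + gibbs N 1 (y + y - z) ^ 2) / 2 :=
            Finset.sum_le_sum fun z _ => by nlinarith [sq_nonneg (gibbs N 1 z - gibbs N 1 (y + y - z))]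
        _ = κ := by rw [← Finset.sum_div, Finset.sum_add_distrib, e4]; ring
    have e5 : κ * ((1 - 1 / 1000) * (1 - 2 * N y))
        ≤ ∑ z, restricted N A α z * gibbs N 1 (y + y - z) := by
      have e6 : ∀ z, exp (-(1 * N (y + y))) * (κ * (gibbs N 2 z * A z) / α)
          ≤ restricted N A α z * gibbs N 1 (y + y - z) := by
        intro z
        have e7 := h.le_gibbs_sub zero_le_one z (y + y)
        have e8 : gibbs N 1 (z - (y + y)) = gibbs N 1 (y + y - z) := by
          rw [← h.gibbs_neg, neg_sub]
        rw [e8] at e7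
        have e9 : 0 ≤ restricted N A α z :=
          mul_nonneg (gibbs_nonneg _ _ _) (div_nonneg (hA0 z) hα.le)
        refine le_trans (le_of_eq ?_) (mul_le_mul_of_nonneg_left e7 e9)
        have e10 := gibbs_one_sq N z
        rw [← hκ] at e10
        rw [restricted, ← mul_assoc κ, ← e10]
        ring
      refine le_trans ?_ (Finset.sum_le_sum fun z _ => e6 z)
      rw [← Finset.mul_sum, ← Finset.sum_div, ← Finset.mul_sum]
      have e7 := one_sub_le_exp_neg (1 * N (y + y))
      have e8 := h.add y y
      have e9 : (1 - 1 / 1000) ≤ (∑ z, gibbs N 2 z * A z) / α := (le_div_iff₀ hα).2 h2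
      calc _ ≤ κ * ((1 - 1 / 1000) * exp (-(1 * N (y + y)))) := by
            gcongr
            linarith
        _ = exp (-(1 * N (y + y))) * (κ * (1 - 1 / 1000)) := by ring
        _ ≤ exp (-(1 * N (y + y))) * (κ * ((∑ z, gibbs N 2 z * A z) / α)) := by gcongr
        _ = _ := by ring
    rw [e1, e2]
    nlinarith
  have hup : ∑ y, gibbs N q y * A y * conv (restricted N A α) (restricted N A α) (y + y)
      ≤ κ / 4 * α := by
    have e1 : ∀ y, A y * conv (restricted N A α) (restricted N A α) (y + y)
        ≤ 1 / (partition N 1 ^ 2 * α ^ 2) * A y := by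
      intro y
      by_cases hy : A y = 0
      · simp [hy]
      have e2 : conv (restricted N A α) (restricted N A α) (y + y) = restricted N A α y ^ 2 := by
        rw [conv, Finset.sum_eq_single y]
        · rw [add_sub_cancel_right, sq]
        · intro z _ hzy
          by_contra hne
          refine hzy (hfree z y (y + y - z) (by abel) ?_ hy ?_)
          · intro h0; apply hne; simp [restricted, h0]
          · intro h0; apply hne; simp [restricted, h0]
        · simp
      rw [e2, mul_comm]
      refine mul_le_mul_of_nonneg_right ?_ (hA0 y)
      have e3 : restricted N A α y ≤ 1 / partition N 1 * (1 / α) := by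
        rw [restricted]
        have := h.gibbs_one_le y
        have := hA1 y
        have := gibbs_nonneg N 1 y
        have := hA0 y
        have := (partition_pos N 1).le
        gcongr
      have e9 : 0 ≤ restricted N A α y :=
        mul_nonneg (gibbs_nonneg _ _ _) (div_nonneg (hA0 y) hα.le)
      calc _ ≤ (1 / partition N 1 * (1 / α)) ^ 2 := pow_le_pow_left₀ e9 e3 2
        _ = _ := by field_simp
    calc _ ≤ ∑ y, gibbs N q y * (1 / (partition N 1 ^ 2 * α ^ 2) * A y) := by
          refine Finset.sum_le_sum fun y _ => ?_
          rw [mul_assoc]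
          exact mul_le_mul_of_nonneg_left (e1 y) (gibbs_nonneg _ _ _)
      _ = 1 / (partition N 1 ^ 2 * α ^ 2) * ∑ y, gibbs N q y * A y := by
          rw [Finset.mul_sum]
          exact Finset.sum_congr rfl fun y _ => by ring
      _ ≤ 1 / (partition N 1 ^ 2 * α ^ 2) * (2 * α) := by
          have := partition_pos N 1
          gcongr
          linarith
      _ ≤ κ / 4 * α := by
          have hp := partition_pos N 1
          rw [hκ, sum_gibbs_one_sq, ← sub_nonneg]
          have : partition N 2 / partition N 1 ^ 2 / 4 * α - 1 / (partition N 1 ^ 2 * α ^ 2) * (2 * α)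
              = (α ^ 2 * partition N 2 - 8) / (4 * α * partition N 1 ^ 2) := by
            field_simp; ring
          rw [this]
          exact div_nonneg (by linarith) (by positivity)
  have hGN : ∑ y, gibbs N q y * A y * N y ≤ α / 4000 := by
    calc _ ≤ ∑ y, gibbs N q y * N y := by
          refine Finset.sum_le_sum fun y _ => ?_
          have := mul_le_mul_of_nonneg_left (hA1 y)
            (mul_nonneg (gibbs_nonneg N q y) (h.nonneg y))
          linarith
      _ ≤ 2 * D / q := h.sum_gibbs_mul_le hq
      _ ≤ _ := by rw [div_le_iff₀ hq]; linarith
  have hlow : ∑ y, gibbs N q y * A y * conv (restricted N A α) (restricted N A α) (y + y) ≥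
      ∑ y, gibbs N q y * A y * (conv (balanced N A α) (balanced N A α) (y + y)
        + κ * (2 * (1 - 1 / 1000) * (1 - 2 * N y) - 1)) :=
    Finset.sum_le_sum fun y _ => mul_le_mul_of_nonneg_left (hpt y)
      (mul_nonneg (gibbs_nonneg _ _ _) (hA0 y))
  have hsplit : ∑ y, gibbs N q y * A y * (conv (balanced N A α) (balanced N A α) (y + y)
        + κ * (2 * (1 - 1 / 1000) * (1 - 2 * N y) - 1)) =
      ∑ y, gibbs N q y * A y * conv (balanced N A α) (balanced N A α) (y + y)
        + κ * ((2 * (1 - 1 / 1000) - 1) * ∑ y, gibbs N q y * A y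
          - 4 * (1 - 1 / 1000) * ∑ y, gibbs N q y * A y * N y) := by
    rw [Finset.mul_sum, Finset.mul_sum, ← Finset.sum_sub_distrib, Finset.mul_sum,
      ← Finset.sum_add_distrib]
    exact Finset.sum_congr rfl fun y _ => by ring
  have habs : -∑ y, gibbs N q y * A y * conv (balanced N A α) (balanced N A α) (y + y)
      ≤ ∑ y, gibbs N q y * A y * |conv (balanced N A α) (balanced N A α) (y + y)| := by
    rw [← Finset.sum_neg_distrib]
    refine Finset.sum_le_sum fun y _ => ?_
    rw [← mul_neg]
    exact mul_le_mul_of_nonneg_left (neg_le_abs _) (mul_nonneg (gibbs_nonneg _ _ _) (hA0 y))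
  have hκα : κ * (3 / 4 * α) ≤ κ * ((2 * (1 - 1 / 1000) - 1) * ∑ y, gibbs N q y * A y
          - 4 * (1 - 1 / 1000) * ∑ y, gibbs N q y * A y * N y) := by
    refine mul_le_mul_of_nonneg_left ?_ hκ0.le
    linarith
  linarith

end Increment

section Truncation

variable {G : Type*} [AddCommGroup G] [Fintype G] {N : G → ℝ} {D : ℝ}

/-- The weight `gibbs N s` conditioned on the ball `N x ≤ δ`. -/
noncomputable def truncated (N : G → ℝ) (s δ : ℝ) (x : G) : ℝ :=
  (gibbs N s x * if N x ≤ δ then 1 else 0) / ∑ y, gibbs N s y * if N y ≤ δ then 1 else 0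

lemma truncated_nonneg (N : G → ℝ) (s δ : ℝ) (x : G) : 0 ≤ truncated N s δ x := by
  have h : ∀ y, 0 ≤ gibbs N s y * if N y ≤ δ then (1 : ℝ) else 0 := fun y =>
    mul_nonneg (gibbs_nonneg _ _ _) (by split_ifs <;> norm_num)
  exact div_nonneg (h x) (Finset.sum_nonneg fun y _ => h y)

lemma truncated_support {s δ : ℝ} {x : G} (h : truncated N s δ x ≠ 0) : N x ≤ δ := by
  by_contra hn
  exact h (by simp [truncated, hn])

lemma sum_truncated {s δ c : ℝ} (hc : 0 < c)
    (hm : c ≤ ∑ y, gibbs N s y * if N y ≤ δ then 1 else 0) : ∑ x, truncated N s δ x = 1 := by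
  simp only [truncated]
  rw [← Finset.sum_div]
  exact div_self (hc.trans_le hm).ne'

lemma mul_truncated_le {s δ c : ℝ} (hc : 0 < c)
    (hm : c ≤ ∑ y, gibbs N s y * if N y ≤ δ then 1 else 0) (x : G) :
    c * truncated N s δ x ≤ gibbs N s x := by
  rw [truncated, mul_div_assoc', div_le_iff₀ (hc.trans_le hm)]
  have h1 : (gibbs N s x * if N x ≤ δ then (1 : ℝ) else 0) ≤ gibbs N s x := by
    have := gibbs_nonneg N s x
    split_ifs <;> simp [this]
  have h0 : 0 ≤ (gibbs N s x * if N x ≤ δ then (1 : ℝ) else 0) :=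
    mul_nonneg (gibbs_nonneg _ _ _) (by split_ifs <;> norm_num)
  exact (mul_le_mul hm h1 h0 (hc.le.trans hm)).trans (le_of_eq (mul_comm _ _))

end Truncation

section Lifting

variable {G : Type*} [AddCommGroup G] [Fintype G] {N : G → ℝ} {D : ℝ}

lemma gibbs_comp_half (N : G → ℝ) (e : G ≃+ G) (he : ∀ x, e x + e x = x) (s : ℝ) (y : G) :
    gibbs (fun x => N (e x)) s (y + y) = gibbs N s y := by
  have h1 : e (y + y) = y := by rw [map_add, he]
  have h2 : partition (fun x => N (e x)) s = partition N s :=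
    Fintype.sum_equiv e.toEquiv _ _ fun x => rfl
  rw [gibbs, gibbs, h2, h1]

lemma sum_comp_half (N : G → ℝ) (e : G ≃+ G) (he : ∀ x, e x + e x = x) (s : ℝ) (f : G → ℝ) :
    ∑ y, gibbs N s y * f (y + y) = ∑ x, gibbs (fun x => N (e x)) s x * f x := by
  symm
  refine Fintype.sum_equiv e.toEquiv _ _ fun x => ?_
  have := gibbs_comp_half N e he s (e x)
  rw [he] at this
  simp [this, he]

lemma pow_le_sum_pow {ι : Type*} [Fintype ι] (g A X : ι → ℝ) (hg : ∀ i, 0 ≤ g i)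
    (hA0 : ∀ i, 0 ≤ A i) (hA1 : ∀ i, A i ≤ 1) {κ α : ℝ} (hκ : 0 ≤ κ) (hα : 0 < α)
    (h1 : (1 - 1 / 1000) * α ≤ ∑ i, g i * A i) (h2 : ∑ i, g i * A i ≤ (1 + 1 / 1000) * α)
    (hX : κ / 2 * α ≤ ∑ i, g i * A i * |X i|) {p : ℕ} (hp : Even p) (hp0 : p ≠ 0)
    (hpα : (3 / 4) ^ p ≤ α) : (κ / 4) ^ p ≤ ∑ i, g i * X i ^ p := by
  set m := ∑ i, g i * A i with hm
  have hm0 : 0 < m := lt_of_lt_of_le (by linarith) h1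
  have hJ := Real.pow_arith_mean_le_arith_mean_pow univ (fun i => g i * A i / m) (fun i => |X i|)
    (fun i _ => div_nonneg (mul_nonneg (hg i) (hA0 i)) hm0.le)
    (by rw [← Finset.sum_div, ← hm, div_self hm0.ne']) (fun i _ => abs_nonneg _) p
  have e1 : ∑ i, g i * A i / m * |X i| = (∑ i, g i * A i * |X i|) / m := by
    rw [Finset.sum_div]; exact Finset.sum_congr rfl fun i _ => by ring
  have e2 : ∑ i, g i * A i / m * |X i| ^ p = (∑ i, g i * A i * X i ^ p) / m := by
    rw [Finset.sum_div]
    exact Finset.sum_congr rfl fun i _ => by rw [hp.pow_abs]; ring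
  rw [e1, e2] at hJ
  have h3 : κ / (2 * (1 + 1 / 1000)) ≤ (∑ i, g i * A i * |X i|) / m := by
    rw [le_div_iff₀ hm0]
    calc _ ≤ κ / (2 * (1 + 1 / 1000)) * ((1 + 1 / 1000) * α) := by gcongr
      _ = κ / 2 * α := by ring
      _ ≤ _ := hX
  have h4 : (κ / (2 * (1 + 1 / 1000))) ^ p ≤ (∑ i, g i * A i * X i ^ p) / m :=
    (pow_le_pow_left₀ (by positivity) h3 p).trans hJ
  have h5 : ∑ i, g i * A i * X i ^ p ≤ ∑ i, g i * X i ^ p := by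
    refine Finset.sum_le_sum fun i _ => ?_
    have := mul_le_mul_of_nonneg_left (hA1 i) (mul_nonneg (hg i) (hp.pow_nonneg (X i)))
    linarith
  rw [le_div_iff₀ hm0] at h4
  refine le_trans ?_ (h4.trans h5)
  have h6 : (2003 / 3000 : ℝ) ≤ 1 - 1/1000 := by norm_num
  have h7 : κ / 4 = κ / (2 * (1 + 1 / 1000)) * (1001 / 2000) := by ring
  have h8 : ((1001 : ℝ) / 2000) ^ p ≤ (3 / 4) ^ p * (2003 / 3000) := by
    obtain ⟨n, rfl⟩ := Nat.exists_eq_succ_of_ne_zero hp0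
    rw [pow_succ, pow_succ, mul_assoc]
    exact mul_le_mul (pow_le_pow_left₀ (by norm_num) (by norm_num) n) (by norm_num)
      (by norm_num) (by positivity)
  rw [h7, mul_pow]
  gcongr
  calc _ ≤ (3 / 4) ^ p * (2003 / 3000 : ℝ) := h8
    _ ≤ α * (1 - 1 / 1000) := by gcongr
    _ ≤ m := by linarith

lemma IsBohrLength.pow_le_sum_corr_pow (h : IsBohrLength N D) {ω X : G → ℝ} (hω : ∀ x, 0 ≤ ω x)
    (hω1 : ∑ x, ω x = 1) {q δ : ℝ} (hq : 0 ≤ q) (hqδ : 2 * q * δ ≤ 1)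
    (hωδ : ∀ x, ω x ≠ 0 → N x ≤ δ) {p : ℕ} (hp : Even p) (hp0 : p ≠ 0) {κ : ℝ} (hκ : 0 ≤ κ)
    (hX : (κ / 4) ^ p ≤ ∑ x, gibbs N q x * conv X X x ^ p) :
    (κ / 8) ^ p ≤ ∑ u, ∑ v, ω u * ω v * corr X u v ^ p := by
  have h1 : ∀ t, ∑ u, ∑ v, ω u * ω v * conv X X (t + u - v) ^ p
      ≤ ∑ u, ∑ v, ω u * ω v * corr X u v ^ p := fun t => sum_conv_pow_le ω X p t
  have h2 : ∀ u v, ω u * ω v * (exp (-1) * ∑ x, gibbs N q x * conv X X x ^ p)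
      ≤ ω u * ω v * ∑ t, gibbs N q t * conv X X (t + u - v) ^ p := by
    intro u v
    by_cases hu : ω u = 0
    · simp [hu]
    by_cases hv : ω v = 0
    · simp [hv]
    refine mul_le_mul_of_nonneg_left ?_ (mul_nonneg (hω u) (hω v))
    have e1 : ∑ t, gibbs N q t * conv X X (t + u - v) ^ p
        = ∑ x, gibbs N q (x - (u - v)) * conv X X x ^ p := by
      refine Fintype.sum_equiv (Equiv.addRight (u - v)) _ _ fun t => ?_
      simp [add_sub_assoc]
    rw [e1, Finset.mul_sum]
    refine Finset.sum_le_sum fun x _ => ?_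
    rw [← mul_assoc]
    refine mul_le_mul_of_nonneg_right ?_ (hp.pow_nonneg _)
    refine le_trans ?_ (h.le_gibbs_sub hq x (u - v))
    refine mul_le_mul_of_nonneg_right (exp_le_exp.2 ?_) (gibbs_nonneg _ _ _)
    have h3 := h.sub u v
    have h4 := hωδ u hu
    have h5 := hωδ v hv
    have h6 : q * N (u - v) ≤ q * (2 * δ) := mul_le_mul_of_nonneg_left (by linarith) hq
    linarith
  have h3 : exp (-1) * ∑ x, gibbs N q x * conv X X x ^ p
      ≤ ∑ u, ∑ v, ω u * ω v * corr X u v ^ p := by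
    calc _ = ∑ u, ∑ v, ω u * ω v * (exp (-1) * ∑ x, gibbs N q x * conv X X x ^ p) := by
          simp_rw [← Finset.sum_mul, ← Finset.mul_sum, hω1, mul_one, hω1, one_mul]
      _ ≤ ∑ u, ∑ v, ω u * ω v * ∑ t, gibbs N q t * conv X X (t + u - v) ^ p :=
          Finset.sum_le_sum fun u _ => Finset.sum_le_sum fun v _ => h2 u v
      _ = ∑ t, gibbs N q t * ∑ u, ∑ v, ω u * ω v * conv X X (t + u - v) ^ p := by
          simp_rw [Finset.mul_sum]
          rw [Finset.sum_congr rfl fun u _ => Finset.sum_comm, Finset.sum_comm]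
          exact Finset.sum_congr rfl fun t _ => Finset.sum_congr rfl fun u _ =>
            Finset.sum_congr rfl fun v _ => by ring
      _ ≤ ∑ t, gibbs N q t * ∑ u, ∑ v, ω u * ω v * corr X u v ^ p :=
          Finset.sum_le_sum fun t _ => mul_le_mul_of_nonneg_left (h1 t) (gibbs_nonneg _ _ _)
      _ = _ := by rw [← Finset.sum_mul, sum_gibbs, one_mul]
  refine le_trans ?_ h3
  have h4 : ((1 : ℝ) / 2) ^ p ≤ exp (-1) := by
    have hp2 : 2 ≤ p := by
      obtain ⟨n, rfl⟩ := hp; omega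
    calc ((1 : ℝ) / 2) ^ p ≤ (1 / 2) ^ 2 := pow_le_pow_of_le_one (by norm_num) (by norm_num) hp2
      _ ≤ _ := by
          rw [exp_neg]
          have := exp_one_lt_d9
          rw [le_inv_comm₀ (by norm_num) (exp_pos _)]
          norm_num; linarith
  calc (κ / 8) ^ p = (1 / 2) ^ p * (κ / 4) ^ p := by rw [← mul_pow]; congr 1; ring
    _ ≤ _ := mul_le_mul h4 hX (by positivity) (exp_pos _).le

end Lifting

section Sifted

variable {G : Type*} [AddCommGroup G] [Fintype G] {N : G → ℝ} {D : ℝ}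

/-- The density of pairs of `A` at given positions, normalised by `α ^ 2`. -/
noncomputable def pairDensity (N A : G → ℝ) (α : ℝ) (a b : G) : ℝ :=
  (∑ s, gibbs N 2 s * A (s + a) * A (s + b)) / α ^ 2

lemma IsBohrLength.corr_restricted_le (h : IsBohrLength N D) {A : G → ℝ} (hA0 : ∀ x, 0 ≤ A x)
    (α : ℝ) (a b : G) : corr (restricted N A α) a b ≤
      exp (N a + N b) * ((∑ y, gibbs N 1 y ^ 2) * pairDensity N A α a b) := by
  rw [corr, pairDensity, mul_div_assoc', mul_div_assoc', Finset.mul_sum, Finset.mul_sum,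
    Finset.sum_div]
  refine Finset.sum_le_sum fun y _ => ?_
  have h1 := h.gibbs_add_le zero_le_one y a
  have h2 := h.gibbs_add_le zero_le_one y b
  rw [one_mul] at h1 h2
  have h3 := gibbs_one_sq N y
  calc _ = gibbs N 1 (y + a) * gibbs N 1 (y + b) * (A (y + a) * A (y + b) / α ^ 2) := by
        rw [restricted, restricted]; ring
    _ ≤ (exp (N a) * gibbs N 1 y) * (exp (N b) * gibbs N 1 y) *
        (A (y + a) * A (y + b) / α ^ 2) := by
        refine mul_le_mul_of_nonneg_right ?_
          (div_nonneg (mul_nonneg (hA0 _) (hA0 _)) (sq_nonneg _))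
        exact mul_le_mul h1 h2 (gibbs_nonneg _ _ _)
          (mul_nonneg (exp_pos _).le (gibbs_nonneg _ _ _))
    _ = exp (N a) * exp (N b) * (gibbs N 1 y ^ 2) * (A (y + a) * A (y + b) / α ^ 2) := by ring
    _ = _ := by rw [h3, exp_add]; ring

lemma IsBohrLength.le_corr_restricted (h : IsBohrLength N D) {A : G → ℝ} (hA0 : ∀ x, 0 ≤ A x)
    (α : ℝ) (a b : G) : exp (-(N a + N b)) * ((∑ y, gibbs N 1 y ^ 2) * pairDensity N A α a b) ≤
      corr (restricted N A α) a b := by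
  rw [corr, pairDensity, mul_div_assoc', mul_div_assoc', Finset.mul_sum, Finset.mul_sum,
    Finset.sum_div]
  refine Finset.sum_le_sum fun y _ => ?_
  have h1 := h.le_gibbs_add zero_le_one y a
  have h2 := h.le_gibbs_add zero_le_one y b
  rw [one_mul] at h1 h2
  have h3 := gibbs_one_sq N y
  calc _ = exp (-N a) * exp (-N b) * (gibbs N 1 y ^ 2) * (A (y + a) * A (y + b) / α ^ 2) := by
        rw [h3, neg_add, exp_add]; ring
    _ = (exp (-N a) * gibbs N 1 y) * (exp (-N b) * gibbs N 1 y) *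
        (A (y + a) * A (y + b) / α ^ 2) := by ring
    _ ≤ gibbs N 1 (y + a) * gibbs N 1 (y + b) * (A (y + a) * A (y + b) / α ^ 2) := by
        refine mul_le_mul_of_nonneg_right ?_
          (div_nonneg (mul_nonneg (hA0 _) (hA0 _)) (sq_nonneg _))
        exact mul_le_mul h1 h2 (mul_nonneg (exp_pos _).le (gibbs_nonneg _ _ _))
          (gibbs_nonneg _ _ _)
    _ = _ := by rw [restricted, restricted]; ring

lemma IsBohrLength.corr_balanced_le (h : IsBohrLength N D) {A : G → ℝ} (hA0 : ∀ x, 0 ≤ A x)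
    {α : ℝ} (hα : 0 < α) (h2 : (1 - 1 / 1000) * α ≤ ∑ y, gibbs N 2 y * A y) (a b : G) :
    corr (balanced N A α) a b
      + (∑ y, gibbs N 1 y ^ 2) * (2 * (1 - 1 / 1000) * exp (-(N a + N b)) - 1) ≤
      corr (restricted N A α) a b := by
  set κ := ∑ y, gibbs N 1 y ^ 2 with hκ
  have hκ0 : 0 < κ := sum_gibbs_one_sq_pos N
  have e1 : corr (restricted N A α) a b = corr (balanced N A α) a b
      + ((∑ y, restricted N A α (y + a) * gibbs N 1 (y + b))
        + (∑ y, restricted N A α (y + b) * gibbs N 1 (y + a))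
        - ∑ y, gibbs N 1 (y + a) * gibbs N 1 (y + b)) := by
    rw [corr, corr, ← Finset.sum_add_distrib, ← Finset.sum_sub_distrib, ← Finset.sum_add_distrib]
    refine Finset.sum_congr rfl fun z _ => ?_
    rw [restricted_eq, restricted_eq]
    ring
  have e3 : ∑ y, gibbs N 1 (y + a) * gibbs N 1 (y + b) ≤ κ := by
    have e4 : ∀ a, ∑ y, gibbs N 1 (y + a) ^ 2 = κ := fun a =>
      Fintype.sum_equiv (Equiv.addRight a) _ _ fun z => by simp
    calc _ ≤ ∑ y, (gibbs N 1 (y + a) ^ 2 + gibbs N 1 (y + b) ^ 2) / 2 :=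
          Finset.sum_le_sum fun y _ => by
            nlinarith [sq_nonneg (gibbs N 1 (y + a) - gibbs N 1 (y + b))]
      _ = κ := by rw [← Finset.sum_div, Finset.sum_add_distrib, e4, e4]; ring
  have e5 : ∀ a b, κ * ((1 - 1 / 1000) * exp (-(N a + N b)))
      ≤ ∑ y, restricted N A α (y + a) * gibbs N 1 (y + b) := by
    intro a b
    have e6 : ∑ y, restricted N A α (y + a) * gibbs N 1 (y + b)
        = ∑ z, restricted N A α z * gibbs N 1 (z + (b - a)) := by
      refine Fintype.sum_equiv (Equiv.addRight a) _ _ fun z => ?_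
      simp
    rw [e6]
    have e7 : ∀ z, exp (-(1 * N (b - a))) * (κ * (gibbs N 2 z * A z) / α)
          ≤ restricted N A α z * gibbs N 1 (z + (b - a)) := by
      intro z
      have e9 : 0 ≤ restricted N A α z :=
        mul_nonneg (gibbs_nonneg _ _ _) (div_nonneg (hA0 z) hα.le)
      refine le_trans (le_of_eq ?_)
        (mul_le_mul_of_nonneg_left (h.le_gibbs_add zero_le_one z (b - a)) e9)
      have e10 := gibbs_one_sq N z
      rw [← hκ] at e10
      rw [restricted, ← mul_assoc κ, ← e10]
      ring
    refine le_trans ?_ (Finset.sum_le_sum fun z _ => e7 z)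
    rw [← Finset.mul_sum, ← Finset.sum_div, ← Finset.mul_sum]
    have e8 := h.sub b a
    have e9 : (1 - 1 / 1000) ≤ (∑ z, gibbs N 2 z * A z) / α := (le_div_iff₀ hα).2 h2
    calc _ ≤ κ * ((1 - 1 / 1000) * exp (-(1 * N (b - a)))) := by
          have : exp (-(N a + N b)) ≤ exp (-(1 * N (b - a))) := exp_le_exp.2 (by linarith)
          gcongr
      _ = exp (-(1 * N (b - a))) * (κ * (1 - 1 / 1000)) := by ring
      _ ≤ exp (-(1 * N (b - a))) * (κ * ((∑ z, gibbs N 2 z * A z) / α)) := by gcongr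
      _ = _ := by ring
  have e6 := e5 a b
  have e7 := e5 b a
  rw [add_comm (N b)] at e7
  rw [e1]
  linarith

lemma IsBohrLength.pow_le_sum_pairDensity (h : IsBohrLength N D) {A : G → ℝ} (hA0 : ∀ x, 0 ≤ A x)
    {α : ℝ} (hα : 0 < α) (h2 : (1 - 1 / 1000) * α ≤ ∑ y, gibbs N 2 y * A y)
    {ω : G → ℝ} (hω : ∀ x, 0 ≤ ω x) (hω1 : ∑ x, ω x = 1)
    (hωδ : ∀ x, ω x ≠ 0 → N x ≤ 1 / 8000) {p : ℕ} (hp : Even p) (hp8 : 8 ≤ p)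
    (hX : ((∑ y, gibbs N 1 y ^ 2) / 8) ^ p ≤
      ∑ u, ∑ v, ω u * ω v * corr (balanced N A α) u v ^ p) :
    (17 / 16 : ℝ) ^ (400 * (p + 1)) ≤
      ∑ a, ∑ b, ω a * ω b * pairDensity N A α a b ^ (400 * (p + 1)) := by
  set κ := ∑ y, gibbs N 1 y ^ 2 with hκ
  have hκ0 : 0 < κ := sum_gibbs_one_sq_pos N
  let w : G × G → ℝ := fun i => ω i.1 * ω i.2
  let g : G × G → ℝ := fun i => if w i = 0 then 0 else corr (balanced N A α) i.1 i.2 / κ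
  let f : G × G → ℝ := fun i => if w i = 0 then 0 else pairDensity N A α i.1 i.2
  have hwg : ∀ n, ∑ i, w i * g i ^ n
      = (∑ u, ∑ v, ω u * ω v * corr (balanced N A α) u v ^ n) / κ ^ n := by
    intro n
    rw [Fintype.sum_prod_type, Finset.sum_div]
    refine Finset.sum_congr rfl fun u _ => ?_
    rw [Finset.sum_div]
    refine Finset.sum_congr rfl fun v _ => ?_
    by_cases h0 : ω u * ω v = 0
    · simp [w, h0]
    · simp only [w, g]
      rw [if_neg h0, div_pow]; ring
  have hwf : ∀ n, ∑ i, w i * f i ^ n = ∑ u, ∑ v, ω u * ω v * pairDensity N A α u v ^ n := by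
    intro n
    rw [Fintype.sum_prod_type]
    refine Finset.sum_congr rfl fun u _ => Finset.sum_congr rfl fun v _ => ?_
    by_cases h0 : ω u * ω v = 0
    · simp [w, h0]
    · simp only [w, f]
      rw [if_neg h0]
  have hpd : ∀ a b, 0 ≤ pairDensity N A α a b := fun a b =>
    div_nonneg (Finset.sum_nonneg fun s _ => mul_nonneg (mul_nonneg (gibbs_nonneg _ _ _)
      (hA0 _)) (hA0 _)) (sq_nonneg _)
  have hgf : ∀ i, w i ≠ 0 → (1 - 1 / 4000) * (g i + 1 - 3 / 1000) ≤ f i ∨ g i + 1 - 3 / 1000 ≤ 0 := by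
    rintro ⟨a, b⟩ hi
    rw [or_iff_not_imp_right, not_le]
    intro hpos
    have ha : ω a ≠ 0 := fun h0 => hi (by simp [w, h0])
    have hb : ω b ≠ 0 := fun h0 => hi (by simp [w, h0])
    have h3 := h.corr_balanced_le hA0 hα h2 a b
    have h4 := h.corr_restricted_le hA0 α a b
    rw [← hκ] at h3 h4
    have h5 := hωδ a ha
    have h6 := hωδ b hb
    have h7 : 1 - 1 / 4000 ≤ exp (-(N a + N b)) := by
      have := one_sub_le_exp_neg (N a + N b); linarith
    have h8 : κ * (g (a, b) + 1 - 3 / 1000) ≤ corr (restricted N A α) a b := by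
      refine le_trans ?_ h3
      have : κ * g (a, b) = corr (balanced N A α) a b := by
        simp only [g, hi, if_false]; field_simp
      have h9 : κ * (1 - 3 / 1000) ≤ κ * (2 * (1 - 1 / 1000) * exp (-(N a + N b)) - 1) :=
        mul_le_mul_of_nonneg_left (by linarith) hκ0.le
      linarith
    have h9 : g (a, b) + 1 - 3 / 1000 ≤ exp (N a + N b) * pairDensity N A α a b := by
      have := h8.trans h4
      rw [← mul_assoc, mul_comm (exp _) κ, mul_assoc] at this
      exact le_of_mul_le_mul_left this hκ0
    have h10 : f (a, b) = pairDensity N A α a b := by simp only [f, hi, if_false]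
    rw [h10]
    calc _ ≤ exp (-(N a + N b)) * (exp (N a + N b) * pairDensity N A α a b) :=
          mul_le_mul h7 h9 hpos.le (exp_pos _).le
      _ = _ := by rw [← mul_assoc, ← exp_add]; simp
  rw [← hwf]
  refine unbalance w g f (fun i => mul_nonneg (hω _) (hω _)) ?_ hp hp8 ?_ ?_ ?_ ?_ ?_
  · rw [Fintype.sum_prod_type]
    simp_rw [w, ← Finset.mul_sum, hω1, mul_one, hω1]
  · rw [hwg, le_div_iff₀ (pow_pos hκ0 p), ← mul_pow]
    refine le_trans (le_of_eq ?_) hX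
    congr 1; ring
  · rw [hwg]
    exact div_nonneg (sum_corr_pow_nonneg ω _ _) (pow_pos hκ0 _).le
  · intro i
    simp only [f]
    split_ifs
    · exact le_rfl
    · exact hpd _ _
  · intro i hi
    have hw0 : w i ≠ 0 := by
      intro h0; simp only [g, h0, if_true] at hi; norm_num at hi
    rcases hgf i hw0 with h3 | h3 <;> linarith
  · intro i hi
    have hw0 : w i ≠ 0 := by
      intro h0; simp only [g, h0, if_true] at hi; norm_num at hi
    rcases hgf i hw0 with h3 | h3 <;> linarith

lemma pow_sixty_three_le {r : ℕ} (hr : 3600 ≤ r) : 2 * (63 / 64 : ℝ) ^ r ≤ 1 / 400 := by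
  have h1 : (63 / 64 : ℝ) ^ r ≤ (63 / 64) ^ 448 :=
    pow_le_pow_of_le_one (by norm_num) (by norm_num) (by omega)
  have h2 : (63 / 64 : ℝ) ^ 448 ≤ 1 / 800 := by
    have : (63 / 64 : ℝ) ^ 448 = ((63 / 64) ^ 64) ^ 7 := by rw [← pow_mul]
    rw [this]
    calc ((63 / 64 : ℝ) ^ 64) ^ 7 ≤ (38 / 100) ^ 7 :=
          pow_le_pow_left₀ (by positivity) (by norm_num) 7
      _ ≤ _ := by norm_num
  have h3 := h1.trans h2
  linarith

lemma IsBohrLength.exists_sifted (h : IsBohrLength N D) {A : G → ℝ} (hA0 : ∀ x, 0 ≤ A x)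
    (hA1 : ∀ x, A x ≤ 1) {α : ℝ} (hα : 0 < α)
    {ω : G → ℝ} (hω : ∀ x, 0 ≤ ω x) (hω1 : ∑ x, ω x = 1)
    (hωδ : ∀ x, ω x ≠ 0 → N x ≤ 1 / 8000) {r : ℕ} (hr : 3600 ≤ r)
    (hf : (17 / 16 : ℝ) ^ r ≤ ∑ a, ∑ b, ω a * ω b * pairDensity N A α a b ^ r) :
    ∃ μ : G → ℝ, (∀ x, 0 ≤ μ x) ∧ ∑ x, μ x = 1 ∧ (∀ x, α ^ (2 * r) / 2 * μ x ≤ ω x) ∧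
      399 / 400 ≤ ∑ a, ∑ b, μ a * μ b *
        (if 1.04 * (∑ y, gibbs N 1 y ^ 2) ≤ autocorr (restricted N A α) (a - b)
          then 1 else 0) := by
  set κ := ∑ y, gibbs N 1 y ^ 2 with hκ
  have hκ0 : 0 < κ := sum_gibbs_one_sq_pos N
  obtain ⟨s, hs1, hs2⟩ := sift ω (gibbs N 2) A hω (gibbs_nonneg N 2) (sum_gibbs N 2) hA0
    (r := r) (T := (17 / 16 * α ^ 2) ^ r) (θ := 63 / 64 * (17 / 16 * α ^ 2)) (by positivity)
    (by positivity) (by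
      rw [mul_pow]
      refine (mul_le_mul_of_nonneg_right hf (by positivity)).trans (le_of_eq ?_)
      rw [Finset.sum_mul]
      refine Finset.sum_congr rfl fun a _ => ?_
      rw [Finset.sum_mul]
      refine Finset.sum_congr rfl fun b _ => ?_
      rw [pairDensity, div_pow, mul_assoc, div_mul_cancel₀ _ (by positivity)]) hω1
  set Ψ : G → ℝ := fun x => ∏ i, A (s i + x) with hΨ
  have hΨ0 : ∀ x, 0 ≤ Ψ x := fun x => Finset.prod_nonneg fun i _ => hA0 _
  have hΨ1 : ∀ x, Ψ x ≤ 1 := fun x => Finset.prod_le_one (fun i _ => hA0 _) fun i _ => hA1 _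
  change _ ≤ (∑ x, ω x * Ψ x) ^ 2 at hs1
  change ∑ a, ∑ b, (ω a * Ψ a) * (ω b * Ψ b) * _ ≤ _ * (∑ x, ω x * Ψ x) ^ 2 at hs2
  set m := ∑ x, ω x * Ψ x with hm
  have hT : α ^ (2 * r) ≤ (17 / 16 * α ^ 2) ^ r := by
    rw [pow_mul]
    refine pow_le_pow_left₀ (by positivity) ?_ r
    nlinarith [sq_nonneg α]
  have hm1 : m ≤ 1 := by
    rw [hm, ← hω1]
    refine Finset.sum_le_sum fun x _ => ?_
    have := mul_le_mul_of_nonneg_left (hΨ1 x) (hω x)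
    linarith
  have hm0' : 0 ≤ m := Finset.sum_nonneg fun x _ => mul_nonneg (hω x) (hΨ0 x)
  have hαr : 0 < α ^ (2 * r) := by positivity
  have hm2 : 0 < m ^ 2 := lt_of_lt_of_le (by linarith) hs1
  have hm0 : 0 < m := lt_of_le_of_ne hm0' (by rintro h0; rw [← h0] at hm2; simp at hm2)
  refine ⟨fun x => ω x * Ψ x / m, fun x => div_nonneg (mul_nonneg (hω x) (hΨ0 x)) hm0',
    ?_, fun x => ?_, ?_⟩
  · rw [← Finset.sum_div, ← hm, div_self hm0.ne']
  · have h1 : α ^ (2 * r) / 2 ≤ m := by nlinarith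
    rw [mul_div_assoc', div_le_iff₀ hm0, mul_comm (ω x) m]
    have h3 := mul_le_mul_of_nonneg_left (hΨ1 x) (hω x)
    exact mul_le_mul h1 (by linarith) (mul_nonneg (hω x) (hΨ0 x)) hm0'
  · have hbad : ∀ a b, ω a * Ψ a / m * (ω b * Ψ b / m) *
        (1 - (if ∑ s, gibbs N 2 s * A (s + a) * A (s + b) < 63 / 64 * (17 / 16 * α ^ 2)
          then 1 else 0)) ≤
        ω a * Ψ a / m * (ω b * Ψ b / m) *
        (if 1.04 * κ ≤ autocorr (restricted N A α) (a - b) then 1 else 0) := by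
      intro a b
      by_cases ha : ω a = 0
      · simp [ha]
      by_cases hb : ω b = 0
      · simp [hb]
      refine mul_le_mul_of_nonneg_left ?_ (mul_nonneg
        (div_nonneg (mul_nonneg (hω _) (hΨ0 _)) hm0')
        (div_nonneg (mul_nonneg (hω _) (hΨ0 _)) hm0'))
      by_cases hab : ∑ s, gibbs N 2 s * A (s + a) * A (s + b) < 63 / 64 * (17 / 16 * α ^ 2)
      · rw [if_pos hab]; split_ifs <;> norm_num
      rw [if_neg hab, if_pos]
      · norm_num
      have h5 := hωδ a ha
      have h6 := hωδ b hb
      have h7 : 1 - 1 / 4000 ≤ exp (-(N a + N b)) := by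
        have := one_sub_le_exp_neg (N a + N b); linarith
      have h8 : 63 / 64 * (17 / 16) ≤ pairDensity N A α a b := by
        rw [pairDensity, le_div_iff₀ (by positivity)]
        linarith [not_lt.1 hab]
      have h9 := h.le_corr_restricted hA0 α a b
      rw [← hκ] at h9
      have h10 : corr (restricted N A α) a b = autocorr (restricted N A α) (a - b) := by
        refine Fintype.sum_equiv (Equiv.addRight b) _ _ fun y => ?_
        simp
      rw [← h10]
      refine le_trans ?_ h9
      calc 1.04 * κ ≤ (1 - 1 / 4000) * (κ * (63 / 64 * (17 / 16))) := by nlinarith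
        _ ≤ _ := by gcongr
    have hsum : ∑ a, ∑ b, ω a * Ψ a / m * (ω b * Ψ b / m) = 1 := by
      simp_rw [← Finset.mul_sum, ← Finset.sum_div]
      rw [← Finset.sum_mul, ← Finset.sum_div, ← hm, div_self hm0.ne', mul_one]
    have hb : ∑ a, ∑ b, ω a * Ψ a / m * (ω b * Ψ b / m) *
        (if ∑ s, gibbs N 2 s * A (s + a) * A (s + b) < 63 / 64 * (17 / 16 * α ^ 2)
          then 1 else 0) ≤ 1 / 400 := by
      refine le_trans ?_ (pow_sixty_three_le hr)
      have e1 : 2 * (63 / 64 * (17 / 16 * α ^ 2)) ^ r / (17 / 16 * α ^ 2) ^ r * m ^ 2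
          = 2 * (63 / 64 : ℝ) ^ r * m ^ 2 := by
        rw [mul_pow (63 / 64 : ℝ)]
        field_simp
      rw [e1, ← div_le_iff₀ hm2] at hs2
      refine le_trans (le_of_eq ?_) hs2
      rw [Finset.sum_div]
      refine Finset.sum_congr rfl fun a _ => ?_
      rw [Finset.sum_div]
      refine Finset.sum_congr rfl fun b _ => ?_
      field_simp
    calc (399 / 400 : ℝ) ≤ ∑ a, ∑ b, ω a * Ψ a / m * (ω b * Ψ b / m) *
        (1 - (if ∑ s, gibbs N 2 s * A (s + a) * A (s + b) < 63 / 64 * (17 / 16 * α ^ 2)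
          then 1 else 0)) := by
          simp_rw [mul_sub, Finset.sum_sub_distrib, mul_one]
          rw [hsum]
          linarith
      _ ≤ _ := Finset.sum_le_sum fun a _ => Finset.sum_le_sum fun b _ => hbad a b

end Sifted

section Increment

variable {G : Type*} [AddCommGroup G] [Fintype G] {N : G → ℝ} {D : ℝ}

lemma IsBohrLength.exists_smoothing (h : IsBohrLength N D) {μ χ : G → ℝ} (hμ : ∀ x, 0 ≤ μ x)
    (hμ1 : ∑ x, μ x = 1) (hχ0 : ∀ x, 0 ≤ χ x) (hχ1 : ∀ x, χ x ≤ 1) {c s s' s'' δ : ℝ}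
    {k m M : ℕ} (hc : 0 < c) (hs : 0 < s) (hs' : 0 < s') (hs'' : 0 < s'') (hδ : 0 < δ)
    (hk : 0 < k) (hm : 0 < m) (hμc : ∀ x, c * μ x ≤ gibbs N s x)
    (hχ : 399 / 400 ≤ ∑ a, ∑ b, μ a * μ b * χ (a - b))
    (hks : 4 * k * s * δ ≤ 1) (hms : m * s * δ ≤ 1) (hsδ : 4 * D ≤ s' * δ)
    (hmk : 1280000 * k ^ 2 * log (19200 * k / c) ≤ m)
    (hM : 8 * M * D * s' ≤ s'') (hMσ : 8 * log (4 / (c ^ m / 12)) + 1 ≤ M) :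
    ∃ (Y : G → ℝ) (Λ : Finset (AddChar G ℂ)), (∀ x, 0 ≤ Y x) ∧ ∑ x, Y x = 1 ∧
      (∀ T, Y T ≠ 0 → N T ≤ 2 * k * δ) ∧
      (∀ T, Y T ≠ 0 → 396 / 400 ≤ ∑ a, ∑ b, μ a * μ b * χ (a - b - T)) ∧
      (#Λ : ℝ) ≤ 8 * log (4 / (c ^ m / 12)) ∧
      (∀ ψ, ‖hat Y ψ‖ ≤ 1) ∧
      ∀ ψ, ‖hat Y ψ‖ ≤ (1 / 4) ^ k ∨ ∀ t, s'' * N t ≤ 1 →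
        ‖ψ t - 1‖ ≤ ∑ ξ ∈ Λ, ‖ξ t - 1‖ + 4 * s'' * N t := by
  have hk0 : (0 : ℝ) < k := by exact_mod_cast hk
  obtain ⟨X, e, hX, hXm, he⟩ := exists_sample h (gibbs N s) μ χ (gibbs_nonneg N s) (sum_gibbs N s)
    hμ hμ1 hχ0 hχ1 (ε := 1 / (800 * k)) (τ := c / (4800 * k)) hm hc hs hs' hδ (by positivity)
    (by positivity) hμc hms hsδ (by
      have h1 : log (19200 * k / c) ≤ (1 / (800 * k : ℝ)) ^ 2 * m / 2 := by
        rw [div_pow, div_mul_eq_mul_div, div_div, le_div_iff₀ (by positivity)]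
        linarith
      have h2 : exp (-((1 / (800 * k : ℝ)) ^ 2 * m / 2)) ≤ c / (19200 * k) := by
        calc _ ≤ exp (-log (19200 * k / c)) := exp_le_exp.2 (by linarith)
          _ = _ := by rw [← log_inv, exp_log (by positivity), inv_div]
      calc _ ≤ 2 * (c / (19200 * k)) := by linarith
        _ = _ := by field_simp; norm_num)
  set σ := c ^ m / 12 with hσ
  have hσ0 : 0 < σ := by positivity
  set mass := ∑ t ∈ X, gibbs N s' t with hmass
  have hmass0 : 0 < mass := hσ0.trans_le hXm
  set f : G → ℝ := fun t => if t ∈ X then gibbs N s' t / mass else 0 with hf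
  have hf0 : ∀ x, 0 ≤ f x := by
    intro x; simp only [hf]; split_ifs
    · exact div_nonneg (gibbs_nonneg _ _ _) hmass0.le
    · exact le_rfl
  have hf1 : ∑ x, f x = 1 := by
    simp only [hf]
    rw [← Finset.sum_filter, ← Finset.sum_div]
    simp only [Finset.filter_univ_mem]
    exact div_self hmass0.ne'
  have hfσ : ∀ x, σ * f x ≤ gibbs N s' x := by
    intro x
    simp only [hf]
    split_ifs
    · rw [mul_div_assoc', div_le_iff₀ hmass0, mul_comm]
      exact mul_le_mul_of_nonneg_left hXm (gibbs_nonneg _ _ _)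
    · rw [mul_zero]; exact gibbs_nonneg _ _ _
  have hsupp : ∀ u, autocorr f u ≠ 0 → ∃ t ∈ X, ∃ t' ∈ X, u = t - t' := by
    intro u hu
    obtain ⟨y, _, hy⟩ := Finset.exists_ne_zero_of_sum_ne_zero hu
    refine ⟨y + u, ?_, y, ?_, by abel⟩
    · by_contra h0; exact hy (by simp [hf, h0])
    · by_contra h0; exact hy (by simp [hf, h0])
  obtain ⟨Λ, hΛ, hΛ'⟩ := exists_chang h hf0 hf1 hσ0 hs'.le hs'' hfσ hM hMσ
  have hY1 : ∑ x, convPow (autocorr f) k x = 1 :=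
    sum_convPow (by rw [sum_autocorr, hf1, one_pow]) k
  have hY0 : ∀ x, 0 ≤ convPow (autocorr f) k x := convPow_nonneg (autocorr_nonneg hf0) k
  refine ⟨convPow (autocorr f) k, Λ, hY0, hY1, fun T hT => ?_, fun T hT => ?_, hΛ,
    norm_hat_le hY0 hY1, fun ψ => ?_⟩
  · refine convPow_induction (Q := fun j T => N T ≤ 2 * j * δ) (by simp [h.zero]) ?_ k T hT
    intro j T u hT hu
    obtain ⟨t, ht, t', ht', rfl⟩ := hsupp u hu
    have h1 := h.add T (t - t')
    have h2 := h.sub t t'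
    have h3 := hX t ht
    have h4 := hX t' ht'
    push_cast
    linarith
  · have h1 := almost_periodic h (gibbs N s) μ (fun b => ∑ a, μ a * χ (a - b)) e hμ hμ1
      (fun b => Finset.sum_nonneg fun a _ => mul_nonneg (hμ a) (hχ0 _))
      (fun b => by
        rw [← hμ1]
        exact Finset.sum_le_sum fun a _ => mul_le_of_le_one_right (hμ a) (hχ1 _))
      hc hs (by positivity) rfl hμc hks hX he hsupp hT
    have e1 : ∀ T, ∑ b, μ b * ∑ a, μ a * χ (a - (b + T))
        = ∑ a, ∑ b, μ a * μ b * χ (a - b - T) := by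
      intro T
      rw [Finset.sum_comm]
      refine Finset.sum_congr rfl fun b _ => ?_
      rw [Finset.mul_sum]
      refine Finset.sum_congr rfl fun a _ => ?_
      rw [sub_sub]; ring
    have e2 := e1 0
    simp only [add_zero, sub_zero] at e2
    rw [e1, e2] at h1
    have h2 : 2 * k * (1 / (800 * k : ℝ)) + 12 * k * (c / (4800 * k)) / c = 2 / 400 := by
      field_simp; norm_num
    rw [h2] at h1
    have h3 := (abs_le.1 h1).1
    linarith
  · by_cases hψ : 1 / 2 ≤ ‖hat f ψ‖
    · exact Or.inr (hΛ' ψ hψ)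
    · left
      rw [hat_convPow, hat_autocorr, norm_pow, Complex.norm_real,
        norm_of_nonneg (sq_nonneg _)]
      refine pow_le_pow_left₀ (sq_nonneg _) ?_ k
      have := not_le.1 hψ
      nlinarith [norm_nonneg (hat f ψ)]

lemma IsBohrLength.exists_density_increment (h : IsBohrLength N D) {N' : G → ℝ}
    (hN' : ∀ x y, N' (x + y) ≤ N' x + N' y) (hneg : ∀ x, N' (-x) = N' x)
    (hNN' : ∀ x, N x ≤ 2 * N' x) {A : G → ℝ} (hA0 : ∀ x, 0 ≤ A x) (hA1 : ∀ x, A x ≤ 1)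
    {α : ℝ} (hα : 0 < α) (h2 : ∑ y, gibbs N 2 y * A y ≤ (1 + 1 / 1000) * α)
    {μ Y η : G → ℝ} (hμ : ∀ x, 0 ≤ μ x) (hμ1 : ∑ x, μ x = 1) (hY : ∀ x, 0 ≤ Y x)
    (hY1 : ∑ x, Y x = 1) (hη : ∀ x, 0 ≤ η x)
    {δ δ' δ'' : ℝ} (hδ : 2 * (2 * δ + δ' + δ'') ≤ 1 / 200) (hμδ : ∀ x, μ x ≠ 0 → N' x ≤ δ)
    (hYδ : ∀ x, Y x ≠ 0 → N' x ≤ δ') (hηδ : ∀ x, η x ≠ 0 → N' x ≤ δ'')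
    (hχ : ∀ T, Y T ≠ 0 → 396 / 400 ≤ ∑ a, ∑ b, μ a * μ b *
      (if 1.04 * (∑ y, gibbs N 1 y ^ 2) ≤ autocorr (restricted N A α) (a - b - T) then 1 else 0))
    (hθ : ∀ ψ, ‖hat Y ψ‖ * ‖1 - hat η ψ‖ ≤ α / 250) :
    ∃ x, 1.01 * α ≤ ∑ u, η u * A (x + u) := by
  set κ := ∑ y, gibbs N 1 y ^ 2 with hκ
  have hκ0 : 0 < κ := sum_gibbs_one_sq_pos N
  set Φ := autocorr (restricted N A α) with hΦ
  have hF0 : ∀ y, 0 ≤ restricted N A α y := fun y =>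
    mul_nonneg (gibbs_nonneg _ _ _) (div_nonneg (hA0 y) hα.le)
  have hΦ0 : ∀ x, 0 ≤ Φ x := autocorr_nonneg hF0
  by_contra! hcon
  have hFF : α / 250 * ∑ y, restricted N A α y ^ 2 ≤ κ * (1001 / 250000) := by
    have e1 : ∑ y, restricted N A α y ^ 2 ≤ κ / α ^ 2 * ∑ y, gibbs N 2 y * A y := by
      rw [Finset.mul_sum]
      refine Finset.sum_le_sum fun y _ => ?_
      have h3 := gibbs_one_sq N y
      rw [← hκ] at h3
      calc _ = gibbs N 1 y ^ 2 * A y ^ 2 / α ^ 2 := by rw [restricted]; ring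
        _ ≤ gibbs N 1 y ^ 2 * A y / α ^ 2 := by
            have : A y ^ 2 ≤ A y := by nlinarith [hA0 y, hA1 y]
            gcongr
        _ = _ := by rw [h3]; ring
    calc _ ≤ α / 250 * (κ / α ^ 2 * ((1 + 1 / 1000) * α)) := by
          refine mul_le_mul_of_nonneg_left (e1.trans ?_) (by positivity)
          exact mul_le_mul_of_nonneg_left h2 (by positivity)
      _ = _ := by field_simp; norm_num
  have hlow : κ * (1.04 * (396 / 400)) ≤ ∑ a, ∑ b, μ a * μ b * ∑ T, Y T * Φ (a - b - T) := by
    have e1 : ∑ a, ∑ b, μ a * μ b * ∑ T, Y T * Φ (a - b - T)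
        = ∑ T, Y T * ∑ a, ∑ b, μ a * μ b * Φ (a - b - T) := by
      simp_rw [Finset.mul_sum]
      rw [Finset.sum_congr rfl fun u _ => Finset.sum_comm, Finset.sum_comm]
      exact Finset.sum_congr rfl fun t _ => Finset.sum_congr rfl fun u _ =>
        Finset.sum_congr rfl fun v _ => by ring
    rw [e1]
    calc κ * (1.04 * (396 / 400)) = ∑ T, Y T * (κ * (1.04 * (396 / 400))) := by
          rw [← Finset.sum_mul, hY1, one_mul]
      _ ≤ _ := by
          refine Finset.sum_le_sum fun T _ => ?_
          by_cases hT : Y T = 0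
          · simp [hT]
          refine mul_le_mul_of_nonneg_left ?_ (hY T)
          calc _ ≤ 1.04 * κ * ∑ a, ∑ b, μ a * μ b *
                (if 1.04 * κ ≤ Φ (a - b - T) then 1 else 0) := by
                rw [← mul_assoc, mul_comm κ]
                exact mul_le_mul_of_nonneg_left (hχ T hT) (by positivity)
            _ ≤ _ := by
                rw [Finset.mul_sum]
                refine Finset.sum_le_sum fun a _ => ?_
                rw [Finset.mul_sum]
                refine Finset.sum_le_sum fun b _ => ?_
                rw [mul_left_comm]
                refine mul_le_mul_of_nonneg_left ?_ (mul_nonneg (hμ a) (hμ b))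
                split_ifs with h0
                · rwa [mul_one]
                · rw [mul_zero]; exact hΦ0 _
  have hμμ : ∀ z : ℝ, ∑ a, ∑ b, μ a * μ b * z = z := by
    intro z
    simp_rw [← Finset.sum_mul, ← Finset.mul_sum, hμ1, mul_one, hμ1, one_mul]
  have hboot : (∑ a, ∑ b, μ a * μ b * ∑ T, Y T * Φ (a - b - T))
      - α / 250 * ∑ y, restricted N A α y ^ 2
      ≤ ∑ a, ∑ b, μ a * μ b * ∑ T, Y T * ∑ u, η u * Φ (a - b - T + u) := by
    rw [← hμμ (α / 250 * ∑ y, restricted N A α y ^ 2), ← Finset.sum_sub_distrib]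
    refine Finset.sum_le_sum fun a _ => ?_
    rw [← Finset.sum_sub_distrib]
    refine Finset.sum_le_sum fun b _ => ?_
    rw [← mul_sub]
    exact mul_le_mul_of_nonneg_left (bootstrap _ Y η hθ (a - b)) (mul_nonneg (hμ a) (hμ b))
  have hup : ∀ t, N' t ≤ 2 * δ + δ' → ∑ u, η u * Φ (t + u) ≤ κ * 1.02 := by
    intro t ht
    have hpt : ∀ u, η u * Φ (t + u) ≤ exp (1 / 200) * κ / α ^ 2 *
        ∑ s, gibbs N 2 s * A s * (η u * A (s + t + u)) := by
      intro u
      by_cases hu : η u = 0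
      · simp [hu]
      have h3 := h.corr_restricted_le hA0 α (t + u) 0
      have h4 : corr (restricted N A α) (t + u) 0 = Φ (t + u) := by simp [corr, hΦ, autocorr]
      rw [h4, h.zero, add_zero] at h3
      have h5 : exp (N (t + u)) ≤ exp (1 / 200) := by
        refine exp_le_exp.2 ?_
        have := hNN' (t + u)
        have := hN' t u
        have := hηδ u hu
        linarith
      have hpd : 0 ≤ pairDensity N A α (t + u) 0 :=
        div_nonneg (Finset.sum_nonneg fun s _ => mul_nonneg (mul_nonneg (gibbs_nonneg _ _ _)
          (hA0 _)) (hA0 _)) (sq_nonneg _)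
      calc _ ≤ η u * (exp (1 / 200) * (κ * pairDensity N A α (t + u) 0)) := by
            refine mul_le_mul_of_nonneg_left (h3.trans ?_) (hη u)
            gcongr
        _ = _ := by
            rw [pairDensity]
            have e : ∀ s, gibbs N 2 s * A s * (η u * A (s + t + u))
              = η u * (gibbs N 2 s * A (s + (t + u)) * A (s + 0)) := by
              intro s; rw [add_zero, add_assoc]; ring
            simp_rw [e]
            rw [← Finset.mul_sum]; ring
    calc _ ≤ ∑ u, exp (1 / 200) * κ / α ^ 2 *
        ∑ s, gibbs N 2 s * A s * (η u * A (s + t + u)) := Finset.sum_le_sum fun u _ => hpt u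
      _ = exp (1 / 200) * κ / α ^ 2 * ∑ s, gibbs N 2 s * A s * ∑ u, η u * A (s + t + u) := by
          rw [← Finset.mul_sum, Finset.sum_comm]
          simp_rw [Finset.mul_sum]
      _ ≤ exp (1 / 200) * κ / α ^ 2 * ∑ s, gibbs N 2 s * A s * (1.01 * α) := by
          refine mul_le_mul_of_nonneg_left (Finset.sum_le_sum fun s _ => ?_) (by positivity)
          exact mul_le_mul_of_nonneg_left (hcon _).le (mul_nonneg (gibbs_nonneg _ _ _) (hA0 _))
      _ ≤ exp (1 / 200) * κ / α ^ 2 * ((1 + 1 / 1000) * α * (1.01 * α)) := by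
          rw [← Finset.sum_mul]
          gcongr
      _ = κ * (exp (1 / 200) * ((1 + 1 / 1000) * 1.01)) := by field_simp
      _ ≤ κ * 1.02 := by
          have : exp (1 / 200) ≤ 1.0052 := by
            have h1 := abs_exp_sub_one_sub_id_le (x := (1 / 200 : ℝ))
              (by rw [abs_of_nonneg] <;> norm_num)
            have h2 := (abs_le.1 h1).2
            norm_num at h2 ⊢
            linarith
          refine mul_le_mul_of_nonneg_left ?_ hκ0.le
          linarith
  have hup' : ∑ a, ∑ b, μ a * μ b * ∑ T, Y T * ∑ u, η u * Φ (a - b - T + u) ≤ κ * 1.02 := by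
    rw [← hμμ (κ * 1.02)]
    refine Finset.sum_le_sum fun a _ => Finset.sum_le_sum fun b _ => ?_
    by_cases ha : μ a = 0
    · simp [ha]
    by_cases hb : μ b = 0
    · simp [hb]
    refine mul_le_mul_of_nonneg_left ?_ (mul_nonneg (hμ a) (hμ b))
    calc _ ≤ ∑ T, Y T * (κ * 1.02) := by
          refine Finset.sum_le_sum fun T _ => ?_
          by_cases hT : Y T = 0
          · simp [hT]
          refine mul_le_mul_of_nonneg_left (hup _ ?_) (hY T)
          have h3 := hN' (a + -b) (-T)
          have h4 := hN' a (-b)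
          rw [hneg] at h3 h4
          have := hμδ a ha
          have := hμδ b hb
          have := hYδ T hT
          rw [sub_eq_add_neg, sub_eq_add_neg]
          linarith
      _ = _ := by rw [← Finset.sum_mul, hY1, one_mul]
  have : κ * (1.04 * (396 / 400)) ≤ κ * (1.02 + 1001 / 250000) := by linarith
  have := le_of_mul_le_mul_left this hκ0
  norm_num at this

end Increment

section Parameters

variable {L α : ℝ}

lemma exists_moment (hL : 1 ≤ L) (hα : exp (-L) ≤ α) :
    ∃ p : ℕ, Even p ∧ 8 ≤ p ∧ (3 / 4) ^ p ≤ α ∧ (p : ℝ) ≤ 10 * L := by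
  refine ⟨2 * (⌈2 * L⌉₊ + 2), even_two_mul _, ?_, ?_, ?_⟩
  · have : 2 ≤ ⌈2 * L⌉₊ := by
      have : ((2 : ℕ) : ℝ) ≤ ⌈2 * L⌉₊ := le_trans (by push_cast; linarith) (Nat.le_ceil _)
      exact_mod_cast this
    omega
  · refine le_trans ?_ hα
    have h1 : (3 / 4 : ℝ) ≤ exp (-(1 / 4)) := by
      have := one_sub_le_exp_neg (1 / 4 : ℝ); linarith
    refine (pow_le_pow_left₀ (by norm_num) h1 _).trans ?_
    rw [← exp_nat_mul]
    refine exp_le_exp.2 ?_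
    have := Nat.le_ceil (2 * L)
    push_cast
    linarith
  · have := Nat.ceil_lt_add_one (show 0 ≤ 2 * L by linarith)
    push_cast
    linarith

lemma exists_order (hL : 1 ≤ L) (hα : exp (-L) ≤ α) :
    ∃ k : ℕ, 0 < k ∧ (1 / 4) ^ k * 2 ≤ α / 250 ∧ (k : ℝ) ≤ 8 * L := by
  refine ⟨⌈L⌉₊ + 6, by omega, ?_, ?_⟩
  · have h1 : (1 / 4 : ℝ) ≤ exp (-1) := by
      rw [exp_neg, one_div]
      refine inv_anti₀ (exp_pos _) ?_
      have := exp_one_lt_d9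
      linarith
    have h2 : (1 / 4 : ℝ) ^ ⌈L⌉₊ ≤ α := by
      refine le_trans ((pow_le_pow_left₀ (by norm_num) h1 _).trans ?_) hα
      rw [← exp_nat_mul]
      refine exp_le_exp.2 ?_
      have := Nat.le_ceil L
      linarith
    have h3 : 0 < α := (exp_pos _).trans_le hα
    rw [pow_add]
    norm_num
    linarith
  · have := Nat.ceil_lt_add_one (show 0 ≤ L by linarith)
    push_cast
    linarith

lemma log_inv_pow_le (hL : 1 ≤ L) (hα : exp (-L) ≤ α) {p : ℕ} (hp : (p : ℝ) ≤ 10 * L) :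
    log (4 / α ^ (2 * (400 * (p + 1)))) ≤ 9000 * L ^ 2 := by
  have hα0 : 0 < α := (exp_pos _).trans_le hα
  have h1 : -L ≤ log α := (le_log_iff_exp_le hα0).2 hα
  have h4 : log 4 ≤ 3 := by
    have := log_le_sub_one_of_pos (show (0 : ℝ) < 4 by norm_num); linarith
  rw [log_div (by norm_num) (by positivity), log_pow]
  push_cast
  have h2 : 2 * (400 * ((p : ℝ) + 1)) * -log α ≤ 2 * (400 * (10 * L + 1)) * L := by
    have : (0 : ℝ) ≤ p := p.cast_nonneg
    calc _ ≤ 2 * (400 * ((p : ℝ) + 1)) * L :=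
          mul_le_mul_of_nonneg_left (by linarith) (by positivity)
      _ ≤ _ := by gcongr
  nlinarith

lemma exists_sample_size (hL : 1 ≤ L) {k : ℕ} (hk : 0 < k) (hkL : (k : ℝ) ≤ 8 * L) {c : ℝ}
    (hc : 0 < c) (hcL : log (1 / c) ≤ 9000 * L ^ 2) :
    ∃ m : ℕ, 0 < m ∧ 1280000 * k ^ 2 * log (19200 * k / c) ≤ m ∧ (m : ℝ) ≤ 10 ^ 13 * L ^ 4 := by
  have hk0 : (0 : ℝ) < k := by exact_mod_cast hk
  have h1 : log (19200 * k / c) ≤ 50000 * L ^ 2 := by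
    rw [mul_div_assoc, log_mul (by norm_num) (by positivity), div_eq_mul_one_div,
      log_mul hk0.ne' (by positivity)]
    have h2 := log_le_sub_one_of_pos (show (0 : ℝ) < 19200 by norm_num)
    have h3 := log_le_sub_one_of_pos hk0
    nlinarith
  refine ⟨⌈1280000 * k ^ 2 * log (19200 * k / c)⌉₊ + 1, by omega, ?_, ?_⟩
  · push_cast
    linarith [Nat.le_ceil (1280000 * k ^ 2 * log (19200 * k / c))]
  · have h2 : 1280000 * k ^ 2 * log (19200 * k / c) ≤ 1280000 * (8 * L) ^ 2 * (50000 * L ^ 2) := by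
      calc _ ≤ 1280000 * (k : ℝ) ^ 2 * (50000 * L ^ 2) :=
            mul_le_mul_of_nonneg_left h1 (by positivity)
        _ ≤ _ := by gcongr
    have h3 : ⌈1280000 * k ^ 2 * log (19200 * k / c)⌉₊ ≤
        ⌈1280000 * (8 * L) ^ 2 * (50000 * L ^ 2)⌉₊ := Nat.ceil_mono h2
    have h4 := Nat.ceil_lt_add_one (show 0 ≤ 1280000 * (8 * L) ^ 2 * (50000 * L ^ 2) by positivity)
    have h5 : (⌈1280000 * k ^ 2 * log (19200 * k / c)⌉₊ : ℝ) ≤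
        ⌈1280000 * (8 * L) ^ 2 * (50000 * L ^ 2)⌉₊ := by exact_mod_cast h3
    have h6 : 1 ≤ L ^ 4 := one_le_pow₀ hL
    push_cast
    nlinarith

lemma log_sample_le (hL : 1 ≤ L) {m : ℕ} (hm : (m : ℝ) ≤ 10 ^ 13 * L ^ 4) {c : ℝ}
    (hc : 0 < c) (hcL : log (1 / c) ≤ 9000 * L ^ 2) :
    log (4 / (c ^ m / 12)) ≤ 10 ^ 17 * L ^ 6 := by
  have e : 4 / (c ^ m / 12) = 48 * (1 / c) ^ m := by
    rw [one_div, inv_pow]; field_simp; norm_num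
  rw [e, log_mul (by norm_num) (by positivity), log_pow]
  have h2 := log_le_sub_one_of_pos (show (0 : ℝ) < 48 by norm_num)
  have h3 : m * log (1 / c) ≤ 10 ^ 13 * L ^ 4 * (9000 * L ^ 2) := by
    calc _ ≤ (m : ℝ) * (9000 * L ^ 2) := mul_le_mul_of_nonneg_left hcL m.cast_nonneg
      _ ≤ _ := by gcongr
  have h6 : 1 ≤ L ^ 6 := one_le_pow₀ hL
  nlinarith

lemma exists_chang_size (hL : 1 ≤ L) {l : ℝ} (hl : l ≤ 10 ^ 17 * L ^ 6) :
    ∃ M : ℕ, 0 < M ∧ 8 * l + 1 ≤ M ∧ (M : ℝ) ≤ 10 ^ 18 * L ^ 6 := by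
  have h1 : 8 * l + 1 ≤ 8 * (10 ^ 17 * L ^ 6) + 1 := by linarith
  have h6 : 1 ≤ L ^ 6 := one_le_pow₀ hL
  refine ⟨⌈8 * (10 ^ 17 * L ^ 6) + 1⌉₊, Nat.ceil_pos.2 (by positivity),
    h1.trans (Nat.le_ceil _), ?_⟩
  have := Nat.ceil_lt_add_one (show 0 ≤ 8 * (10 ^ 17 * L ^ 6) + 1 by positivity)
  linarith

lemma one_le_scale {D m k M s₃ s₄ s₅ : ℝ} (hD : 1 ≤ D) (hm : 1 ≤ m) (hk : 1 ≤ k) (hM : 1 ≤ M)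
    (hs₃ : 64000 ≤ s₃) (hs₄ : s₄ = 4 * D * (m + 4 * k) * s₃) (hs₅ : s₅ = 8 * M * D * s₄) :
    1 ≤ s₅ := by
  have h3 : 1 ≤ s₄ := by
    have : 1 ≤ 4 * D * (m + 4 * k) := by nlinarith
    rw [hs₄]; nlinarith
  have h4 : 1 ≤ 8 * M * D := by nlinarith
  rw [hs₅]; nlinarith

lemma scale_le (hL : 1 ≤ L) {D α m k M q s₃ s₄ s₅ : ℝ} (hD : 1 ≤ D) (hα : 0 < α)
    (hm : m ≤ 10 ^ 13 * L ^ 4) (hk : k ≤ 8 * L) (hm0 : 0 ≤ m) (hk0 : 0 ≤ k)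
    (hM : M ≤ 10 ^ 18 * L ^ 6)
    (hq : q = 8000 * D / α) (hs₃ : s₃ = 8 * D * q)
    (hs₄ : s₄ = 4 * D * (m + 4 * k) * s₃) (hs₅ : s₅ = 8 * M * D * s₄) :
    s₅ ≤ 10 ^ 40 * L ^ 10 * D ^ 4 / α := by
  have e1 : s₅ = 2048000 * M * (m + 4 * k) * D ^ 4 / α := by
    rw [hs₅, hs₄, hs₃, hq]; ring
  have h3 : m + 4 * k ≤ 10 ^ 14 * L ^ 4 := by
    have : L ≤ L ^ 4 := le_self_pow₀ hL (by norm_num)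
    linarith
  have h4 : M * (m + 4 * k) ≤ 10 ^ 18 * L ^ 6 * (10 ^ 14 * L ^ 4) :=
    mul_le_mul hM h3 (by positivity) (by positivity)
  have h5 : 2048000 * M * (m + 4 * k) ≤ 10 ^ 40 * L ^ 10 := by
    have : 0 ≤ L ^ 10 := by positivity
    nlinarith
  rw [e1]
  gcongr

end Parameters

section Step

variable {G : Type*} [AddCommGroup G] [Fintype G] {N : G → ℝ} {D : ℝ}

set_option maxHeartbeats 600000 in
lemma IsBohrLength.exists_spectral_data (h : IsBohrLength N D) (hD : 1 ≤ D) (e : G ≃+ G)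
    (he : ∀ x, e x + e x = x) (h' : IsBohrLength (fun x => N (e x)) D) {A : G → ℝ}
    (hA0 : ∀ x, 0 ≤ A x) (hA1 : ∀ x, A x ≤ 1)
    (hfree : ∀ x y z, x + z = y + y → A x ≠ 0 → A y ≠ 0 → A z ≠ 0 → x = y)
    {L α q : ℝ} (hL : 1 ≤ L) (hα : exp (-L) ≤ α) (hα1 : α ≤ 1) (hq : q = 8000 * D / α)
    (h2 : (1 - 1 / 1000) * α ≤ ∑ y, gibbs N 2 y * A y)
    (hq1 : (1 - 1 / 1000) * α ≤ ∑ y, gibbs N q y * A y)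
    (hq2 : ∑ y, gibbs N q y * A y ≤ (1 + 1 / 1000) * α)
    (hZ : 8 ≤ α ^ 2 * partition N 2) :
    ∃ (μ Y : G → ℝ) (Λ : Finset (AddChar G ℂ)) (s : ℝ), (∀ x, 0 ≤ μ x) ∧ ∑ x, μ x = 1 ∧
      (∀ x, μ x ≠ 0 → N (e x) ≤ 1 / 16000) ∧
      (∀ x, 0 ≤ Y x) ∧ ∑ x, Y x = 1 ∧ (∀ T, Y T ≠ 0 → N (e T) ≤ 1 / 16000) ∧
      (∀ T, Y T ≠ 0 → 396 / 400 ≤ ∑ a, ∑ b, μ a * μ b *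
        (if 1.04 * (∑ y, gibbs N 1 y ^ 2) ≤ autocorr (restricted N A α) (a - b - T)
          then 1 else 0)) ∧
      (#Λ : ℝ) ≤ 10 ^ 18 * L ^ 6 ∧ 1 ≤ s ∧ s ≤ 10 ^ 40 * L ^ 10 * D ^ 4 / α ∧
      (∀ ψ, ‖hat Y ψ‖ ≤ 1) ∧
      ∀ ψ, ‖hat Y ψ‖ * 2 ≤ α / 250 ∨ ∀ t, s * N (e t) ≤ 1 →
        ‖ψ t - 1‖ ≤ ∑ ξ ∈ Λ, ‖ξ t - 1‖ + 4 * s * N (e t) := by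
  have hα0 : 0 < α := (exp_pos _).trans_le hα
  have hD0 : 0 < D := by linarith
  have hq8 : 8000 ≤ q := by
    rw [hq, le_div_iff₀ hα0]; nlinarith
  have hq0 : 0 < q := by linarith
  have hqD : 8000 * D ≤ α * q := by rw [hq]; field_simp; exact le_rfl
  obtain ⟨p, hp, hp8, hpα, hpL⟩ := exists_moment hL hα
  obtain ⟨k, hk, hkα, hkL⟩ := exists_order hL hα
  set c : ℝ := α ^ (2 * (400 * (p + 1))) / 4 with hc
  have hc0 : 0 < c := by positivity
  have hcL : log (1 / c) ≤ 9000 * L ^ 2 := by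
    refine le_trans (le_of_eq ?_) (log_inv_pow_le hL hα hpL)
    rw [hc, one_div_div]
  obtain ⟨m, hm, hmk, hmL⟩ := exists_sample_size hL hk hkL hc0 hcL
  obtain ⟨M, hM, hMσ, hML⟩ := exists_chang_size hL (log_sample_le hL hmL hc0 hcL)
  have hk1 : (1 : ℝ) ≤ k := by exact_mod_cast hk
  have hm1 : (1 : ℝ) ≤ m := by exact_mod_cast hm
  have hM1 : (1 : ℝ) ≤ M := by exact_mod_cast hM
  set s₃ := 8 * D * q with hs₃
  have hs₃1 : 64000 ≤ s₃ := by nlinarith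
  have hs₃0 : 0 < s₃ := by linarith
  set δ₃ := 1 / (2 * q) with hδ₃
  have hδ₃0 : 0 < δ₃ := by positivity
  have hδ₃1 : δ₃ ≤ 1 / 16000 := by
    rw [hδ₃]
    exact one_div_le_one_div_of_le (by norm_num) (by linarith)
  set δ₄ := 1 / ((m + 4 * k) * s₃) with hδ₄
  have hδ₄0 : 0 < δ₄ := by positivity
  have hsδ₄ : s₃ * δ₄ * (m + 4 * k) = 1 := by rw [hδ₄]; field_simp
  set s₄ := 4 * D * (m + 4 * k) * s₃ with hs₄
  have hs₄0 : 0 < s₄ := by positivity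
  set s₅ := 8 * M * D * s₄ with hs₅
  have hN2 : ∀ x, N x ≤ 2 * N (e x) := by
    intro x
    have := h.add (e x) (e x)
    rw [he] at this; linarith
  have hmass : (1 / 2 : ℝ) ≤ ∑ y, gibbs (fun x => N (e x)) s₃ y *
      if N (e y) ≤ δ₃ then 1 else 0 := by
    refine le_trans (le_of_eq ?_) (h'.le_sum_gibbs_ite hs₃0 hδ₃0)
    rw [hs₃, hδ₃]; field_simp; norm_num
  set ω := truncated (fun x => N (e x)) s₃ δ₃ with hω
  have hω0 : ∀ x, 0 ≤ ω x := truncated_nonneg _ _ _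
  have hω1 : ∑ x, ω x = 1 := sum_truncated (by norm_num) hmass
  have hωδ : ∀ x, ω x ≠ 0 → N (e x) ≤ δ₃ := fun x hx =>
    truncated_support (N := fun x => N (e x)) (s := s₃) (x := x) hx
  have hωN : ∀ x, ω x ≠ 0 → N x ≤ 1 / 8000 := by
    intro x hx
    have := hωδ x hx
    have := hN2 x
    linarith
  have hκ0 := sum_gibbs_one_sq_pos N
  have hX := pow_le_sum_pow (gibbs N q) A (fun y => conv (balanced N A α) (balanced N A α) (y + y))
    (gibbs_nonneg N q) hA0 hA1 hκ0.le hα0 hq1 hq2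
    (h.half_le_sum_conv_balanced hA0 hA1 hfree hα0 hq0 hqD h2 hq1 hq2 hZ) hp (by omega) hpα
  rw [sum_comp_half N e he q fun x => conv (balanced N A α) (balanced N A α) x ^ p] at hX
  have hX' := h'.pow_le_sum_corr_pow hω0 hω1 hq0.le (by rw [hδ₃]; field_simp; exact le_rfl) hωδ hp
    (by omega) hκ0.le hX
  have hf := h.pow_le_sum_pairDensity hA0 hα0 h2 hω0 hω1 hωN hp hp8 hX'
  obtain ⟨μ, hμ0, hμ1, hμω, hμχ⟩ := h.exists_sifted hA0 hA1 hα0 hω0 hω1 hωN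
    (show 3600 ≤ 400 * (p + 1) by omega) hf
  have hμδ : ∀ x, μ x ≠ 0 → N (e x) ≤ δ₃ := by
    intro x hx
    refine hωδ x fun h0 => hx ?_
    have h1 := hμω x
    rw [h0] at h1
    have h3 : 0 < α ^ (2 * (400 * (p + 1))) / 2 := by positivity
    exact le_antisymm (nonpos_of_mul_nonpos_right h1 h3) (hμ0 x)
  have hμc : ∀ x, c * μ x ≤ gibbs (fun x => N (e x)) s₃ x := by
    intro x
    have h1 := mul_truncated_le (by norm_num) hmass x
    have h3 := hμω x
    rw [← hω] at h1
    rw [hc]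
    linarith
  obtain ⟨Y, Λ, hY0, hY1, hYδ, hYχ, hΛ, hYn, hYs⟩ := h'.exists_smoothing
    (χ := fun x => if 1.04 * (∑ y, gibbs N 1 y ^ 2) ≤ autocorr (restricted N A α) x then 1 else 0)
    (s := s₃) (s' := s₄) (s'' := s₅) (δ := δ₄) (M := M) hμ0 hμ1
    (fun x => by split_ifs <;> norm_num)
    (fun x => by split_ifs <;> norm_num)
    hc0 hs₃0 hs₄0 (by positivity) hδ₄0 hk hm hμc hμχ (by nlinarith) (by nlinarith)
    (by rw [hs₄, hδ₄]; field_simp; exact le_rfl) hmk le_rfl hMσ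
  refine ⟨μ, Y, Λ, s₅, hμ0, hμ1, fun x hx => (hμδ x hx).trans hδ₃1, hY0, hY1,
    fun T hT => (hYδ T hT).trans ?_, hYχ, ?_, ?_, ?_, hYn, fun ψ => ?_⟩
  · have : 2 * k * δ₄ * s₃ ≤ 1 := by nlinarith
    have h3 : 2 * k * δ₄ ≤ 1 / s₃ := (le_div_iff₀ hs₃0).2 this
    refine h3.trans (one_div_le_one_div_of_le (by norm_num) (by linarith))
  · linarith
  · exact one_le_scale hD hm1 hk1 hM1 hs₃1 hs₄ hs₅
  · exact scale_le hL hD hα0 hmL hkL (by positivity) (by positivity) hML hq hs₃ hs₄ hs₅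
  · rcases hYs ψ with h3 | h3
    · left; linarith
    · exact Or.inr h3

end Step

section Step

variable {G : Type*} [AddCommGroup G] [Fintype G] {N : G → ℝ}

lemma HasRank.const_mul {d : ℕ} {W s : ℝ} (h : HasRank N d W) (hs : 0 ≤ s) :
    HasRank (fun x => s * N x) d (s * W) := by
  have := h.add hs le_rfl ∅
  simpa using this

lemma HasRank.mono {d d' : ℕ} {W W' : ℝ} (h : HasRank N d W) (hd : d ≤ d') (hW : W ≤ W') :
    HasRank N d' W' := by
  obtain ⟨w, h0, h1, h2, h3⟩ := h
  exact ⟨w, h0, fun ψ => (h1 ψ).trans hW, h2.trans hd, h3⟩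

lemma norm_one_sub_hat_le {η : G → ℝ} (hη : ∀ x, 0 ≤ η x) (hη1 : ∑ x, η x = 1)
    (ψ : AddChar G ℂ) {c : ℝ} (hc : ∀ x, η x ≠ 0 → ‖ψ x - 1‖ ≤ c) : ‖1 - hat η ψ‖ ≤ c := by
  have e : 1 - hat η ψ = ∑ x, (η x : ℂ) * (1 - ψ x) := by
    have : (1 : ℂ) = ∑ x, (η x : ℂ) := by rw [← Complex.ofReal_sum, hη1, Complex.ofReal_one]
    rw [hat]
    simp_rw [mul_sub, mul_one, Finset.sum_sub_distrib]
    rw [← this]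
  rw [e]
  calc _ ≤ ∑ x, ‖(η x : ℂ) * (1 - ψ x)‖ := norm_sum_le _ _
    _ ≤ ∑ x, η x * c := by
      refine Finset.sum_le_sum fun x _ => ?_
      rw [norm_mul, Complex.norm_real, norm_of_nonneg (hη x), norm_sub_rev]
      rcases eq_or_ne (η x) 0 with h | h
      · simp [h]
      · exact mul_le_mul_of_nonneg_left (hc x h) (hη x)
    _ = c := by rw [← Finset.sum_mul, hη1, one_mul]

lemma spectral_weight_le {d ℓ D₁ D L α s : ℝ} (hd : 0 ≤ d) (hL : 1 ≤ L) (hα : exp (-L) ≤ α)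
    (hℓ : ℓ ≤ 10 ^ 18 * L ^ 6) (hD₁ : D₁ = 8 * (d + ℓ + 1)) (hD : D = 8 * (d + 1))
    (hℓ0 : 0 ≤ ℓ) (hs1 : 1 ≤ s) (hs : s ≤ 10 ^ 40 * L ^ 10 * D ^ 4 / α) :
    4 * 10 ^ 6 * D₁ * s / α + 10 ^ 6 * D₁ / α ≤ 10 ^ 71 * (d + 1) ^ 5 * exp (18 * L) := by
  have hα0 : 0 < α := (exp_pos _).trans_le hα
  have hLe : L ≤ exp L := by linarith [add_one_le_exp L]
  have hαe : 1 / α ≤ exp L := by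
    rw [div_le_iff₀ hα0]
    calc (1 : ℝ) = exp L * exp (-L) := by rw [← exp_add]; simp
      _ ≤ _ := by gcongr
  have hE : exp (18 * L) = exp L ^ 18 := by rw [← exp_nat_mul]; norm_num
  set E := exp L
  have hE1 : 1 ≤ E := hL.trans hLe
  have h1 : L ^ 6 ≤ E ^ 6 := by gcongr
  have h2 : L ^ 10 ≤ E ^ 10 := by gcongr
  have h3 : 1 ≤ E ^ 6 := one_le_pow₀ hE1
  have hD1 : D₁ ≤ 10 ^ 20 * E ^ 6 * (d + 1) := by
    rw [hD₁]
    nlinarith [mul_nonneg (show 0 ≤ E ^ 6 by positivity) hd]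
  have hD10 : 0 ≤ D₁ := by rw [hD₁]; positivity
  have hs2 : s ≤ 10 ^ 40 * E ^ 10 * (8 * (d + 1)) ^ 4 * E := by
    refine hs.trans ?_
    rw [div_eq_mul_one_div, hD]
    gcongr
  calc 4 * 10 ^ 6 * D₁ * s / α + 10 ^ 6 * D₁ / α
      = (4 * 10 ^ 6 * D₁ * s + 10 ^ 6 * D₁ * 1) * (1 / α) := by ring
    _ ≤ (4 * 10 ^ 6 * D₁ * s + 10 ^ 6 * D₁ * s) * (1 / α) := by gcongr
    _ = 5 * 10 ^ 6 * D₁ * s * (1 / α) := by ring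
    _ ≤ 5 * 10 ^ 6 * (10 ^ 20 * E ^ 6 * (d + 1)) *
        (10 ^ 40 * E ^ 10 * (8 * (d + 1)) ^ 4 * E) * E := by gcongr
    _ = (5 * 10 ^ 66 * 8 ^ 4) * ((d + 1) ^ 5 * E ^ 18) := by ring
    _ ≤ 10 ^ 71 * ((d + 1) ^ 5 * E ^ 18) := by gcongr; norm_num
    _ = _ := by rw [hE]; ring

lemma mul_le_of_mul_div_mul_le {a b D α u : ℝ} (hD : 0 < D) (hα : 0 < α)
    (h : a * D / α * u ≤ b * D) : a * u ≤ b * α := by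
  have e : a * D / α * u = a * u / α * D := by ring
  rw [e] at h
  exact (div_le_iff₀ hα).1 (le_of_mul_le_mul_right h hD)

set_option maxHeartbeats 400000 in
lemma HasRank.exists_increment {d : ℕ} {W : ℝ} (h : HasRank N d W) (hW : 1 ≤ W) (e : G ≃+ G)
    (he : ∀ x, e x + e x = x) {A : G → ℝ} (hA0 : ∀ x, 0 ≤ A x) (hA1 : ∀ x, A x ≤ 1)
    (hfree : ∀ x y z, x + z = y + y → A x ≠ 0 → A y ≠ 0 → A z ≠ 0 → x = y)
    {L α q : ℝ} (hL : 1 ≤ L) (hα : exp (-L) ≤ α) (hα1 : α ≤ 1)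
    (hq : q = 8000 * (8 * (d + 1)) / α)
    (h2 : (1 - 1 / 1000) * α ≤ ∑ y, gibbs N 2 y * A y)
    (h2' : ∑ y, gibbs N 2 y * A y ≤ (1 + 1 / 1000) * α)
    (hq1 : (1 - 1 / 1000) * α ≤ ∑ y, gibbs N q y * A y)
    (hq2 : ∑ y, gibbs N q y * A y ≤ (1 + 1 / 1000) * α)
    (hZ : 8 ≤ α ^ 2 * partition N 2) :
    ∃ (N' : G → ℝ) (d' : ℕ), HasRank N' d' (10 ^ 71 * (d + 1) ^ 5 * exp (18 * L) * W) ∧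
      (d' : ℝ) ≤ d + 10 ^ 18 * L ^ 6 ∧
      ∃ x, (1 + 1 / 5000) * α ≤ ∑ y, gibbs N' 1 y * A (x + y) := by
  have hα0 : 0 < α := (exp_pos _).trans_le hα
  have hB := h.isBohrLength
  have hR := h.comp_half e
  have hB' := hR.isBohrLength
  have hd0 : (0 : ℝ) ≤ d := d.cast_nonneg
  obtain ⟨μ, Y, Λ, s, hμ0, hμ1, hμδ, hY0, hY1, hYδ, hχ, hΛ, hs1, hs, hYn, hYs⟩ :=
    hB.exists_spectral_data (by linarith) e he hB' hA0 hA1 hfree hL hα hα1 hq h2 hq1 hq2 hZ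
  have hs0 : 0 < s := by linarith
  have hs6 : 0 ≤ 4 * 10 ^ 6 * (8 * ((d + #Λ : ℕ) + 1 : ℝ)) * s / α := by positivity
  have hw6 : 0 ≤ 10 ^ 6 * (8 * ((d + #Λ : ℕ) + 1 : ℝ)) / α := by positivity
  have hR1 := hR.add hs6 hw6 Λ
  have hB1 := hR1.isBohrLength
  have hsize := spectral_weight_le hd0 hL hα hΛ rfl rfl (by positivity) hs1 hs
  have hD1 : (8 : ℝ) ≤ 8 * ((d + #Λ : ℕ) + 1 : ℝ) := by
    have : (0 : ℝ) ≤ (d + #Λ : ℕ) := Nat.cast_nonneg _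
    linarith
  rw [← Nat.cast_add] at hsize
  set D₁ : ℝ := 8 * ((d + #Λ : ℕ) + 1 : ℝ) with hD₁
  set s₆ := 4 * 10 ^ 6 * D₁ * s / α with hs₆
  set w₆ := 10 ^ 6 * D₁ / α with hw₆
  have hD0 : 0 < D₁ := by linarith
  have hs₆0 : 0 < s₆ := by positivity
  have hw₆0 : 0 < w₆ := by positivity
  set N₁ : G → ℝ := fun x => s₆ * N (e x) + w₆ * ∑ ψ ∈ Λ, ‖ψ x - 1‖ with hN₁
  have hmass : (999 / 1000 : ℝ) ≤ ∑ y, gibbs N₁ 1 y * if N₁ y ≤ 2000 * D₁ then 1 else 0 := by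
    refine le_trans (le_of_eq ?_) (hB1.le_sum_gibbs_ite one_pos (by positivity))
    field_simp; norm_num
  have hη0 := truncated_nonneg N₁ 1 (2000 * D₁)
  have hη1 : ∑ x, truncated N₁ 1 (2000 * D₁) x = 1 := sum_truncated (by norm_num) hmass
  have hsum0 : ∀ x, 0 ≤ ∑ ψ ∈ Λ, ‖ψ x - 1‖ := fun x => Finset.sum_nonneg fun _ _ => norm_nonneg _
  have hN0 : ∀ x, 0 ≤ N (e x) := fun x => hB.nonneg _
  have hηN : ∀ x, truncated N₁ 1 (2000 * D₁) x ≠ 0 → s * N (e x) ≤ α / 2000 ∧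
      ∑ ψ ∈ Λ, ‖ψ x - 1‖ ≤ α / 500 := by
    intro x hx
    have h3 : s₆ * N (e x) + w₆ * ∑ ψ ∈ Λ, ‖ψ x - 1‖ ≤ 2000 * D₁ :=
      truncated_support (N := N₁) hx
    have h4 := mul_nonneg hs₆0.le (hN0 x)
    have h5 := mul_nonneg hw₆0.le (hsum0 x)
    constructor
    · have h6 : 4 * 10 ^ 6 * D₁ / α * (s * N (e x)) ≤ 2000 * D₁ := by
        have : 4 * 10 ^ 6 * D₁ / α * (s * N (e x)) = s₆ * N (e x) := by rw [hs₆]; ring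
        linarith
      have := mul_le_of_mul_div_mul_le hD0 hα0 h6
      linarith
    · have := mul_le_of_mul_div_mul_le hD0 hα0
        (show 10 ^ 6 * D₁ / α * ∑ ψ ∈ Λ, ‖ψ x - 1‖ ≤ 2000 * D₁ by rw [← hw₆]; linarith)
      linarith
  obtain ⟨x, hx⟩ := hB.exists_density_increment (N' := fun x => N (e x)) hB'.add hB'.neg
    (fun x => by
      have := hB.add (e x) (e x)
      rw [he] at this; linarith)
    hA0 hA1 hα0 h2' hμ0 hμ1 hY0 hY1 hη0 (δ := 1 / 16000) (δ' := 1 / 16000) (δ'' := 1 / 2000)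
    (by norm_num) hμδ hYδ (fun x hx => by
      have h3 := (hηN x hx).1
      have h4 := mul_le_mul_of_nonneg_right hs1 (hN0 x)
      linarith) hχ (fun ψ => by
      rcases hYs ψ with h3 | h3
      · refine le_trans (mul_le_mul_of_nonneg_left ?_ (norm_nonneg _)) h3
        refine norm_one_sub_hat_le hη0 hη1 ψ fun x _ => (norm_sub_le _ _).trans ?_
        rw [AddChar.norm_apply, norm_one]; norm_num
      · refine le_trans (mul_le_of_le_one_left (norm_nonneg _) (hYn ψ)) ?_
        refine norm_one_sub_hat_le hη0 hη1 ψ fun x hx => ?_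
        obtain ⟨h4, h5⟩ := hηN x hx
        have := h3 x (by linarith)
        linarith)
  refine ⟨N₁, d + #Λ, hR1.mono le_rfl ?_, by push_cast; linarith, x, ?_⟩
  · have : w₆ ≤ w₆ * W := le_mul_of_one_le_right hw₆0.le hW
    calc _ ≤ (s₆ + w₆) * W := by linarith
      _ ≤ _ := mul_le_mul_of_nonneg_right hsize (by linarith)
  · have h3 : 999 / 1000 * ∑ u, truncated N₁ 1 (2000 * D₁) u * A (x + u) ≤
        ∑ y, gibbs N₁ 1 y * A (x + y) := by
      rw [Finset.mul_sum]
      refine Finset.sum_le_sum fun u _ => ?_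
      rw [← mul_assoc]
      exact mul_le_mul_of_nonneg_right (mul_truncated_le (by norm_num) hmass u) (hA0 _)
    linarith

end Step

section Step

variable {G : Type*} [AddCommGroup G] [Fintype G] {N : G → ℝ}

lemma HasRank.log_card_le {d : ℕ} {W : ℝ} (h : HasRank N d W) (hW : 1 ≤ W) {L α : ℝ}
    (hα : exp (-L) ≤ α) (hZ : α ^ 2 * partition N 2 < 8) :
    log (Fintype.card G) ≤
      4 + 2 * L + (2 * log (4 * (d + 1) * W) + 1) * (8 * (d + 1)) := by
  have hα0 : 0 < α := (exp_pos _).trans_le hα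
  have hd0 : (0 : ℝ) ≤ d := d.cast_nonneg
  have hX : 1 ≤ 4 * ((d : ℝ) + 1) * W := by nlinarith
  have hX0 := log_nonneg hX
  set j := ⌈2 * log (4 * ((d : ℝ) + 1) * W)⌉₊ with hj
  have hj1 : 2 * log (4 * ((d : ℝ) + 1) * W) ≤ j := Nat.le_ceil _
  have hj2 : (j : ℝ) < 2 * log (4 * ((d : ℝ) + 1) * W) + 1 := Nat.ceil_lt_add_one (by positivity)
  have hpow : 2 * (2 * d * W) ≤ 2 ^ j := by
    have h1 : exp (1 / 2) ≤ 2 := by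
      calc exp (1 / 2) ≤ exp (log 2) := exp_le_exp.2 (by linarith [log_two_gt_d9])
        _ = 2 := exp_log two_pos
    calc 2 * (2 * d * W) ≤ 4 * (d + 1) * W := by nlinarith
      _ = exp (log (4 * (d + 1) * W)) := (exp_log (by linarith)).symm
      _ ≤ exp (j * (1 / 2)) := exp_le_exp.2 (by linarith)
      _ = exp (1 / 2) ^ j := exp_nat_mul _ _
      _ ≤ 2 ^ j := by gcongr
  have hc := h.isBohrLength.card_le (h.le (by linarith)) j two_pos hpow
  have hcard : (0 : ℝ) < Fintype.card G := by exact_mod_cast Fintype.card_pos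
  have hp := partition_pos N 2
  have hp8 : partition N 2 ≤ 8 * exp (2 * L) := by
    have h1 : exp (-(2 * L)) ≤ α ^ 2 := by
      calc exp (-(2 * L)) = exp (-L) ^ 2 := by rw [← exp_nat_mul]; congr 1; push_cast; ring
        _ ≤ _ := by gcongr
    have h2 : exp (-(2 * L)) * partition N 2 ≤ 8 :=
      (mul_le_mul_of_nonneg_right h1 hp.le).trans hZ.le
    rw [exp_neg, inv_mul_le_iff₀ (exp_pos _)] at h2
    linarith
  have h3 := log_le_log hcard hc
  rw [log_mul (exp_pos _).ne' hp.ne', log_exp] at h3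
  have h4 := log_le_log hp hp8
  rw [log_mul (by norm_num) (exp_pos _).ne', log_exp] at h4
  have h5 : log 8 ≤ 3 := by
    rw [show (8 : ℝ) = 2 ^ 3 by norm_num, log_pow]
    push_cast
    linarith [log_two_lt_d9]
  have h6 : (j : ℝ) * (8 * (d + 1)) ≤ (2 * log (4 * (d + 1) * W) + 1) * (8 * (d + 1)) := by gcongr
  linarith

lemma weight_le_weight {d L W α q : ℝ} (hd : 0 ≤ d) (hL : 1 ≤ L) (hα : exp (-L) ≤ α)
    (hq : q = 8000 * (8 * (d + 1)) / α) (hW : 1 ≤ W) :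
    2 * (10 ^ 4 * (8 * (d + 1))) * W ≤ 10 ^ 76 * (d + 1) ^ 6 * exp (18 * L) * W ∧
    q * (10 ^ 4 * (8 * (d + 1))) * W ≤ 10 ^ 76 * (d + 1) ^ 6 * exp (18 * L) * W := by
  have hα0 : 0 < α := (exp_pos _).trans_le hα
  have hαe : 1 / α ≤ exp (18 * L) := by
    rw [div_le_iff₀ hα0]
    calc (1 : ℝ) ≤ exp (18 * L) * exp (-L) := by rw [← exp_add]; exact one_le_exp (by linarith)
      _ ≤ _ := by gcongr
  have hE : 1 ≤ exp (18 * L) := one_le_exp (by linarith)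
  have h1 : d + 1 ≤ (d + 1) ^ 6 := le_self_pow₀ (by linarith) (by norm_num)
  have h2 : (d + 1) ^ 2 ≤ (d + 1) ^ 6 := pow_le_pow_right₀ (by linarith) (by norm_num)
  constructor
  · calc 2 * (10 ^ 4 * (8 * (d + 1))) * W = 160000 * (d + 1) * 1 * W := by ring
      _ ≤ _ := by gcongr; norm_num
  · calc q * (10 ^ 4 * (8 * (d + 1))) * W = 5120000000 * (d + 1) ^ 2 * (1 / α) * W := by
          rw [hq]; ring
      _ ≤ _ := by gcongr; norm_num

lemma HasRank.exists_step {d : ℕ} {W : ℝ} (h : HasRank N d W) (hW : 1 ≤ W) (e : G ≃+ G)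
    (he : ∀ x, e x + e x = x) {A : G → ℝ} (hA0 : ∀ x, 0 ≤ A x) (hA1 : ∀ x, A x ≤ 1)
    (hfree : ∀ x y z, x + z = y + y → A x ≠ 0 → A y ≠ 0 → A z ≠ 0 → x = y)
    {L α : ℝ} (hL : 1 ≤ L) (hα : exp (-L) ≤ α) {x₀ : G}
    (hx₀ : α ≤ ∑ y, gibbs N 1 y * A (x₀ + y)) :
    log (Fintype.card G) ≤ 300 * (d + 1) * (L + log (d + 1) + log W) ∨
    ∃ (N' : G → ℝ) (d' : ℕ), HasRank N' d' (10 ^ 76 * (d + 1) ^ 6 * exp (18 * L) * W) ∧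
      (d' : ℝ) ≤ d + 10 ^ 18 * L ^ 6 ∧
      ∃ x, (1 + 1 / 5000) * α ≤ ∑ y, gibbs N' 1 y * A (x + y) := by
  have hα0 : 0 < α := (exp_pos _).trans_le hα
  have hd0 : (0 : ℝ) ≤ d := d.cast_nonneg
  have hα1 : α ≤ 1 := by
    calc α ≤ ∑ y, gibbs N 1 y * A (x₀ + y) := hx₀
      _ ≤ ∑ y, gibbs N 1 y :=
        Finset.sum_le_sum fun y _ => mul_le_of_le_one_right (gibbs_nonneg _ _ _) (hA1 _)
      _ = 1 := sum_gibbs N 1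
  have hB := h.isBohrLength
  set s : ℝ := 10 ^ 4 * (8 * (d + 1)) with hs
  have hs0 : 0 < s := by positivity
  set q : ℝ := 8000 * (8 * (d + 1)) / α with hq
  have hq1 : 1 ≤ q := by
    rw [hq, le_div_iff₀ hα0]; linarith
  have hqs0 : 0 < q * s := by positivity
  obtain ⟨hw2, hwq⟩ := weight_le_weight hd0 hL hα hq hW
  have hL6 : (d : ℝ) ≤ d + 10 ^ 18 * L ^ 6 := by
    have : 0 ≤ L ^ 6 := by positivity
    linarith
  by_cases h2 : ∃ x, (1 + 1 / 5000) * α ≤ ∑ y, gibbs N (2 * s) y * A (x + y)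
  · obtain ⟨x, hx⟩ := h2
    refine Or.inr ⟨_, d, (h.const_mul (s := 2 * s) (by positivity)).mono le_rfl hw2, hL6, x, ?_⟩
    simpa only [gibbs_mul, mul_one] using hx
  by_cases h3 : ∃ x, (1 + 1 / 5000) * α ≤ ∑ y, gibbs N (q * s) y * A (x + y)
  · obtain ⟨x, hx⟩ := h3
    refine Or.inr ⟨_, d, (h.const_mul (s := q * s) (by positivity)).mono le_rfl hwq, hL6, x, ?_⟩
    simpa only [gibbs_mul, mul_one] using hx
  push Not at h2 h3
  obtain ⟨x, hx2, hxq⟩ := hB.exists_center hA0 (show 0 < 2 * s by positivity) hqs0 hα0.le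
    (c := 1 / 5000) (by linarith) (by nlinarith) hx₀ (fun x => (h2 x).le) (fun x => (h3 x).le)
  have hs1 := h.const_mul hs0.le
  have hsW : 1 ≤ s * W := by nlinarith
  rcases lt_or_ge (α ^ 2 * partition (fun y => s * N y) 2) 8 with hZ | hZ
  · left
    refine (hs1.log_card_le hsW hα hZ).trans ?_
    have hd1 : (0 : ℝ) < d + 1 := by positivity
    have e1 : log (4 * (d + 1) * (s * W)) = log 320000 + 2 * log (d + 1) + log W := by
      rw [show 4 * ((d : ℝ) + 1) * (s * W) = 320000 * (d + 1) ^ 2 * W by rw [hs]; ring,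
        log_mul (by positivity) (by positivity), log_mul (by norm_num) (by positivity), log_pow]
      norm_num
    have e2 : log 320000 ≤ 14 := by
      have : log 320000 ≤ log (2 ^ 20) := log_le_log (by norm_num) (by norm_num)
      rw [log_pow] at this
      push_cast at this
      linarith [log_two_lt_d9]
    have e3 : 0 ≤ log ((d : ℝ) + 1) := log_nonneg (by linarith)
    have e4 : 0 ≤ log W := log_nonneg hW
    rw [e1]
    have e5 : (2 * (log 320000 + 2 * log ((d : ℝ) + 1) + log W) + 1) * (8 * (d + 1)) ≤
        (29 * L + 4 * log (d + 1) + 2 * log W) * (8 * (d + 1)) :=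
      mul_le_mul_of_nonneg_right (by linarith) (by positivity)
    have e6 : 4 + 2 * L ≤ 6 * L * (d + 1) := by nlinarith
    nlinarith [mul_nonneg hd1.le e3, mul_nonneg hd1.le e4, mul_nonneg hd1.le (by linarith : 0 ≤ L)]
  · right
    have hg : ∀ t y, gibbs (fun y => s * N y) t y = gibbs N (t * s) y := fun t y => by
      rw [gibbs_mul, mul_comm]
    obtain ⟨N', d', hr, hd', x', hx'⟩ := hs1.exists_increment hsW e he
      (A := fun y => A (x + y)) (fun _ => hA0 _) (fun _ => hA1 _)
      (fun a b c hab ha hb hc => add_left_cancel (hfree (x + a) (x + b) (x + c)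
        (by rw [add_add_add_comm, hab, add_add_add_comm]) ha hb hc))
      hL hα hα1 hq
      (by simp only [hg]; linarith)
      (by simp only [hg]; linarith [h2 x])
      (by simp only [hg]; linarith)
      (by simp only [hg]; linarith [h3 x]) hZ
    refine ⟨N', d', hr.mono le_rfl ?_, hd', x + x', ?_⟩
    · rw [hs]
      have : 0 ≤ ((d : ℝ) + 1) ^ 6 * exp (18 * L) * W := by positivity
      calc _ = (10 ^ 75 * 8) * (((d : ℝ) + 1) ^ 6 * exp (18 * L) * W) := by ring
        _ ≤ 10 ^ 76 * (((d : ℝ) + 1) ^ 6 * exp (18 * L) * W) := by gcongr; norm_num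
        _ = _ := by ring
    · simpa only [add_assoc] using hx'

end Step

section Iteration

variable {G : Type*} [AddCommGroup G] [Fintype G]

lemma hasRank_zero : HasRank (fun _ : G => 0) 0 1 :=
  ⟨0, fun _ => le_rfl, fun _ => zero_le_one, by simp, by funext x; simp [charLength]⟩

lemma log_card_le_or_exists_iterate (e : G ≃+ G) (he : ∀ x, e x + e x = x) {A : G → ℝ}
    (hA0 : ∀ x, 0 ≤ A x) (hA1 : ∀ x, A x ≤ 1)
    (hfree : ∀ x y z, x + z = y + y → A x ≠ 0 → A y ≠ 0 → A z ≠ 0 → x = y)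
    {L α K P : ℝ} (hL : 1 ≤ L) (hα : exp (-L) ≤ α) (hsum : α * Fintype.card G ≤ ∑ x, A x)
    {n₀ : ℕ} (hK : K = 10 ^ 18 * L ^ 6)
    (hP : P = 10 ^ 76 * (n₀ * K + 1) ^ 6 * exp (18 * L)) :
    ∀ n ≤ n₀, log (Fintype.card G) ≤
        300 * (n₀ * K + 1) * (L + log (n₀ * K + 1) + n₀ * log P) ∨
      ∃ (N : G → ℝ) (d : ℕ), HasRank N d (P ^ n) ∧ (d : ℝ) ≤ n * K ∧
        ∃ x, (1 + 1 / 5000) ^ n * α ≤ ∑ y, gibbs N 1 y * A (x + y) := by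
  have hK0 : 0 ≤ K := by rw [hK]; positivity
  have hX : 1 ≤ n₀ * K + 1 := by
    have : 0 ≤ n₀ * K := by positivity
    linarith
  have hE : 1 ≤ exp (18 * L) := one_le_exp (by linarith)
  have hX6 : 1 ≤ (n₀ * K + 1) ^ 6 := one_le_pow₀ hX
  have hP1 : 1 ≤ P := by
    rw [hP]
    exact one_le_mul_of_one_le_of_one_le (one_le_mul_of_one_le_of_one_le (by norm_num) hX6) hE
  have hlogP := log_nonneg hP1
  intro n
  induction n with
  | zero =>
    refine fun _ => Or.inr ⟨_, 0, by simpa using hasRank_zero, by simp, 0, ?_⟩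
    have hcard : (0 : ℝ) < Fintype.card G := by exact_mod_cast Fintype.card_pos
    simp only [gibbs, partition, mul_zero, neg_zero, exp_zero, Finset.sum_const, Finset.card_univ,
      nsmul_eq_mul, mul_one, zero_add, pow_zero, one_mul]
    rw [← Finset.mul_sum, one_div, ← div_eq_inv_mul]
    exact (le_div_iff₀ hcard).2 hsum
  | succ n ih =>
    intro hn
    rcases ih (by omega) with h | ⟨N, d, hr, hd, x, hx⟩
    · exact Or.inl h
    have hnn : (n : ℝ) ≤ n₀ := by exact_mod_cast (by omega : n ≤ n₀)
    have hd₀ : (d : ℝ) ≤ n₀ * K := hd.trans (mul_le_mul_of_nonneg_right hnn hK0)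
    have hd0 : (0 : ℝ) ≤ d := d.cast_nonneg
    have hPn : 1 ≤ P ^ n := one_le_pow₀ hP1
    have hαn : exp (-L) ≤ (1 + 1 / 5000) ^ n * α :=
      hα.trans (le_mul_of_one_le_left ((exp_pos _).le.trans hα) (one_le_pow₀ (by norm_num)))
    rcases hr.exists_step hPn e he hA0 hA1 hfree hL hαn hx with h | ⟨N', d', hr', hd', x', hx'⟩
    · left
      refine h.trans ?_
      have h1 : log ((d : ℝ) + 1) ≤ log (n₀ * K + 1) := log_le_log (by linarith) (by linarith)
      have h2 : log (P ^ n) ≤ n₀ * log P := by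
        rw [log_pow]
        exact mul_le_mul_of_nonneg_right hnn hlogP
      have h3 : 0 ≤ log ((d : ℝ) + 1) := log_nonneg (by linarith)
      have h4 : 0 ≤ log (P ^ n) := log_nonneg hPn
      gcongr
    · right
      refine ⟨N', d', hr'.mono le_rfl ?_, ?_, x', ?_⟩
      · rw [pow_succ' P n]
        refine mul_le_mul_of_nonneg_right ?_ (by linarith)
        rw [hP]
        gcongr
      · push_cast
        rw [← hK] at hd'
        linarith
      · rw [pow_succ', mul_assoc]
        exact hx'

lemma iteration_bound_le {L : ℝ} (hL : 1 ≤ L) {n K P : ℝ} (hn0 : 0 ≤ n) (hn : n ≤ 20000 * L)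
    (hK : K = 10 ^ 18 * L ^ 6) (hP : P = 10 ^ 76 * (n * K + 1) ^ 6 * exp (18 * L)) :
    300 * (n * K + 1) * (L + log (n * K + 1) + n * log P) ≤ 10 ^ 34 * L ^ 9 := by
  have hK0 : 0 ≤ K := by rw [hK]; positivity
  have hL7 : 1 ≤ L ^ 7 := one_le_pow₀ hL
  have hX0 : 0 < n * K + 1 := by positivity
  have hX : n * K + 1 ≤ 10 ^ 23 * L ^ 7 := by
    have : n * K ≤ 20000 * L * (10 ^ 18 * L ^ 6) := by
      rw [hK]; gcongr
    have e : 20000 * L * (10 ^ 18 * L ^ 6) = 2 * 10 ^ 22 * L ^ 7 := by ring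
    linarith
  have hlog2 := log_two_lt_d9
  have hlogX : log (n * K + 1) ≤ 65 * L := by
    have h1 : log (n * K + 1) ≤ log (2 ^ 77 * L ^ 7) :=
      log_le_log hX0 (hX.trans (by gcongr; norm_num))
    rw [log_mul (by positivity) (by positivity), log_pow, log_pow] at h1
    have h2 := log_le_sub_one_of_pos (show 0 < L by linarith)
    push_cast at h1
    linarith
  have hlogP : log P ≤ 600 * L := by
    have h1 : log ((10 : ℝ) ^ 76) ≤ log (2 ^ 253) := log_le_log (by norm_num) (by norm_num)
    rw [log_pow 2 253] at h1
    push_cast at h1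
    rw [hP, log_mul (by positivity) (exp_pos _).ne', log_mul (by norm_num) (by positivity), log_exp,
      log_pow (n * K + 1) 6]
    push_cast
    linarith
  have h1 : n * log P ≤ 20000 * L * (600 * L) := by
    calc n * log P ≤ n * (600 * L) := mul_le_mul_of_nonneg_left hlogP hn0
      _ ≤ _ := by gcongr
  have h2 : L + log (n * K + 1) + n * log P ≤ 10 ^ 8 * L ^ 2 := by nlinarith
  calc 300 * (n * K + 1) * (L + log (n * K + 1) + n * log P)
      ≤ 300 * (n * K + 1) * (10 ^ 8 * L ^ 2) := by gcongr
    _ ≤ 300 * (10 ^ 23 * L ^ 7) * (10 ^ 8 * L ^ 2) := by gcongr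
    _ = 3 * 10 ^ 33 * L ^ 9 := by ring
    _ ≤ 10 ^ 34 * L ^ 9 := by gcongr; norm_num

/-- A dense subset of a group of odd order without nontrivial three-term progressions
forces the group to be small. -/
lemma log_card_le_of_threeAPFree (e : G ≃+ G) (he : ∀ x, e x + e x = x) {A : G → ℝ}
    (hA0 : ∀ x, 0 ≤ A x) (hA1 : ∀ x, A x ≤ 1)
    (hfree : ∀ x y z, x + z = y + y → A x ≠ 0 → A y ≠ 0 → A z ≠ 0 → x = y)
    {L : ℝ} (hL : 1 ≤ L) (hsum : exp (-L) * Fintype.card G ≤ ∑ x, A x) :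
    log (Fintype.card G) ≤ 10 ^ 34 * L ^ 9 := by
  set n := ⌈10000 * L⌉₊ + 1 with hn
  have hn1 : 10000 * L < n := by
    have := Nat.le_ceil (10000 * L)
    rw [hn]; push_cast; linarith
  have hn2 : (n : ℝ) ≤ 20000 * L := by
    have := Nat.ceil_lt_add_one (show 0 ≤ 10000 * L by positivity)
    rw [hn]; push_cast; linarith
  rcases log_card_le_or_exists_iterate e he hA0 hA1 hfree hL le_rfl hsum rfl rfl n le_rfl with
    h | ⟨N, d, -, -, x, hx⟩
  · exact h.trans (iteration_bound_le hL n.cast_nonneg hn2 rfl rfl)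
  · exfalso
    have h1 : ∑ y, gibbs N 1 y * A (x + y) ≤ 1 := by
      calc _ ≤ ∑ y, gibbs N 1 y :=
            Finset.sum_le_sum fun y _ => mul_le_of_le_one_right (gibbs_nonneg _ _ _) (hA1 _)
        _ = 1 := sum_gibbs N 1
    have h2 : exp (1 / 10000) ≤ 1 + 1 / 5000 := by
      rw [← le_log_iff_exp_le (by norm_num)]
      have := one_sub_inv_le_log_of_pos (show (0 : ℝ) < 1 + 1 / 5000 by norm_num)
      norm_num at this ⊢
      linarith
    have h3 : exp L < (1 + 1 / 5000) ^ n := by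
      calc exp L < exp (n * (1 / 10000)) := exp_lt_exp.2 (by linarith)
        _ = exp (1 / 10000) ^ n := exp_nat_mul _ _
        _ ≤ _ := by gcongr
    have h4 : 1 < (1 + 1 / 5000) ^ n * exp (-L) := by
      calc (1 : ℝ) = exp L * exp (-L) := by rw [← exp_add]; simp
        _ < _ := mul_lt_mul_of_pos_right h3 (exp_pos _)
    linarith

end Iteration

/-- Multiplication by the inverse of `2` modulo `2 * N + 1`. -/
def halving (N : ℕ) : ZMod (2 * N + 1) ≃+ ZMod (2 * N + 1) where
  toFun x := (N + 1) * x
  invFun x := x + x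
  left_inv x := by
    have h : ((2 * N + 1 : ℕ) : ZMod (2 * N + 1)) = 0 := ZMod.natCast_self _
    push_cast at h
    linear_combination x * h
  right_inv x := by
    have h : ((2 * N + 1 : ℕ) : ZMod (2 * N + 1)) = 0 := ZMod.natCast_self _
    push_cast at h
    linear_combination x * h
  map_add' x y := mul_add _ _ _

lemma eq_of_add_eq_add {N : ℕ} {S : Finset ℕ} (hS : S ⊆ Finset.Icc 1 N)
    (hfree : ¬ ∃ x d : ℕ, d ≠ 0 ∧ x ∈ S ∧ x + d ∈ S ∧ x + 2 * d ∈ S)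
    {a b c : ZMod (2 * N + 1)} (habc : a + c = b + b) (ha : a.val ∈ S) (hb : b.val ∈ S)
    (hc : c.val ∈ S) : a = b := by
  have ha' := Finset.mem_Icc.1 (hS ha)
  have hb' := Finset.mem_Icc.1 (hS hb)
  have hc' := Finset.mem_Icc.1 (hS hc)
  have h : a.val + c.val = b.val + b.val := by
    rw [← ZMod.val_add_of_lt (by omega), ← ZMod.val_add_of_lt (by omega), habc]
  by_contra hab
  have hne : a.val ≠ b.val := fun h => hab (ZMod.val_injective _ h)
  refine hfree ?_
  rcases lt_or_gt_of_ne hne with h1 | h1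
  · exact ⟨a.val, b.val - a.val, by omega, ha, by convert hb using 1; omega,
      by convert hc using 1; omega⟩
  · exact ⟨c.val, b.val - c.val, by omega, hc, by convert hb using 1; omega,
      by convert ha using 1; omega⟩

lemma log_le_of_threeAPFree {N : ℕ} (hN : 1 ≤ N) {S : Finset ℕ} (hS : S ⊆ Finset.Icc 1 N)
    (hfree : ¬ ∃ x d : ℕ, d ≠ 0 ∧ x ∈ S ∧ x + d ∈ S ∧ x + 2 * d ∈ S)
    (hne : S.Nonempty) : log N ≤ 10 ^ 34 * (2 + log (N / #S)) ^ 9 := by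
  have hN1 : (1 : ℝ) ≤ N := by exact_mod_cast hN
  have hS0 : (0 : ℝ) < #S := by exact_mod_cast hne.card_pos
  have hSN : (#S : ℝ) ≤ N := by
    have := Finset.card_le_card hS
    rw [Nat.card_Icc] at this
    exact_mod_cast (by omega : #S ≤ N)
  have hlog : 0 ≤ log (N / #S) := log_nonneg ((one_le_div hS0).2 hSN)
  have hcard : (Fintype.card (ZMod (2 * N + 1)) : ℝ) = 2 * N + 1 := by
    rw [ZMod.card]; push_cast; rfl
  have hsum : (#S : ℝ) ≤ ∑ x : ZMod (2 * N + 1), if x.val ∈ S then (1 : ℝ) else 0 := by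
    rw [Finset.sum_boole]
    norm_cast
    have hval : ∀ n ∈ S, ((n : ℕ) : ZMod (2 * N + 1)).val = n := fun n hn => by
      have := Finset.mem_Icc.1 (hS hn)
      exact ZMod.val_cast_of_lt (by omega)
    refine Finset.card_le_card_of_injOn (fun n => (n : ZMod (2 * N + 1))) (fun n hn => ?_)
      (fun m hm n hn hmn => ?_)
    · simpa [hval n hn] using hn
    · rw [← hval m hm, ← hval n hn]
      exact congrArg ZMod.val hmn
  have h := log_card_le_of_threeAPFree (halving N) (fun x => (halving N).left_inv x)
    (A := fun x => if x.val ∈ S then 1 else 0)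
    (fun x => by split_ifs <;> norm_num) (fun x => by split_ifs <;> norm_num)
    (fun a b c habc ha hb hc => eq_of_add_eq_add hS hfree habc (by by_contra h; simp [h] at ha)
      (by by_contra h; simp [h] at hb) (by by_contra h; simp [h] at hc))
    (L := 2 + log (N / #S)) (by linarith) (by
      refine le_trans ?_ hsum
      rw [hcard, neg_add, exp_add, exp_neg (log _), exp_log (by positivity), inv_div]
      have h2 : exp (-2) ≤ 1 / 3 := by
        rw [exp_neg, one_div]
        exact inv_anti₀ (by norm_num) (by linarith [add_one_le_exp (2 : ℝ)])
      calc exp (-2) * (#S / N) * (2 * N + 1) ≤ 1 / 3 * (#S / N) * (3 * N) := by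
            gcongr; linarith
        _ = #S := by field_simp)
  rw [hcard] at h
  exact (log_le_log (by linarith) (by linarith)).trans h

end KelleyMeka

/-- Bloom–Sisask refinement of Kelley–Meka: progression-free subsets of `{1,...,N}` have size at most
`N · exp(−c (log N)^{1/9})`. -/
theorem bloom_sisask_refinement :
    ∃ c : ℝ, 0 < c ∧ ∃ N₀ : ℕ, ∀ N : ℕ, N₀ < N →
      ∀ S : Finset ℕ, S ⊆ Finset.Icc 1 N →
        (¬ ∃ x d : ℕ, d ≠ 0 ∧ x ∈ S ∧ x + d ∈ S ∧ x + 2 * d ∈ S) →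
        (S.card : ℝ) ≤ (N : ℝ) * Real.exp (-c * Real.log N ^ ((1 : ℝ) / 9)) := by
  have hT : Filter.Tendsto (fun n : ℕ => Real.log n ^ ((1 : ℝ) / 9)) Filter.atTop Filter.atTop :=
    (tendsto_rpow_atTop (by norm_num)).comp
      (Real.tendsto_log_atTop.comp tendsto_natCast_atTop_atTop)
  obtain ⟨N₀, hN₀⟩ := Filter.eventually_atTop.1 (hT.eventually_ge_atTop 40000)
  refine ⟨1 / 20000, by norm_num, N₀ + 1, fun N hN S hS hfree => ?_⟩
  have hX := hN₀ N (by omega)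
  rcases S.eq_empty_or_nonempty with rfl | hne
  · simpa using by positivity
  have hN1 : (1 : ℝ) ≤ N := by exact_mod_cast (by omega : 1 ≤ N)
  have hS0 : (0 : ℝ) < S.card := by exact_mod_cast hne.card_pos
  have h := KelleyMeka.log_le_of_threeAPFree (by omega) hS hfree hne
  set X := Real.log N ^ ((1 : ℝ) / 9) with hXdef
  have hX9 : X ^ 9 = Real.log N := by
    rw [hXdef, ← Real.rpow_natCast, ← Real.rpow_mul (Real.log_nonneg hN1)]
    norm_num
  have hb : X < 10000 * (2 + Real.log (N / S.card)) := by
    have hSN : (S.card : ℝ) ≤ N := by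
      have := Finset.card_le_card hS
      rw [Nat.card_Icc] at this
      exact_mod_cast (by omega : S.card ≤ N)
    have hlog := Real.log_nonneg ((one_le_div hS0).2 hSN)
    by_contra! hle
    have h9 := pow_le_pow_left₀ (by positivity) hle 9
    rw [hX9, mul_pow] at h9
    have : 0 < (2 + Real.log (N / S.card)) ^ 9 := by positivity
    linarith
  have hlog : 1 / 20000 * X ≤ Real.log (N / S.card) := by linarith
  rw [Real.le_log_iff_exp_le (by positivity), le_div_iff₀ hS0] at hlog
  rw [neg_mul, Real.exp_neg, ← div_eq_mul_inv, le_div_iff₀ (Real.exp_pos _), mul_comm]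
  exact hlog
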